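/- arXiv:1404.6739 — 5 statements merged into one kernel-verified Lean document; each statement's English description precedes it below -/
import Mathlib

section
/- For every real number c with 0 < c < 1/2 there exists a natural number n₀ such that the following holds. Let X be a finite set with n := |X| ≥ n₀ and let G ≤ Sym(X) be primitive with G ≠ Alt(X). For Y ⊆ X write Y^G := {g(Y) : g ∈ G}; note G ≤ Aut(X, Y^G) always. Then the number of subsets Y of X for which Aut(X, Y^G) is strictly larger than G is less than 2^n · exp(−n^c). -/
/-- A subgroup `G ≤ Sym(X)` is primitive if its natural action on `X` is transitive
and every `G`-block is trivial (i.e. the action is preprimitive). -/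
def IsPrimitiveSubgroup {X : Type*} (G : Subgroup (Equiv.Perm X)) : Prop :=
  MulAction.IsPretransitive G X ∧ ∀ B : Set X, MulAction.IsBlock G B → MulAction.IsTrivialBlock B

/-- The orbit `Y^G` of a subset `Y ⊆ X` under a subgroup `G ≤ Sym(X)`. -/
def setOrbit {X : Type*} (G : Subgroup (Equiv.Perm X)) (Y : Set X) : Set (Set X) :=
  {Z | ∃ g ∈ G, (g : X → X) '' Y = Z}

/-- The automorphism group of a family of subsets, as a set of permutations. -/
def setAut {X : Type*} (ℬ : Set (Set X)) : Set (Equiv.Perm X) :=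
  {σ | (fun Y : Set X => (σ : X → X) '' Y) '' ℬ = ℬ}

section Counting

open Finset
open scoped Classical

/-- Averaging over a transitive orbit. -/
theorem card_mul_sum_smul {G Z : Type*} [Group G] [Fintype G] [MulAction G Z] (S : Finset Z)
    (hinv : ∀ g : G, ∀ z ∈ S, g • z ∈ S) (htr : ∀ z ∈ S, ∀ w ∈ S, ∃ g : G, g • z = w)
    (F : Z → ℝ) {z : Z} (hz : z ∈ S) :
    (#S : ℝ) * ∑ g : G, F (g • z) = Fintype.card G * ∑ w ∈ S, F w := by
  have h1 : ∀ w ∈ S, ∑ g : G, F (g • w) = ∑ g : G, F (g • z) := by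
    intro w hw
    obtain ⟨k, rfl⟩ := htr z hz w hw
    exact Fintype.sum_equiv (Equiv.mulRight k) _ _ fun g => by simp [mul_smul]
  calc (#S : ℝ) * ∑ g : G, F (g • z) = ∑ w ∈ S, ∑ g : G, F (g • w) := by
        rw [Finset.sum_congr rfl h1]; simp
    _ = ∑ g : G, ∑ w ∈ S, F (g • w) := Finset.sum_comm
    _ = ∑ _g : G, ∑ w ∈ S, F w := by
        refine Finset.sum_congr rfl fun g _ => ?_
        refine Finset.sum_bij' (fun w _ => g • w) (fun w _ => g⁻¹ • w) ?_ ?_ ?_ ?_ ?_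
        · exact fun w hw => hinv g w hw
        · exact fun w hw => hinv g⁻¹ w hw
        · simp
        · simp
        · simp
    _ = _ := by simp

/-- If every row of `f` has average at most `θ`, some sequence of columns makes the sum of
the row products at most `|I| θ ^ r`. -/
theorem exists_sum_prod_le {I Γ : Type*} [Fintype I] [Fintype Γ] [Nonempty Γ]
    (f : I → Γ → ℝ) (hf : ∀ i γ, 0 ≤ f i γ) (θ : ℝ)
    (hθ : ∀ i, ∑ γ, f i γ ≤ θ * Fintype.card Γ) (r : ℕ) :
    ∃ γ : Fin r → Γ, ∑ i, ∏ j, f i (γ j) ≤ Fintype.card I * θ ^ r := by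
  have key : ∑ γ : Fin r → Γ, ∑ i, ∏ j, f i (γ j) ≤
      ∑ _γ : Fin r → Γ, Fintype.card I * θ ^ r := by
    rw [Finset.sum_comm]
    have : ∀ i, ∑ γ : Fin r → Γ, ∏ j, f i (γ j) = (∑ γ, f i γ) ^ r := by
      intro i
      rw [← Fin.prod_const, Finset.prod_univ_sum]
      simp
    simp only [this]
    calc ∑ i, (∑ γ, f i γ) ^ r ≤ ∑ _i : I, (θ * Fintype.card Γ) ^ r :=
          Finset.sum_le_sum fun i _ =>
            pow_le_pow_left₀ (Finset.sum_nonneg fun γ _ => hf i γ) (hθ i) r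
      _ = _ := by simp [mul_pow]; ring
  obtain ⟨γ, -, hγ⟩ := Finset.exists_le_of_sum_le (s := univ) univ_nonempty key
  exact ⟨γ, hγ⟩

/-- A map moving many points is compatible with few subsets. -/
theorem ncard_invariant_sets_mul_le {X : Type*} [Fintype X] (f : X → X) (k : ℕ)
    (hk : 2 * k ≤ #{x | f x ≠ x}) :
    {Y : Set X | ∀ x, x ∈ Y ↔ f x ∈ Y}.ncard * 2 ^ k ≤ 2 ^ Fintype.card X := by
  let s : Setoid X := Relation.EqvGen.setoid fun a b => f a = b
  have hs : ∀ x, (Quotient.mk s (f x)) = Quotient.mk s x := fun x =>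
    Quotient.sound ((Relation.EqvGen.rel x (f x) rfl).symm)
  have hcard : Fintype.card (Quotient s) + k ≤ Fintype.card X := by
    have h1 : ∀ q : Quotient s, 2 + #{x | Quotient.mk s x = q ∧ f x ≠ x} ≤
        2 * #{x | Quotient.mk s x = q} := by
      intro q
      obtain ⟨a, rfl⟩ := Quotient.exists_rep q
      have hle : #{x | Quotient.mk s x = Quotient.mk s a ∧ f x ≠ x} ≤
          #{x | Quotient.mk s x = Quotient.mk s a} :=
        card_le_card fun x hx => by simp only [mem_filter] at hx ⊢; tauto
      have ha : a ∈ ({x | Quotient.mk s x = Quotient.mk s a} : Finset X) := by simp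
      rcases Nat.lt_or_ge #{x | Quotient.mk s x = Quotient.mk s a} 2 with h | h
      · have hone : #{x | Quotient.mk s x = Quotient.mk s a} = 1 := by
          have := card_pos.2 ⟨a, ha⟩; omega
        obtain ⟨b, hb⟩ := card_eq_one.1 hone
        have hzero : #{x | Quotient.mk s x = Quotient.mk s a ∧ f x ≠ x} = 0 := by
          rw [card_eq_zero, filter_eq_empty_iff]
          rintro x - ⟨hx, hfx⟩
          have h1 : x ∈ ({x | Quotient.mk s x = Quotient.mk s a} : Finset X) := by simpa using hx
          have h2 : f x ∈ ({x | Quotient.mk s x = Quotient.mk s a} : Finset X) := by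
            simpa [hs] using hx
          rw [hb, mem_singleton] at h1 h2
          exact hfx (h2.trans h1.symm)
        omega
      · omega
    have h2 := Finset.sum_le_sum fun q (_ : q ∈ (univ : Finset (Quotient s))) => h1 q
    rw [Finset.sum_add_distrib, ← Finset.mul_sum] at h2
    have h3 : ∑ q : Quotient s, #{x | Quotient.mk s x = q} = Fintype.card X := by
      rw [← Finset.card_univ]
      exact (Finset.card_eq_sum_card_fiberwise (f := Quotient.mk s) (by simp)).symm
    have h4 : ∑ q : Quotient s, #{x | Quotient.mk s x = q ∧ f x ≠ x} = #{x | f x ≠ x} := by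
      rw [Finset.card_eq_sum_card_fiberwise (s := {x | f x ≠ x}) (t := univ)
        (f := Quotient.mk s) (by simp)]
      refine Finset.sum_congr rfl fun q _ => ?_
      rw [Finset.filter_filter]
      simp only [and_comm]
    rw [h3, h4] at h2
    simp only [sum_const, card_univ, smul_eq_mul] at h2
    omega
  have hle : {Y : Set X | ∀ x, x ∈ Y ↔ f x ∈ Y}.ncard ≤ 2 ^ Fintype.card (Quotient s) := by
    have : {Y : Set X | ∀ x, x ∈ Y ↔ f x ∈ Y} ⊆
        Set.range fun Q : Set (Quotient s) => {x | Quotient.mk s x ∈ Q} := by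
      intro Y hY
      have hrel : ∀ a b, Relation.EqvGen (fun a b => f a = b) a b → (a ∈ Y ↔ b ∈ Y) := by
        intro a b hab
        induction hab with
        | rel a b h => rw [← h]; exact hY a
        | refl => rfl
        | symm _ _ _ ih => exact ih.symm
        | trans _ _ _ _ _ ih1 ih2 => exact ih1.trans ih2
      refine ⟨{q | ∃ a ∈ Y, Quotient.mk s a = q}, ?_⟩
      ext x
      constructor
      · rintro ⟨a, ha, hax⟩
        exact (hrel a x (Quotient.exact hax)).1 ha
      · exact fun hx => ⟨x, hx, rfl⟩
    refine (Set.ncard_le_ncard this (Set.toFinite _)).trans ?_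
    rw [← Set.image_univ]
    refine (Set.ncard_image_le (Set.toFinite _)).trans ?_
    rw [Set.ncard_univ, Nat.card_eq_fintype_card, Fintype.card_set]
  calc _ ≤ 2 ^ Fintype.card (Quotient s) * 2 ^ k := Nat.mul_le_mul_right _ hle
    _ = 2 ^ (Fintype.card (Quotient s) + k) := (pow_add _ _ _).symm
    _ ≤ _ := Nat.pow_le_pow_right (by norm_num) hcard

/-- A set of subsets covered by few families, each of size at most `2 ^ (n - k)`. -/
theorem ncard_mul_le_of_cover {X C : Type*} [Fintype X] [Fintype C] (T : Set (Set X))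
    (A : C → Set (Set X)) (k n M : ℕ) (hM : Fintype.card C ≤ M)
    (hT : ∀ Y ∈ T, ∃ c, Y ∈ A c ∧ (A c).ncard * 2 ^ k ≤ 2 ^ n) :
    T.ncard * 2 ^ k ≤ M * 2 ^ n := by
  let D : Finset C := {c | (A c).ncard * 2 ^ k ≤ 2 ^ n}
  have hsub : T ⊆ ⋃ c ∈ D, A c := by
    intro Y hY
    obtain ⟨c, hc, hc'⟩ := hT Y hY
    simp only [Set.mem_iUnion]
    exact ⟨c, by simpa [D] using hc', hc⟩
  calc T.ncard * 2 ^ k ≤ (∑ c ∈ D, (A c).ncard) * 2 ^ k := by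
        refine Nat.mul_le_mul_right _ ?_
        exact (Set.ncard_le_ncard hsub (Set.toFinite _)).trans (Finset.set_ncard_biUnion_le D A)
    _ = ∑ c ∈ D, (A c).ncard * 2 ^ k := Finset.sum_mul _ _ _
    _ ≤ ∑ _c ∈ D, 2 ^ n := Finset.sum_le_sum fun c hc => by simpa [D] using hc
    _ = #D * 2 ^ n := by simp
    _ ≤ M * 2 ^ n := Nat.mul_le_mul_right _ ((Finset.card_le_univ D).trans hM)

end Counting

section Rigidity

open Finset
open scoped Classical

variable {X : Type*} [Fintype X]

theorem card_mul_sum_perm (G : Subgroup (Equiv.Perm X)) (htr : ∀ x y : X, ∃ g ∈ G, g x = y)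
    (F : X → ℝ) (x : X) :
    (Fintype.card X : ℝ) * ∑ g : G, F (g.1 x) = Fintype.card G * ∑ w, F w := by
  have := card_mul_sum_smul (G := G) (univ : Finset X) (by simp)
    (fun z _ w _ => by obtain ⟨g, hg, h⟩ := htr z w; exact ⟨⟨g, hg⟩, h⟩) F (mem_univ x)
  simpa [Subgroup.smul_def] using this

/-- A random element of a group moves each point that is not fixed by the group with
probability at least one half. -/
theorem card_mul_card_le_two_mul_sum (P : Subgroup (Equiv.Perm X)) (Z : Finset X)
    (hZ : ∀ x ∈ Z, ∃ k ∈ P, k x ≠ x) :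
    Fintype.card P * #Z ≤ 2 * ∑ h : P, #{x ∈ Z | h.1 x ≠ x} := by
  have hx : ∀ x ∈ Z, Fintype.card P ≤ 2 * #{h : P | h.1 x ≠ x} := by
    intro x hxZ
    obtain ⟨k, hk, hkx⟩ := hZ x hxZ
    have h1 : #{h : P | h.1 x = x} ≤ #{h : P | h.1 x ≠ x} := by
      refine card_le_card_of_injOn (fun h => ⟨k, hk⟩ * h) ?_ ?_
      · intro h hh
        have hh : h.1 x = x := by simpa using hh
        simp [hh, hkx]
      · intro a _ b _ hab
        exact mul_left_cancel hab
    have h2 := Finset.card_filter_add_card_filter_not (s := (univ : Finset P))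
      (fun h : P => h.1 x = x)
    rw [card_univ] at h2
    simp only [← ne_eq] at h2
    omega
  have hswap : ∑ h : P, #{x ∈ Z | h.1 x ≠ x} = ∑ x ∈ Z, #{h : P | h.1 x ≠ x} := by
    simp only [card_filter]
    exact Finset.sum_comm
  rw [hswap, Finset.mul_sum, mul_comm]
  simpa using Finset.sum_le_sum hx

/-- Some element of a permutation group moves at least half of the points that are not fixed
by the whole group. -/
theorem exists_card_le_two_mul_moved (P : Subgroup (Equiv.Perm X)) :
    ∃ h ∈ P, #{x : X | ∃ k ∈ P, k x ≠ x} ≤ 2 * #{x | h x ≠ x} := by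
  have h := card_mul_card_le_two_mul_sum P {x : X | ∃ k ∈ P, k x ≠ x} (by simp)
  have h' : ∑ _h : P, #{x : X | ∃ k ∈ P, k x ≠ x} ≤
      ∑ h : P, 2 * #{x ∈ {x : X | ∃ k ∈ P, k x ≠ x} | h.1 x ≠ x} := by
    rw [← Finset.mul_sum]; simpa using h
  obtain ⟨g, -, hg⟩ := Finset.exists_le_of_sum_le (s := univ) ⟨1, mem_univ _⟩ h'
  refine ⟨g.1, g.2, hg.trans ?_⟩
  refine Nat.mul_le_mul_left _ (card_le_card ?_)
  intro x hx
  simp only [mem_filter] at hx ⊢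
  exact ⟨mem_univ _, hx.2⟩

/-- If the points not fixed by `P` are few and `P` is carried into itself by the double cosets
of `G`, every element of `P` is a pointwise majority vote of elements of `G` of small support. -/
theorem exists_majority (G P : Subgroup (Equiv.Perm X)) (htr : ∀ x y : X, ∃ g ∈ G, g x = y)
    (hP : ∀ h ∈ P, ∀ g ∈ G, ∃ t ∈ G, g⁻¹ * t⁻¹ * h * g ∈ P)
    (hU : 16 * #{x : X | ∃ k ∈ P, k x ≠ x} ≤ Fintype.card X)
    (r : ℕ) (hr : Fintype.card X < 2 ^ r) (h : Equiv.Perm X) (hh : h ∈ P) :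
    ∃ t : Fin r → Equiv.Perm X, (∀ i, t i ∈ G) ∧
      (∀ i, #{x | t i x ≠ x} ≤ #{x | h x ≠ x} + #{x : X | ∃ k ∈ P, k x ≠ x}) ∧
      ∀ x, 2 * #{i | t i x ≠ h x} < r := by
  set U : Finset X := {x : X | ∃ k ∈ P, k x ≠ x} with hUdef
  rcases isEmpty_or_nonempty X with hX | hX
  · exact ⟨fun _ => 1, fun _ => G.one_mem, fun i => by simp, fun x => (IsEmpty.false x).elim⟩
  have hn : (0 : ℝ) < Fintype.card X := by exact_mod_cast Fintype.card_pos
  obtain ⟨γ, hγ⟩ := exists_sum_prod_le (I := X) (Γ := G)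
    (fun x g => if g.1 x ∈ U then 16 else 1) (fun x g => by split_ifs <;> norm_num) 2 (by
      intro x
      have h1 := card_mul_sum_perm G htr (fun w => if w ∈ U then 16 else 1) x
      have h2 : ∑ w : X, (if w ∈ U then (16 : ℝ) else 1) ≤ 2 * Fintype.card X := by
        have : ∀ w : X, (if w ∈ U then (16 : ℝ) else 1) = 1 + if w ∈ U then 15 else 0 := by
          intro w; split_ifs <;> norm_num
        simp only [this, Finset.sum_add_distrib]
        rw [← Finset.sum_filter]
        have h3 : (16 : ℝ) * #U ≤ Fintype.card X := by exact_mod_cast hU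
        have h4 : filter (fun w => w ∈ U) univ = U := by ext; simp
        rw [h4]
        simp only [sum_const, card_univ, nsmul_eq_mul, mul_one]
        linarith
      have h5 : (0 : ℝ) ≤ Fintype.card G := by positivity
      have h6 := mul_le_mul_of_nonneg_left h2 h5
      rw [← h1] at h6
      refine le_of_mul_le_mul_left ?_ hn
      linarith) r
  have hbad : ∀ x, 2 * #{i | (γ i).1 x ∈ U} < r := by
    intro x
    have h1 : ∏ j, (if (γ j).1 x ∈ U then (16 : ℝ) else 1) = 16 ^ #{i | (γ i).1 x ∈ U} := by
      rw [← Finset.prod_filter]; simp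
    have h2 : ∏ j, (if (γ j).1 x ∈ U then (16 : ℝ) else 1) ≤ Fintype.card X * 2 ^ r := by
      refine le_trans ?_ hγ
      exact Finset.single_le_sum (f := fun x => ∏ j, (if (γ j).1 x ∈ U then (16 : ℝ) else 1))
        (fun y _ => Finset.prod_nonneg fun j _ => by split_ifs <;> norm_num) (mem_univ x)
    rw [h1] at h2
    have h3 : 16 ^ #{i | (γ i).1 x ∈ U} ≤ Fintype.card X * 2 ^ r := by exact_mod_cast h2
    have h4 : 2 ^ (4 * #{i | (γ i).1 x ∈ U}) < 2 ^ (r + r) := by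
      rw [pow_mul, pow_add]
      calc _ = 16 ^ #{i | (γ i).1 x ∈ U} := by norm_num
        _ ≤ _ := h3
        _ < _ := Nat.mul_lt_mul_of_pos_right hr (by positivity)
    have := (Nat.pow_lt_pow_iff_right (by norm_num : 1 < 2)).1 h4
    omega
  choose t ht htP using fun i => hP h hh (γ i)⁻¹.1 (γ i)⁻¹.2
  have hfix : ∀ i x, (γ i).1 x ∉ U → ((t i)⁻¹ * h) x = x := by
    intro i x hx
    have h1 : ∀ k ∈ P, k ((γ i).1 x) = (γ i).1 x := by
      intro k hk
      by_contra hne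
      exact hx (by simp only [hUdef, mem_filter]; exact ⟨mem_univ _, k, hk, hne⟩)
    have h2 := h1 _ (htP i)
    have h3 : (γ i).1 (((t i)⁻¹ * h) x) = (γ i).1 x := by simpa [Equiv.Perm.mul_apply] using h2
    exact (γ i).1.injective h3
  have hne : ∀ i x, t i x ≠ h x → (γ i).1 x ∈ U := by
    intro i x hx
    by_contra hU'
    have := hfix i x hU'
    rw [Equiv.Perm.mul_apply, Equiv.Perm.inv_eq_iff_eq] at this
    exact hx this.symm
  refine ⟨t, ht, fun i => ?_, fun x => lt_of_le_of_lt (Nat.mul_le_mul_left _ (card_le_card ?_))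
    (hbad x)⟩
  · have hsub : ({x | t i x ≠ x} : Finset X) ⊆
        ({x | h x ≠ x} : Finset X) ∪ U.image fun y => (γ i).1⁻¹ y := by
      intro x hx
      simp only [mem_union, mem_filter, mem_univ, true_and, mem_image] at hx ⊢
      by_cases hxt : t i x = h x
      · exact Or.inl (hxt ▸ hx)
      · exact Or.inr ⟨_, hne i x hxt, by simp⟩
    exact (card_le_card hsub).trans ((card_union_le _ _).trans
      (Nat.add_le_add_left card_image_le _))
  · intro i hi
    simp only [mem_filter, mem_univ, true_and] at hi ⊢
    exact hne i x hi

/-- A group with a base of size `K` has few elements of small support. -/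
theorem card_moved_le (G : Subgroup (Equiv.Perm X)) (htr : ∀ x y : X, ∃ g ∈ G, g x = y)
    (B : Finset X) (hB : ∀ g ∈ G, (∀ x ∈ B, g x = x) → g = 1) (k j : ℕ)
    (hj : 2 * #B * k < Fintype.card X * (j + 1)) :
    #{t : G | #{x | t.1 x ≠ x} ≤ k} ≤ 2 * Fintype.card X ^ (2 * j) := by
  set T : Finset G := {t : G | #{x | t.1 x ≠ x} ≤ k} with hT
  have hXpos : 0 < Fintype.card X := by
    rcases Nat.eq_zero_or_pos (Fintype.card X) with h | h
    · simp [h] at hj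
    · exact h
  have hX : Nonempty X := Fintype.card_pos_iff.1 hXpos
  -- a translate of the base meets the support of half the elements in few points
  have hdc : ∃ g : G, #T ≤ 2 * #{t ∈ T | #{b ∈ B | t.1 (g.1 b) ≠ g.1 b} ≤ j} := by
    have hone : ∀ t ∈ T, Fintype.card G ≤ 2 * #{g : G | #{b ∈ B | t.1 (g.1 b) ≠ g.1 b} ≤ j} := by
      intro t ht
      have h1 : (Fintype.card X : ℝ) * ∑ g : G, (#{b ∈ B | t.1 (g.1 b) ≠ g.1 b} : ℝ) ≤
          Fintype.card G * (#B * k) := by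
        have h2 : ∀ g : G, (#{b ∈ B | t.1 (g.1 b) ≠ g.1 b} : ℝ) =
            ∑ b ∈ B, if t.1 (g.1 b) ≠ g.1 b then 1 else 0 := by
          intro g; rw [card_filter]; push_cast; rfl
        simp only [h2]
        rw [Finset.sum_comm, Finset.mul_sum]
        have h3 : ∀ b ∈ B, (Fintype.card X : ℝ) * ∑ g : G,
            (if t.1 (g.1 b) ≠ g.1 b then (1 : ℝ) else 0) ≤ Fintype.card G * k := by
          intro b _
          rw [card_mul_sum_perm G htr (fun w => if t.1 w ≠ w then 1 else 0) b]
          refine mul_le_mul_of_nonneg_left ?_ (by positivity)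
          rw [Finset.sum_ite]
          simp only [sum_const, nsmul_eq_mul, mul_one, mul_zero, add_zero]
          exact_mod_cast (mem_filter.1 ht).2
        calc _ ≤ ∑ b ∈ B, (Fintype.card G * k : ℝ) := Finset.sum_le_sum h3
          _ = _ := by simp; ring
      have h1' : Fintype.card X * ∑ g : G, #{b ∈ B | t.1 (g.1 b) ≠ g.1 b} ≤
          Fintype.card G * (#B * k) := by exact_mod_cast h1
      have h4 : (j + 1) * #{g : G | ¬ #{b ∈ B | t.1 (g.1 b) ≠ g.1 b} ≤ j} ≤
          ∑ g : G, #{b ∈ B | t.1 (g.1 b) ≠ g.1 b} := by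
        calc _ = ∑ g ∈ ({g : G | ¬ #{b ∈ B | t.1 (g.1 b) ≠ g.1 b} ≤ j} : Finset G), (j + 1) := by
              simp [mul_comm]
          _ ≤ ∑ g ∈ ({g : G | ¬ #{b ∈ B | t.1 (g.1 b) ≠ g.1 b} ≤ j} : Finset G),
                #{b ∈ B | t.1 (g.1 b) ≠ g.1 b} := by
              refine Finset.sum_le_sum fun g hg => ?_
              have := (mem_filter.1 hg).2
              omega
          _ ≤ _ := Finset.sum_le_univ_sum_of_nonneg (by simp)
      have h5 := Finset.card_filter_add_card_filter_not (s := (univ : Finset G))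
        (fun g : G => #{b ∈ B | t.1 (g.1 b) ≠ g.1 b} ≤ j)
      rw [card_univ] at h5
      have hG : 0 < Fintype.card G := Fintype.card_pos
      by_contra hcon
      have h6 : Fintype.card G ≤ 2 * #{g : G | ¬ #{b ∈ B | t.1 (g.1 b) ≠ g.1 b} ≤ j} := by omega
      have h7 : Fintype.card G * (2 * #B * k) < Fintype.card G * (Fintype.card X * (j + 1)) :=
        Nat.mul_lt_mul_of_pos_left hj hG
      have h8 : Fintype.card G * (Fintype.card X * (j + 1)) ≤
          2 * (Fintype.card X * ((j + 1) * #{g : G | ¬ #{b ∈ B | t.1 (g.1 b) ≠ g.1 b} ≤ j})) := by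
        calc _ ≤ (2 * #{g : G | ¬ #{b ∈ B | t.1 (g.1 b) ≠ g.1 b} ≤ j}) *
              (Fintype.card X * (j + 1)) := Nat.mul_le_mul_right _ h6
          _ = _ := by ring
      have h9 := Nat.mul_le_mul_left (Fintype.card X) h4
      nlinarith
    have hsum : ∑ _g : G, #T ≤ ∑ g : G, 2 * #{t ∈ T | #{b ∈ B | t.1 (g.1 b) ≠ g.1 b} ≤ j} := by
      have h1 := Finset.sum_le_sum hone
      have h2 : ∑ t ∈ T, #{g : G | #{b ∈ B | t.1 (g.1 b) ≠ g.1 b} ≤ j} =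
          ∑ g : G, #{t ∈ T | #{b ∈ B | t.1 (g.1 b) ≠ g.1 b} ≤ j} := by
        simp only [card_filter]
        exact Finset.sum_comm
      rw [← Finset.mul_sum, h2] at h1
      rw [← Finset.mul_sum]
      simpa [mul_comm] using h1
    obtain ⟨g, -, hg⟩ := Finset.exists_le_of_sum_le (s := univ) ⟨1, mem_univ _⟩ hsum
    exact ⟨g, hg⟩
  obtain ⟨g, hg⟩ := hdc
  refine hg.trans (Nat.mul_le_mul_left _ ?_)
  -- such an element is determined by its values on the points of the translate that it moves
  have hcode : ∀ t ∈ ({t ∈ T | #{b ∈ B | t.1 (g.1 b) ≠ g.1 b} ≤ j} : Finset G),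
      ∃ p : Fin j → X × X, (∀ i, t.1 (p i).1 = (p i).2) ∧
        ∀ b ∈ B, t.1 (g.1 b) ≠ g.1 b → ∃ i, (p i).1 = g.1 b := by
    intro t ht
    have hcard := (mem_filter.1 ht).2
    obtain ⟨e⟩ : Nonempty ({b // b ∈ ({b ∈ B | t.1 (g.1 b) ≠ g.1 b} : Finset X)} ↪ Fin j) := by
      rw [Function.Embedding.nonempty_iff_card_le]
      rw [Fintype.card_coe, Fintype.card_fin]
      exact hcard
    let q : Fin j → X := fun i =>
      if h : ∃ b, e b = i then g.1 h.choose.1 else Classical.arbitrary X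
    refine ⟨fun i => (q i, t.1 (q i)), fun i => rfl, fun b hb hbt => ?_⟩
    have hex : ∃ b', e b' = e ⟨b, by simp [hb, hbt]⟩ := ⟨_, rfl⟩
    refine ⟨e ⟨b, by simp [hb, hbt]⟩, ?_⟩
    simp only [q, dif_pos hex]
    rw [e.injective hex.choose_spec]
  choose! p hp1 hp2 using hcode
  calc #{t ∈ T | #{b ∈ B | t.1 (g.1 b) ≠ g.1 b} ≤ j} ≤ #(univ : Finset (Fin j → X × X)) := by
        refine card_le_card_of_injOn p (by simp) ?_
        intro t ht t' ht' heq
        have hagree : ∀ b ∈ B, t.1 (g.1 b) = t'.1 (g.1 b) := by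
          intro b hb
          by_cases h1 : ∃ i, (p t i).1 = g.1 b
          · obtain ⟨i, hi⟩ := h1
            have e1 := hp1 t ht i
            have e2 := hp1 t' ht' i
            rw [← heq] at e2
            rw [← hi, e1, e2]
          · have e1 : t.1 (g.1 b) = g.1 b := by
              by_contra hne; exact h1 (hp2 t ht b hb hne)
            have e2 : t'.1 (g.1 b) = g.1 b := by
              by_contra hne; rw [heq] at h1; exact h1 (hp2 t' ht' b hb hne)
            rw [e1, e2]
        have hone := hB (g.1⁻¹ * (t'.1⁻¹ * t.1) * g.1)
          (G.mul_mem (G.mul_mem (G.inv_mem g.2) (G.mul_mem (G.inv_mem t'.2) t.2)) g.2) (by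
            intro b hb
            simp [Equiv.Perm.mul_apply, hagree b hb])
        have h2 : t'.1⁻¹ * t.1 = 1 := by
          have h3 : t'.1⁻¹ * t.1 = g.1 * (g.1⁻¹ * (t'.1⁻¹ * t.1) * g.1) * g.1⁻¹ := by group
          rw [h3, hone]; simp
        exact Subtype.ext (inv_mul_eq_one.1 h2).symm
    _ = _ := by simp [pow_mul, pow_two]

end Rigidity

section Rigidity

open Finset
open scoped Classical

variable {X : Type*} [Fintype X]

theorem card_filter_mul_inv_mem (G P : Subgroup (Equiv.Perm X)) (p : P) :
    #{q : P | p.1 * q.1⁻¹ ∈ G} = #{q : P | q.1 ∈ G} := by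
  refine Finset.card_bij' (fun q _ => p * q⁻¹) (fun q _ => q⁻¹ * p) ?_ ?_ ?_ ?_
  · intro q hq; simpa using hq
  · intro q hq
    have : q.1 ∈ G := by simpa using hq
    simpa using this
  · intro q _; simp
  · intro q _; simp

/-- Moving along the double coset `G h g` inside `P` does not decrease averages over `P`. -/
theorem exists_sum_le_sum_double_coset (G P : Subgroup (Equiv.Perm X))
    (hP : ∀ h ∈ P, ∀ g ∈ G, ∃ t ∈ G, g⁻¹ * t⁻¹ * h * g ∈ P) (g : Equiv.Perm X) (hg : g ∈ G)
    (F : P → ℕ) :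
    ∃ τ : P → P, (∀ h, h.1 * g * (τ h).1⁻¹ ∈ G) ∧ ∑ p, F p ≤ ∑ h, F (τ h) := by
  have hne : ∀ h : P, ∃ p : P, h.1 * g * p.1⁻¹ ∈ G := by
    intro h
    obtain ⟨t, ht, htP⟩ := hP h.1 h.2 g hg
    refine ⟨⟨_, htP⟩, ?_⟩
    have : h.1 * g * (g⁻¹ * t⁻¹ * h.1 * g)⁻¹ = t * g := by group
    rw [this]
    exact G.mul_mem ht hg
  have hne' : ∀ p : P, ∃ h : P, h.1 * g * p.1⁻¹ ∈ G := by
    intro p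
    obtain ⟨t, ht, htP⟩ := hP p.1 p.2 g⁻¹ (G.inv_mem hg)
    refine ⟨⟨_, htP⟩, ?_⟩
    have : g⁻¹⁻¹ * t⁻¹ * p.1 * g⁻¹ * g * p.1⁻¹ = g * t⁻¹ := by group
    simp only [this]
    exact G.mul_mem hg (G.inv_mem ht)
  have hrow : ∀ h : P, #{p : P | h.1 * g * p.1⁻¹ ∈ G} = #{q : P | q.1 ∈ G} := by
    intro h
    obtain ⟨p₀, hp₀⟩ := hne h
    rw [← card_filter_mul_inv_mem G P p₀]
    congr 1
    ext p
    simp only [mem_filter, mem_univ, true_and]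
    have : h.1 * g * p.1⁻¹ = (h.1 * g * p₀.1⁻¹) * (p₀.1 * p.1⁻¹) := by group
    rw [this, G.mul_mem_cancel_left hp₀]
  have hcol : ∀ p : P, #{h : P | h.1 * g * p.1⁻¹ ∈ G} = #{q : P | q.1 ∈ G} := by
    intro p
    obtain ⟨h₀, hh₀⟩ := hne' p
    rw [← card_filter_mul_inv_mem G P h₀]
    congr 1
    ext h
    simp only [mem_filter, mem_univ, true_and]
    have : h.1 * g * p.1⁻¹ = (h₀.1 * h.1⁻¹)⁻¹ * (h₀.1 * g * p.1⁻¹) := by group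
    rw [this, G.mul_mem_cancel_right hh₀, G.inv_mem_iff]
  have hmax : ∀ h : P, ∃ p ∈ ({p : P | h.1 * g * p.1⁻¹ ∈ G} : Finset P),
      ∀ q ∈ ({p : P | h.1 * g * p.1⁻¹ ∈ G} : Finset P), F q ≤ F p := by
    intro h
    obtain ⟨p, hp⟩ := hne h
    exact Finset.exists_max_image _ F ⟨p, by simpa using hp⟩
  choose τ hτ hτmax using hmax
  refine ⟨τ, fun h => by simpa using hτ h, ?_⟩
  have hc : 0 < #{q : P | q.1 ∈ G} := card_pos.2 ⟨1, by simp [G.one_mem]⟩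
  refine Nat.le_of_mul_le_mul_left ?_ hc
  calc #{q : P | q.1 ∈ G} * ∑ p, F p = ∑ p, ∑ h : P, if h.1 * g * p.1⁻¹ ∈ G then F p else 0 := by
        rw [Finset.mul_sum]
        refine Finset.sum_congr rfl fun p _ => ?_
        rw [← Finset.sum_filter, Finset.sum_const, hcol, smul_eq_mul]
    _ = ∑ h : P, ∑ p ∈ ({p : P | h.1 * g * p.1⁻¹ ∈ G} : Finset P), F p := by
        rw [Finset.sum_comm]
        simp only [Finset.sum_filter]
    _ ≤ ∑ h : P, #{q : P | q.1 ∈ G} * F (τ h) := by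
        refine Finset.sum_le_sum fun h _ => ?_
        rw [← hrow h]
        simpa using Finset.sum_le_card_nsmul _ _ _ (hτmax h)
    _ = _ := by rw [Finset.mul_sum]

/-- A transitive group contains elements pulling a fixed set `S` back to sets that
overlap a dense set `U` in many disjoint pieces. -/
theorem exists_disjoint_pullbacks (G : Subgroup (Equiv.Perm X))
    (htr : ∀ x y : X, ∃ g ∈ G, g x = y) (S U : Finset X) (hU : Fintype.card X ≤ 16 * #U) (r : ℕ)
    (hr : 32 * (r * #S) ≤ Fintype.card X) :
    ∃ (g : ℕ → Equiv.Perm X) (Z : ℕ → Finset X), (∀ i, g i ∈ G) ∧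
      (∀ i < r, Z i ⊆ U ∧ (∀ z ∈ Z i, g i z ∈ S) ∧ #S ≤ 32 * #(Z i)) ∧
      ∀ i < r, ∀ j < r, i ≠ j → Disjoint (Z i) (Z j) := by
  induction r with
  | zero => exact ⟨fun _ => 1, fun _ => ∅, fun _ => G.one_mem, by simp, by simp⟩
  | succ r ih =>
    obtain ⟨g, Z, hg, hZ, hdis⟩ := ih (by nlinarith)
    set used : Finset X := (range r).biUnion Z with hused
    have hcu : #used ≤ r * #S := by
      refine (card_biUnion_le_card_mul _ _ #S fun i hi => ?_).trans (by simp)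
      refine card_le_card_of_injOn (g i) ?_ ((g i).injective.injOn)
      exact fun z hz => (hZ i (mem_range.1 hi)).2.1 z hz
    have hV : Fintype.card X ≤ 32 * #(U \ used) := by
      have := Finset.le_card_sdiff used U
      have h2 : r * #S ≤ (r + 1) * #S := Nat.mul_le_mul_right _ (by omega)
      omega
    have hex : ∃ k : G, #S ≤ 32 * #{z ∈ U \ used | k.1 z ∈ S} := by
      rcases isEmpty_or_nonempty X with hX | hX
      · refine ⟨1, ?_⟩
        simp [Finset.eq_empty_of_isEmpty S]
      have hn : 0 < Fintype.card X := Fintype.card_pos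
      have h1 : (Fintype.card X : ℝ) * ∑ k : G, (#{z ∈ U \ used | k.1 z ∈ S} : ℝ) =
          Fintype.card G * (#(U \ used) * #S) := by
        have h2 : ∀ k : G, (#{z ∈ U \ used | k.1 z ∈ S} : ℝ) =
            ∑ z ∈ U \ used, if k.1 z ∈ S then 1 else 0 := by
          intro k; rw [card_filter]; push_cast; rfl
        simp only [h2]
        rw [Finset.sum_comm, Finset.mul_sum]
        have h3 : ∀ z ∈ U \ used, (Fintype.card X : ℝ) * ∑ k : G,
            (if k.1 z ∈ S then (1 : ℝ) else 0) = Fintype.card G * #S := by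
          intro z _
          rw [card_mul_sum_perm G htr (fun w => if w ∈ S then 1 else 0) z]
          simp
        rw [Finset.sum_congr rfl h3]
        simp only [sum_const, nsmul_eq_mul]; ring
      have h1' : Fintype.card X * ∑ k : G, #{z ∈ U \ used | k.1 z ∈ S} =
          Fintype.card G * (#(U \ used) * #S) := by exact_mod_cast h1
      have hsum : ∑ _k : G, #S ≤ ∑ k : G, 32 * #{z ∈ U \ used | k.1 z ∈ S} := by
        refine Nat.le_of_mul_le_mul_left ?_ hn
        rw [← Finset.mul_sum]
        calc Fintype.card X * ∑ _k : G, #S = Fintype.card G * (Fintype.card X * #S) := by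
              simp; ring
          _ ≤ Fintype.card G * (32 * #(U \ used) * #S) :=
              Nat.mul_le_mul_left _ (Nat.mul_le_mul_right _ hV)
          _ = 32 * (Fintype.card G * (#(U \ used) * #S)) := by ring
          _ = _ := by rw [← h1']; ring
      obtain ⟨k, -, hk⟩ := Finset.exists_le_of_sum_le (s := univ) ⟨1, mem_univ _⟩ hsum
      exact ⟨k, hk⟩
    obtain ⟨k, hk⟩ := hex
    have hnew : ∀ i < r, Disjoint (Z i) {z ∈ U \ used | k.1 z ∈ S} := by
      intro i hi
      rw [Finset.disjoint_left]
      intro z hz hz'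
      simp only [mem_filter, mem_sdiff] at hz'
      exact hz'.1.2 (mem_biUnion.2 ⟨i, mem_range.2 hi, hz⟩)
    refine ⟨Function.update g r k.1, Function.update Z r {z ∈ U \ used | k.1 z ∈ S}, ?_, ?_, ?_⟩
    · intro i
      by_cases hi : i = r
      · subst hi; simp [k.2]
      · simp [hi, hg i]
    · intro i hi
      by_cases hir : i = r
      · subst hir
        simp only [Function.update_self]
        refine ⟨fun z hz => ?_, fun z hz => (mem_filter.1 hz).2, hk⟩
        exact (mem_sdiff.1 (mem_filter.1 hz).1).1
      · simpa [hir] using hZ i (by omega)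
    · intro i hi j hj hij
      by_cases hir : i = r
      · subst hir
        have hjr : j ≠ i := hij.symm
        simpa [hjr] using (hnew j (by omega)).symm
      · by_cases hjr : j = r
        · subst hjr
          simpa [hir] using hnew i (by omega)
        · simpa [hir, hjr] using hdis i (by omega) j (by omega) hij

/-- `P` consists of symmetries of the orbit of `Y` under `G` that fix `Y`. -/
structure IsOrbitStabilizer (G P : Subgroup (Equiv.Perm X)) (Y : Set X) : Prop where
  exists_mem : ∀ h ∈ P, ∀ g ∈ G, ∃ t ∈ G, g⁻¹ * t⁻¹ * h * g ∈ P
  mem_iff : ∀ h ∈ P, ∀ x, x ∈ Y ↔ h x ∈ Y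

/-- Subsets whose orbit stabilizer moves a positive proportion of the points are rare. -/
theorem ncard_dense_stabilizer_mul_le (G : Subgroup (Equiv.Perm X))
    (htr : ∀ x y : X, ∃ g ∈ G, g x = y) (r s k M : ℕ) (hs : s ≤ Fintype.card X)
    (hrs : 32 * (r * s) ≤ Fintype.card X) (hk : 128 * k ≤ r * s)
    (hM : Fintype.card G ^ r * (Fintype.card G ^ r * Fintype.card X ^ s) ≤ M) :
    {Y : Set X | ∃ P, IsOrbitStabilizer G P Y ∧
      Fintype.card X ≤ 16 * #{x : X | ∃ k ∈ P, k x ≠ x}}.ncard * 2 ^ k ≤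
      M * 2 ^ Fintype.card X := by
  obtain ⟨S, -, hS⟩ := Finset.exists_subset_card_eq (s := (univ : Finset X)) (n := s) (by simpa)
  refine ncard_mul_le_of_cover (C := (Fin r → G) × (Fin r → G) × (S → X)) _
    (fun c => {Y | ∀ i, ∀ x : S, (c.1 i).1⁻¹ x.1 ∈ Y ↔
      ((c.1 i).1⁻¹ * (c.2.1 i).1⁻¹) (c.2.2 x) ∈ Y}) k _ M ?_ ?_
  · simpa [hS] using hM
  rintro Y ⟨P, hPY, hU⟩
  obtain ⟨g, Z, hg, hZ, hdis⟩ := exists_disjoint_pullbacks G htr S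
    {x : X | ∃ k ∈ P, k x ≠ x} hU r (by rwa [hS])
  choose τ hτG hτ using fun i => exists_sum_le_sum_double_coset G P hPY.exists_mem (g i) (hg i)
    (fun p => #{z ∈ Z i | p.1 z ≠ z})
  -- a common choice of `h` making all the elements `τ i h` move many points
  have hexh : ∃ h : P, ∑ i ∈ range r, #(Z i) ≤
      ∑ i ∈ range r, 2 * #{z ∈ Z i | (τ i h).1 z ≠ z} := by
    have h1 : ∑ _h : P, ∑ i ∈ range r, #(Z i) ≤
        ∑ h : P, ∑ i ∈ range r, 2 * #{z ∈ Z i | (τ i h).1 z ≠ z} := by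
      rw [Finset.sum_comm, Finset.sum_comm (s := univ)]
      refine Finset.sum_le_sum fun i hi => ?_
      have h2 := card_mul_card_le_two_mul_sum P (Z i) (fun x hx => by
        simpa using (hZ i (mem_range.1 hi)).1 hx)
      rw [← Finset.mul_sum]
      calc _ = Fintype.card P * #(Z i) := by simp
        _ ≤ _ := h2
        _ ≤ _ := Nat.mul_le_mul_left _ (hτ i)
    obtain ⟨h, -, hh⟩ := Finset.exists_le_of_sum_le (s := univ) ⟨1, mem_univ _⟩ h1
    exact ⟨h, hh⟩
  obtain ⟨h, hh⟩ := hexh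
  let t : ℕ → G := fun i => ⟨h.1 * g i * (τ i h).1⁻¹ * (g i)⁻¹,
    G.mul_mem (hτG i h) (G.inv_mem (hg i))⟩
  have hτt : ∀ i, (g i)⁻¹ * (t i).1⁻¹ * h.1 * g i = (τ i h).1 := by
    intro i
    simp only [t]
    group
  have hτt' : ∀ i x, ((g i)⁻¹ * (t i).1⁻¹) (h.1 x) = (τ i h).1 ((g i)⁻¹ x) := by
    intro i x
    rw [← hτt i]
    simp [Equiv.Perm.mul_apply]
  refine ⟨(fun i => ⟨g i, hg i⟩, fun i => t i, fun x => h.1 x), ?_, ?_⟩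
  · intro i x
    simp only
    rw [hτt']
    exact hPY.mem_iff _ (τ i h).2 _
  -- the code determines a map moving many points
  let f : X → X := fun z => if hz : ∃ i < r, z ∈ Z i then (τ hz.choose h).1 z else z
  have hf : ∀ i < r, ∀ z ∈ Z i, f z = (τ i h).1 z := by
    intro i hi z hz
    have hex : ∃ i < r, z ∈ Z i := ⟨i, hi, hz⟩
    have hci : hex.choose = i := by
      by_contra hne
      exact Finset.disjoint_left.1 (hdis _ hex.choose_spec.1 i hi hne) hex.choose_spec.2 hz
    simp only [f, dif_pos hex, hci]
  have hmoved : 2 * k ≤ #{x | f x ≠ x} := by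
    have h1 : #((range r).biUnion fun i => {z ∈ Z i | (τ i h).1 z ≠ z}) =
        ∑ i ∈ range r, #{z ∈ Z i | (τ i h).1 z ≠ z} := by
      refine card_biUnion fun i hi j hj hij => ?_
      exact (hdis i (mem_range.1 hi) j (mem_range.1 hj) hij).mono (filter_subset _ _)
        (filter_subset _ _)
    have h2 : (range r).biUnion (fun i => {z ∈ Z i | (τ i h).1 z ≠ z}) ⊆
        ({x | f x ≠ x} : Finset X) := by
      intro z hz
      simp only [mem_biUnion, mem_range, mem_filter] at hz
      obtain ⟨i, hi, hzi, hne⟩ := hz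
      simp only [mem_filter, mem_univ, true_and]
      rwa [hf i hi z hzi]
    have h3 := card_le_card h2
    rw [h1] at h3
    rw [← Finset.mul_sum] at hh
    have h4 : r * s ≤ 32 * ∑ i ∈ range r, #(Z i) := by
      rw [Finset.mul_sum]
      calc r * s = ∑ _i ∈ range r, #S := by simp [hS]
        _ ≤ _ := Finset.sum_le_sum fun i hi => (hZ i (mem_range.1 hi)).2.2
    omega
  refine (Nat.mul_le_mul_right _ (Set.ncard_le_ncard ?_ (Set.toFinite _))).trans
    (ncard_invariant_sets_mul_le f k hmoved)
  intro Y' hY' z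
  by_cases hz : ∃ i < r, z ∈ Z i
  · obtain ⟨i, hi, hzi⟩ := hz
    rw [hf i hi z hzi]
    have h1 := hY' ⟨i, hi⟩ ⟨g i z, (hZ i hi).2.1 z hzi⟩
    simp only [hτt'] at h1
    simpa using h1
  · simp [f, hz]

/-- Subsets whose orbit stabilizer contains an element of support `m` and moves few points. -/
theorem ncard_sparse_stabilizer_mul_le (G : Subgroup (Equiv.Perm X))
    (htr : ∀ x y : X, ∃ g ∈ G, g x = y) (r m M : ℕ) (hr : Fintype.card X < 2 ^ r)
    (hM : #{t : G | #{x | t.1 x ≠ x} ≤ 3 * m} ^ r ≤ M) :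
    {Y : Set X | ∃ P, IsOrbitStabilizer G P Y ∧
      16 * #{x : X | ∃ k ∈ P, k x ≠ x} ≤ Fintype.card X ∧
      ∃ h ∈ P, #{x | h x ≠ x} = m ∧ #{x : X | ∃ k ∈ P, k x ≠ x} ≤ 2 * m}.ncard * 2 ^ (m / 2) ≤
      M * 2 ^ Fintype.card X := by
  refine ncard_mul_le_of_cover
    (C := Fin r → {t // t ∈ ({t : G | #{x | t.1 x ≠ x} ≤ 3 * m} : Finset G)}) _
    (fun c => {Y | ∃ h : Equiv.Perm X, (∀ x, 2 * #{i | (c i).1.1 x ≠ h x} < r) ∧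
      #{x | h x ≠ x} = m ∧ ∀ x, x ∈ Y ↔ h x ∈ Y}) (m / 2) _ M ?_ ?_
  · rw [Fintype.card_fun, Fintype.card_fin, Fintype.card_coe]; exact hM
  rintro Y ⟨P, hPY, hU, h, hh, hm, hUm⟩
  obtain ⟨t, htG, htm, hmaj⟩ := exists_majority G P htr hPY.exists_mem hU r hr h hh
  refine ⟨fun i => ⟨⟨t i, htG i⟩, ?_⟩, ⟨h, hmaj, hm, hPY.mem_iff h hh⟩, ?_⟩
  · simp only [mem_filter, mem_univ, true_and]
    exact (htm i).trans (by omega)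
  refine (Nat.mul_le_mul_right _ (Set.ncard_le_ncard ?_ (Set.toFinite _))).trans
    (ncard_invariant_sets_mul_le h (m / 2) (by omega))
  rintro Y' ⟨h', hmaj', -, hY'⟩
  have heq : h' = h := by
    ext x
    by_contra hne
    have h1 := hmaj x
    have h2 := hmaj' x
    simp only at h2
    have h3 : (univ : Finset (Fin r)) ⊆
        ({i | t i x ≠ h x} : Finset (Fin r)) ∪ ({i | t i x ≠ h' x} : Finset (Fin r)) := by
      intro i _
      simp only [mem_union, mem_filter, mem_univ, true_and]
      by_contra hcon
      push Not at hcon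
      exact hne (hcon.2.symm.trans hcon.1)
    have h4 := (card_le_card h3).trans (card_union_le _ _)
    rw [card_univ, Fintype.card_fin] at h4
    omega
  rw [← heq]
  exact (hY')

/-- A transitive group with a small base, all of whose nontrivial elements have large support,
has few subsets with a nontrivial orbit stabilizer. -/
theorem ncard_orbit_stabilizer_ne_bot_mul_le (G : Subgroup (Equiv.Perm X))
    (htr : ∀ x y : X, ∃ g ∈ G, g x = y)
    (B : Finset X) (hB : ∀ g ∈ G, (∀ x ∈ B, g x = x) → g = 1) (L K a : ℕ)
    (hL : Fintype.card X ≤ 2 ^ L) (hBK : #B ≤ K) (hK : 2 ^ 24 * (L ^ 2 * K) ≤ Fintype.card X)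
    (hLa : 4 * L ≤ a) (haK : a ≤ K) (hL0 : 1 ≤ L)
    (hmin : ∀ g ∈ G, g ≠ 1 → 12 * a ≤ #{x | g x ≠ x}) :
    {Y : Set X | ∃ P, IsOrbitStabilizer G P Y ∧ P ≠ ⊥}.ncard * 2 ^ a ≤
      (Fintype.card X + 1) * 2 ^ Fintype.card X := by
  have hcardG : Fintype.card G ≤ 2 ^ (L * K) := by
    have h1 : Fintype.card G ≤ Fintype.card (B → X) := by
      refine Fintype.card_le_of_injective (fun g b => g.1 b.1) ?_
      intro g g' hgg
      have h2 := hB (g'.1⁻¹ * g.1) (G.mul_mem (G.inv_mem g'.2) g.2) (by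
        intro x hx
        have h3 : g.1 x = g'.1 x := congrFun hgg ⟨x, hx⟩
        simp [Equiv.Perm.mul_apply, h3])
      exact Subtype.ext (inv_mul_eq_one.1 h2).symm
    refine h1.trans ?_
    rw [Fintype.card_fun, Fintype.card_coe]
    calc Fintype.card X ^ #B ≤ (2 ^ L) ^ #B := Nat.pow_le_pow_left hL _
      _ = 2 ^ (L * #B) := (pow_mul _ _ _).symm
      _ ≤ _ := Nat.pow_le_pow_right (by norm_num) (Nat.mul_le_mul_left _ hBK)
  have hdense := ncard_dense_stabilizer_mul_le G htr (512 * L) (1024 * L * K) (4096 * (L ^ 2 * K))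
    (2 ^ (2048 * (L ^ 2 * K))) (by nlinarith [Nat.zero_le (L * K)]) (by nlinarith) (by nlinarith)
    (by
      calc Fintype.card G ^ (512 * L) *
            (Fintype.card G ^ (512 * L) * Fintype.card X ^ (1024 * L * K))
          ≤ (2 ^ (L * K)) ^ (512 * L) * ((2 ^ (L * K)) ^ (512 * L) * (2 ^ L) ^ (1024 * L * K)) := by
            gcongr
        _ = 2 ^ (2048 * (L ^ 2 * K)) := by
            rw [← pow_mul, ← pow_mul, ← pow_add, ← pow_add]; congr 1; ring)
  have hdense' : {Y : Set X | ∃ P, IsOrbitStabilizer G P Y ∧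
      Fintype.card X ≤ 16 * #{x : X | ∃ k ∈ P, k x ≠ x}}.ncard * 2 ^ a ≤ 2 ^ Fintype.card X := by
    refine Nat.le_of_mul_le_mul_left ?_ (by positivity : 0 < 2 ^ (2048 * (L ^ 2 * K)))
    refine le_trans ?_ hdense
    rw [mul_left_comm, ← pow_add]
    refine Nat.mul_le_mul_left _ (Nat.pow_le_pow_right (by norm_num) ?_)
    nlinarith [Nat.one_le_pow 2 L hL0]
  have hsparse : {Y : Set X | ∃ P, IsOrbitStabilizer G P Y ∧ P ≠ ⊥ ∧
      16 * #{x : X | ∃ k ∈ P, k x ≠ x} ≤ Fintype.card X}.ncard * 2 ^ a ≤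
      Fintype.card X * 2 ^ Fintype.card X := by
    refine ncard_mul_le_of_cover (C := Fin (Fintype.card X)) _ (fun i => {Y : Set X | 4 * a ≤ i.1 + 1 ∧
      ∃ P, IsOrbitStabilizer G P Y ∧
      16 * #{x : X | ∃ k ∈ P, k x ≠ x} ≤ Fintype.card X ∧
      ∃ h ∈ P, #{x | h x ≠ x} = i.1 + 1 ∧ #{x : X | ∃ k ∈ P, k x ≠ x} ≤ 2 * (i.1 + 1)}) a _ _
      (by simp) ?_
    rintro Y ⟨P, hPY, hPne, hU⟩
    obtain ⟨h, hh, hhU⟩ := exists_card_le_two_mul_moved P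
    have hUpos : 0 < #{x : X | ∃ k ∈ P, k x ≠ x} := by
      obtain ⟨k, hk, hk1⟩ := P.bot_or_exists_ne_one.resolve_left hPne
      have : ∃ x, k x ≠ x := by
        by_contra hcon
        push Not at hcon
        exact hk1 (Equiv.ext hcon)
      obtain ⟨x, hx⟩ := this
      exact card_pos.2 ⟨x, by simpa using ⟨k, hk, hx⟩⟩
    obtain ⟨m, hm⟩ : ∃ m, #{x | h x ≠ x} = m := ⟨_, rfl⟩
    rw [hm] at hhU
    have hmn : m ≤ Fintype.card X := hm ▸ card_le_univ _
    have hr : Fintype.card X < 2 ^ (L + 1) := lt_of_le_of_lt hL (by rw [pow_succ]; simp)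
    have h4a : 4 * a ≤ m := by
      obtain ⟨t, htG, htm, hmaj⟩ := exists_majority G P htr hPY.exists_mem hU (L + 1) hr h hh
      obtain ⟨x, hx⟩ : ∃ x, h x ≠ x := by
        have : 0 < #{x | h x ≠ x} := by omega
        obtain ⟨x, hx⟩ := card_pos.1 this
        exact ⟨x, by simpa using hx⟩
      have hex : ∃ i, t i ≠ 1 := by
        by_contra hcon
        push Not at hcon
        have h1 := hmaj x
        have h2 : ({i | t i x ≠ h x} : Finset (Fin (L + 1))) = univ := by
          ext i
          simpa [hcon i] using hx.symm
        rw [h2, card_univ, Fintype.card_fin] at h1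
        omega
      obtain ⟨i, hi⟩ := hex
      have h1 := hmin (t i) (htG i) hi
      have h2 := htm i
      omega
    have hm1 : m - 1 + 1 = m := by omega
    refine ⟨⟨m - 1, by omega⟩, ⟨by simp only [hm1]; exact h4a, P, hPY, hU, h, hh,
      by simp only [hm1]; exact hm, by simp only [hm1]; exact hhU⟩, ?_⟩
    simp only [hm1]
    set n := Fintype.card X with hn
    have hnpos : 0 < n := by omega
    set j := 6 * K * m / n with hj
    have hjn : j * n ≤ 6 * K * m := Nat.div_mul_le_self _ _
    have hsmall := card_moved_le G htr B hB (3 * m) j (by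
      rw [← hn]
      have h1 : 6 * K * m < n * (j + 1) := Nat.lt_mul_div_succ _ hnpos
      have h2 : 2 * #B * (3 * m) ≤ 6 * K * m := by nlinarith
      omega)
    have hexp : (L + 1) * (1 + 2 * j * L) ≤ m / 4 := by
      have hj' : 32 * (L ^ 2 * j) ≤ m := by
        refine Nat.le_of_mul_le_mul_right ?_ hnpos
        have h1 : 32 * (L ^ 2 * j) * n ≤ 32 * L ^ 2 * (6 * K * m) := by
          calc _ = 32 * L ^ 2 * (j * n) := by ring
            _ ≤ _ := Nat.mul_le_mul_left _ hjn
        have h2 : 32 * L ^ 2 * (6 * K * m) ≤ 2 ^ 24 * (L ^ 2 * K) * m := by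
          calc _ = 192 * (L ^ 2 * K) * m := by ring
            _ ≤ _ := by gcongr; norm_num
        have h3 : 2 ^ 24 * (L ^ 2 * K) * m ≤ n * m := Nat.mul_le_mul_right _ hK
        calc _ ≤ _ := h1.trans (h2.trans h3)
          _ = m * n := mul_comm _ _
      have h5 : (L + 1) * (1 + 2 * j * L) ≤ 2 * L * (1 + 2 * j * L) :=
        Nat.mul_le_mul_right _ (by omega)
      have h6 : 2 * L * (1 + 2 * j * L) = 2 * L + 4 * (L ^ 2 * j) := by ring
      omega
    have hM : #{t : G | #{x | t.1 x ≠ x} ≤ 3 * m} ^ (L + 1) ≤ 2 ^ (m / 4) := by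
      calc _ ≤ (2 * n ^ (2 * j)) ^ (L + 1) := Nat.pow_le_pow_left hsmall _
        _ ≤ (2 * (2 ^ L) ^ (2 * j)) ^ (L + 1) := by gcongr
        _ = 2 ^ ((L + 1) * (1 + 2 * j * L)) := by
            rw [← pow_mul, ← pow_succ', ← pow_mul]; congr 1; ring
        _ ≤ _ := Nat.pow_le_pow_right (by norm_num) hexp
    have hfin := ncard_sparse_stabilizer_mul_le G htr (L + 1) m _ hr hM
    have hfin' : {Y : Set X | ∃ P, IsOrbitStabilizer G P Y ∧
        16 * #{x : X | ∃ k ∈ P, k x ≠ x} ≤ Fintype.card X ∧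
        ∃ h ∈ P, #{x | h x ≠ x} = m ∧
          #{x : X | ∃ k ∈ P, k x ≠ x} ≤ 2 * m}.ncard * 2 ^ a ≤ 2 ^ n := by
      refine Nat.le_of_mul_le_mul_left ?_ (by positivity : 0 < 2 ^ (m / 4))
      refine le_trans ?_ hfin
      rw [mul_left_comm, ← pow_add]
      exact Nat.mul_le_mul_left _ (Nat.pow_le_pow_right (by norm_num) (by omega))
    refine le_trans (Nat.mul_le_mul_right _ (Set.ncard_le_ncard ?_ (Set.toFinite _))) hfin'
    rintro Y' ⟨-, hY'⟩
    exact hY'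
  have hsub : {Y : Set X | ∃ P, IsOrbitStabilizer G P Y ∧ P ≠ ⊥} ⊆
      {Y : Set X | ∃ P, IsOrbitStabilizer G P Y ∧ P ≠ ⊥ ∧
        16 * #{x : X | ∃ k ∈ P, k x ≠ x} ≤ Fintype.card X} ∪
      {Y : Set X | ∃ P, IsOrbitStabilizer G P Y ∧
        Fintype.card X ≤ 16 * #{x : X | ∃ k ∈ P, k x ≠ x}} := by
    rintro Y ⟨P, hPY, hPne⟩
    rcases le_total (16 * #{x : X | ∃ k ∈ P, k x ≠ x}) (Fintype.card X) with h | h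
    · exact Or.inl ⟨P, hPY, hPne, h⟩
    · exact Or.inr ⟨P, hPY, h⟩
  have h1 := (Set.ncard_le_ncard hsub (Set.toFinite _)).trans (Set.ncard_union_le _ _)
  have h2 := Nat.mul_le_mul_right (2 ^ a) h1
  rw [add_mul] at h2
  rw [add_mul, one_mul]
  omega

end Rigidity

section MinimalDegree

open Finset
open scoped Classical

variable {X : Type*} [Fintype X]

theorem card_mul_sum_perm_pair (G : Subgroup (Equiv.Perm X))
    (h2 : ∀ x y x' y' : X, x ≠ y → x' ≠ y' → ∃ g ∈ G, g x = x' ∧ g y = y')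
    (F : X × X → ℝ) {a b : X} (hab : a ≠ b) :
    (#(univ.offDiag : Finset (X × X)) : ℝ) * ∑ g : G, F (g.1 a, g.1 b) =
      Fintype.card G * ∑ w ∈ univ.offDiag, F w := by
  have := card_mul_sum_smul (G := G) (univ.offDiag : Finset (X × X))
    (by
      intro g z hz
      simpa [Subgroup.smul_def] using hz)
    (by
      rintro ⟨z, z'⟩ hz ⟨w, w'⟩ hw
      obtain ⟨g, hg, h, h'⟩ := h2 z z' w w' (by simpa using hz) (by simpa using hw)
      exact ⟨⟨g, hg⟩, Prod.ext h h'⟩) F (z := (a, b)) (by simpa using hab)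
  simpa [Subgroup.smul_def] using this

theorem card_not_commute_le (g h : Equiv.Perm X) :
    #{x | g (h x) ≠ h (g x)} ≤ 3 * #{x | g x ≠ x ∧ h x ≠ x} := by
  have hsub : ({x | g (h x) ≠ h (g x)} : Finset X) ⊆
      ({x | g x ≠ x ∧ h x ≠ x} : Finset X) ∪
      (({x | g x ≠ x ∧ h x ≠ x} : Finset X).image g.symm ∪
        ({x | g x ≠ x ∧ h x ≠ x} : Finset X).image h.symm) := by
    intro x hx
    simp only [mem_filter, mem_univ, true_and, mem_union, mem_image] at hx ⊢
    by_cases hg : g x = x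
    · refine Or.inr (Or.inr ⟨h x, ⟨?_, ?_⟩, by simp⟩)
      · rwa [hg] at hx
      · intro hh
        rw [hg] at hx
        have := h.injective hh
        rw [this] at hx
        exact hx hg
    · by_cases hh : h x = x
      · refine Or.inr (Or.inl ⟨g x, ⟨?_, ?_⟩, by simp⟩)
        · intro hgg
          exact hg (g.injective hgg)
        · rw [hh] at hx
          exact fun h' => hx h'.symm
      · exact Or.inl ⟨hg, hh⟩
  have h1 := card_le_card hsub
  have h2 := card_union_le ({x | g x ≠ x ∧ h x ≠ x} : Finset X)
      (({x | g x ≠ x ∧ h x ≠ x} : Finset X).image g.symm ∪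
        ({x | g x ≠ x ∧ h x ≠ x} : Finset X).image h.symm)
  have h3 := card_union_le (({x | g x ≠ x ∧ h x ≠ x} : Finset X).image g.symm)
        (({x | g x ≠ x ∧ h x ≠ x} : Finset X).image h.symm)
  have h4 := card_image_le (s := ({x | g x ≠ x ∧ h x ≠ x} : Finset X)) (f := g.symm)
  have h5 := card_image_le (s := ({x | g x ≠ x ∧ h x ≠ x} : Finset X)) (f := h.symm)
  omega

/-- A nontrivial element of a doubly transitive group with no nontrivial elements of support
less than four moves at least `n / 19` points. -/
theorem card_le_nineteen_mul_card_moved (G : Subgroup (Equiv.Perm X))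
    (h2 : ∀ x y x' y' : X, x ≠ y → x' ≠ y' → ∃ g ∈ G, g x = x' ∧ g y = y')
    (h4 : ∀ g ∈ G, g ≠ 1 → 4 ≤ #{x | g x ≠ x}) (g : Equiv.Perm X) (hg : g ∈ G) (hg1 : g ≠ 1) :
    Fintype.card X ≤ 19 * #{x | g x ≠ x} := by
  have hex : ∃ m, ∃ g ∈ G, g ≠ 1 ∧ #{x | g x ≠ x} = m := ⟨_, g, hg, hg1, rfl⟩
  suffices h : Fintype.card X ≤ 19 * Nat.find hex from
    h.trans (Nat.mul_le_mul_left _ (Nat.find_min' hex ⟨g, hg, hg1, rfl⟩))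
  have hmin : ∀ g ∈ G, g ≠ 1 → Nat.find hex ≤ #{x | g x ≠ x} := fun g hg hg1 =>
    Nat.find_min' hex ⟨g, hg, hg1, rfl⟩
  obtain ⟨k, hk, hk1, hkm⟩ := Nat.find_spec hex
  generalize Nat.find hex = m at hmin hkm
  set A : Finset X := {x | k x ≠ x} with hA
  have hm4 : 4 ≤ m := hkm ▸ h4 k hk hk1
  obtain ⟨a, ha⟩ : A.Nonempty := card_pos.1 (by omega)
  have ha' : k a ≠ a := by simpa [hA] using ha
  set O : ℝ := (#(univ.offDiag : Finset (X × X)) : ℝ) with hO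
  have hOpos : 0 < O := by
    rw [hO]
    exact_mod_cast card_pos.2 ⟨(a, k a), by simpa using ha'.symm⟩
  -- many conjugates do not commute with `k`
  set F : X × X → ℝ := fun p => if p.1 ∉ A ∧ p.2 ∈ A then 1 else 0 with hF
  have hsumF : ∑ w ∈ univ.offDiag, F w = ((Fintype.card X : ℝ) - m) * m := by
    have : ({w ∈ univ.offDiag | w.1 ∉ A ∧ w.2 ∈ A} : Finset (X × X)) = Aᶜ ×ˢ A := by
      ext ⟨u, v⟩
      simp only [mem_filter, mem_offDiag, mem_univ, true_and, mem_product, mem_compl]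
      refine ⟨fun h => h.2, fun h => ⟨?_, h⟩⟩
      rintro rfl
      exact h.1 h.2
    rw [hF, Finset.sum_boole, this, card_product, card_compl, hkm, Nat.cast_mul,
      Nat.cast_sub (hkm ▸ card_le_univ A)]
  have e1 := card_mul_sum_perm_pair G h2 F ha'.symm
  rw [hsumF] at e1
  -- pairs of points in the intersection of the supports
  set H : X × X → ℝ := fun p => if p.1 ∈ A ∧ p.2 ∈ A then 1 else 0 with hH
  have hsumH : ∑ w ∈ univ.offDiag, H w = (m : ℝ) * m - m := by
    have : ({w ∈ univ.offDiag | w.1 ∈ A ∧ w.2 ∈ A} : Finset (X × X)) = A.offDiag := by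
      ext ⟨u, v⟩
      simp only [mem_filter, mem_offDiag, mem_univ, true_and]
      tauto
    rw [hH, Finset.sum_boole, this, offDiag_card, hkm, Nat.cast_sub (Nat.le_mul_self m)]
    push_cast; ring
  have e2 : O * ∑ p ∈ A.offDiag, ∑ x : G, H (x.1 p.1, x.1 p.2) =
      ((m : ℝ) * m - m) * (Fintype.card G * ((m : ℝ) * m - m)) := by
    rw [Finset.mul_sum]
    have : ∀ p ∈ A.offDiag, O * ∑ x : G, H (x.1 p.1, x.1 p.2) =
        Fintype.card G * ((m : ℝ) * m - m) := by
      intro p hp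
      rw [← hsumH]
      exact card_mul_sum_perm_pair G h2 H (mem_offDiag.1 hp).2.2
    rw [Finset.sum_congr rfl this, Finset.sum_const, offDiag_card, hkm, nsmul_eq_mul,
      Nat.cast_sub (Nat.le_mul_self m)]
    push_cast; ring
  rw [Finset.sum_comm] at e2
  have hpt : ∀ x : G, F (x.1 a, x.1 (k a)) * (m * m) ≤
      18 * ∑ p ∈ A.offDiag, H (x.1 p.1, x.1 p.2) := by
    intro x
    have hHnn : 0 ≤ ∑ p ∈ A.offDiag, H (x.1 p.1, x.1 p.2) :=
      Finset.sum_nonneg fun p _ => by simp only [hH]; split_ifs <;> norm_num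
    by_cases hx : x.1 a ∉ A ∧ x.1 (k a) ∈ A
    · set I : Finset X := {y | k y ≠ y ∧ (x.1⁻¹ * k * x.1) y ≠ y} with hI
      have hconj : ∀ y, (x.1⁻¹ * k * x.1) y ≠ y ↔ x.1 y ∈ A := by
        intro y
        simp only [hA, mem_filter, mem_univ, true_and, Equiv.Perm.mul_apply, ne_eq,
          Equiv.Perm.inv_eq_iff_eq]
      have hle := card_not_commute_le k (x.1⁻¹ * k * x.1)
      have hmem : (x.1⁻¹ * k * x.1) ∈ G := G.mul_mem (G.mul_mem (G.inv_mem x.2) hk) x.2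
      have hcomm : (((x.1⁻¹ * k * x.1) * k)⁻¹ * (k * (x.1⁻¹ * k * x.1))) ∈ G :=
        G.mul_mem (G.inv_mem (G.mul_mem hmem hk)) (G.mul_mem hk hmem)
      have hmoved : ∀ y, (((x.1⁻¹ * k * x.1) * k)⁻¹ * (k * (x.1⁻¹ * k * x.1))) y ≠ y ↔
          k ((x.1⁻¹ * k * x.1) y) ≠ (x.1⁻¹ * k * x.1) (k y) := by
        intro y
        rw [Equiv.Perm.mul_apply, ne_eq, Equiv.Perm.inv_eq_iff_eq]
        rfl
      have hne : (((x.1⁻¹ * k * x.1) * k)⁻¹ * (k * (x.1⁻¹ * k * x.1))) ≠ 1 := by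
        intro h1
        have hfix : (x.1⁻¹ * k * x.1) a = a := by
          by_contra h; exact hx.1 ((hconj a).1 h)
        refine (hmoved a).not.1 (by rw [h1]; simp) ?_
        rw [hfix]
        exact ((hconj (k a)).2 hx.2).symm
      have h3 := hmin _ hcomm hne
      simp only [hmoved] at h3
      have h3I : m ≤ 3 * #I := h3.trans hle
      have hHI : ∑ p ∈ A.offDiag, H (x.1 p.1, x.1 p.2) = (#I : ℝ) * #I - #I := by
        have : ({p ∈ A.offDiag | x.1 p.1 ∈ A ∧ x.1 p.2 ∈ A} : Finset (X × X)) = I.offDiag := by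
          ext ⟨u, v⟩
          simp only [mem_filter, mem_offDiag, hI, mem_univ, true_and, hconj]
          simp only [hA, mem_filter, mem_univ, true_and]
          tauto
        rw [hH, Finset.sum_boole, this, offDiag_card, Nat.cast_sub (Nat.le_mul_self _)]
        push_cast; ring
      rw [hHI]
      simp only [hF, hx, not_false_eq_true, and_self, if_true, one_mul]
      have hI2 : (2 : ℝ) ≤ #I := by exact_mod_cast (by omega : 2 ≤ #I)
      have h3R : (m : ℝ) ≤ 3 * #I := by exact_mod_cast h3I
      nlinarith [mul_le_mul h3R h3R (by positivity) (by positivity)]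
    · simp only [hF]
      rw [if_neg hx]
      linarith
  have hsum : (∑ x : G, F (x.1 a, x.1 (k a))) * (m * m) ≤
      18 * ∑ x : G, ∑ p ∈ A.offDiag, H (x.1 p.1, x.1 p.2) := by
    rw [Finset.sum_mul, Finset.mul_sum]
    exact Finset.sum_le_sum fun x _ => hpt x
  have hGpos : (0 : ℝ) < Fintype.card G := by exact_mod_cast Fintype.card_pos
  have hmR : (4 : ℝ) ≤ m := by exact_mod_cast hm4
  have hfin : (Fintype.card G : ℝ) * ((m : ℝ) * m) * (((Fintype.card X : ℝ) - m) * m) ≤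
      (Fintype.card G : ℝ) * ((m : ℝ) * m) * (18 * ((m : ℝ) - 1) ^ 2) := by
    have := mul_le_mul_of_nonneg_left hsum hOpos.le
    calc _ = (O * ∑ x : G, F (x.1 a, x.1 (k a))) * (m * m) := by rw [e1]; ring
      _ = O * ((∑ x : G, F (x.1 a, x.1 (k a))) * (m * m)) := by ring
      _ ≤ _ := this
      _ = 18 * (O * ∑ x : G, ∑ p ∈ A.offDiag, H (x.1 p.1, x.1 p.2)) := by ring
      _ = _ := by rw [e2]; ring
  have hfin' := le_of_mul_le_mul_left hfin (by positivity)
  have : ((Fintype.card X : ℝ) - m) * m ≤ (18 * m) * m := by nlinarith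
  have := le_of_mul_le_mul_right this (by linarith)
  have : (Fintype.card X : ℝ) ≤ 19 * m := by linarith
  exact_mod_cast this

end MinimalDegree

section Uniprimitive

open Finset
open scoped Classical

variable {X : Type*}

/-- `x` and `x'` lie in the same orbit of the stabilizer of `y`. -/
def SameSuborbit (G : Subgroup (Equiv.Perm X)) (y x x' : X) : Prop :=
  ∃ g ∈ G, g y = y ∧ g x = x'

/-- `(x, y)` lies in the orbital of `(u, v)`. -/
def InOrbital (G : Subgroup (Equiv.Perm X)) (u v x y : X) : Prop :=
  ∃ g ∈ G, g u = x ∧ g v = y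

/-- Every invariant equivalence relation is trivial. -/
def HasTrivialCongruences (G : Subgroup (Equiv.Perm X)) : Prop :=
  ∀ s : X → X → Prop, Equivalence s → (∀ g ∈ G, ∀ x y, s x y → s (g x) (g y)) →
    ∀ u v, u ≠ v → s u v → ∀ x y, s x y

namespace SameSuborbit

variable {G : Subgroup (Equiv.Perm X)} {x y z w : X}

theorem refl (G : Subgroup (Equiv.Perm X)) (y x : X) : SameSuborbit G y x x :=
  ⟨1, G.one_mem, rfl, rfl⟩

theorem symm (h : SameSuborbit G y x z) : SameSuborbit G y z x := by
  obtain ⟨g, hg, h1, h2⟩ := h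
  exact ⟨g⁻¹, G.inv_mem hg, by rw [Equiv.Perm.inv_eq_iff_eq, h1],
    by rw [Equiv.Perm.inv_eq_iff_eq, h2]⟩

theorem trans (h : SameSuborbit G y x z) (h' : SameSuborbit G y z w) : SameSuborbit G y x w := by
  obtain ⟨g, hg, h1, h2⟩ := h
  obtain ⟨k, hk, h3, h4⟩ := h'
  exact ⟨k * g, G.mul_mem hk hg, by simp [h1, h3], by simp [h2, h4]⟩

theorem map (h : SameSuborbit G y x z) {g : Equiv.Perm X} (hg : g ∈ G) :
    SameSuborbit G (g y) (g x) (g z) := by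
  obtain ⟨k, hk, h1, h2⟩ := h
  exact ⟨g * k * g⁻¹, G.mul_mem (G.mul_mem hg hk) (G.inv_mem hg), by simp [h1], by simp [h2]⟩

end SameSuborbit

namespace InOrbital

variable {G : Subgroup (Equiv.Perm X)} {u v x y z : X}

theorem map (h : InOrbital G u v x y) {g : Equiv.Perm X} (hg : g ∈ G) :
    InOrbital G u v (g x) (g y) := by
  obtain ⟨k, hk, rfl, rfl⟩ := h
  exact ⟨g * k, G.mul_mem hg hk, rfl, rfl⟩

theorem right_of_sameSuborbit (h : InOrbital G u v x y) (hy : SameSuborbit G x y z) :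
    InOrbital G u v x z := by
  obtain ⟨k, hk, h1, rfl⟩ := hy
  simpa [h1] using h.map hk

theorem left_of_sameSuborbit (h : InOrbital G u v x y) (hx : SameSuborbit G y x z) :
    InOrbital G u v z y := by
  obtain ⟨k, hk, h1, rfl⟩ := hx
  simpa [h1] using h.map hk

end InOrbital

variable {G : Subgroup (Equiv.Perm X)}

/-- A set closed under adjacency in an orbital graph of a primitive group is everything. -/
theorem HasTrivialCongruences.closed_eq_univ (hpr : HasTrivialCongruences G) {u v : X} (huv : u ≠ v)
    (C : X → Prop) (hC : ∀ x z, C x → InOrbital G u v x z ∨ InOrbital G u v z x → C z)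
    {x₀ : X} (h₀ : C x₀) (z : X) : C z := by
  have := hpr (Relation.EqvGen (InOrbital G u v)) (Relation.EqvGen.is_equivalence _)
    (fun g hg x y h => by
      induction h with
      | rel x y h => exact .rel _ _ (h.map hg)
      | refl x => exact .refl _
      | symm x y _ h => exact h.symm
      | trans x y z _ _ h h' => exact h.trans _ _ _ h') u v huv (.rel _ _ ⟨1, G.one_mem, rfl, rfl⟩) x₀ z
  have hiff : C x₀ ↔ C z := by
    clear h₀
    induction this with
    | rel x y h => exact ⟨fun hx => hC _ _ hx (.inl h), fun hy => hC _ _ hy (.inr h)⟩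
    | refl x => rfl
    | symm x y _ h => exact h.symm
    | trans x y z _ _ h h' => exact h.trans h'
  exact hiff.1 h₀

theorem exists_adj_not_sameSuborbit (hpr : HasTrivialCongruences G) {u v : X} (huv : u ≠ v)
    (y x : X) : ∃ z, (InOrbital G u v x z ∨ InOrbital G u v z x) ∧ ¬ SameSuborbit G y x z := by
  by_contra! hcon
  have hall : ∀ z, SameSuborbit G y x z := by
    refine hpr.closed_eq_univ huv _ ?_ (SameSuborbit.refl G y x)
    rintro z w hz hw
    obtain ⟨g, hg, h1, rfl⟩ := hz
    have hw' : InOrbital G u v x (g⁻¹ w) ∨ InOrbital G u v (g⁻¹ w) x := by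
      rcases hw with hw | hw
      · exact .inl (by simpa using hw.map (G.inv_mem hg))
      · exact .inr (by simpa using hw.map (G.inv_mem hg))
    have h2 := (hcon _ hw').map hg
    rw [h1, Equiv.Perm.coe_inv, Equiv.apply_symm_apply] at h2
    exact SameSuborbit.trans ⟨g, hg, h1, rfl⟩ h2
  have hx : x = y := by
    obtain ⟨g, -, h1, h2⟩ := hall y
    exact g.injective (h2.trans h1.symm)
  subst hx
  have hz : ∀ z, z = x := by
    intro z
    obtain ⟨g, -, h1, h2⟩ := hall z
    exact h2.symm.trans h1
  exact huv ((hz u).trans (hz v).symm)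

variable [Fintype X]

/-- The number of points whose stabilizer has `x` and `x'` in different orbits. -/
noncomputable def distinguishing (G : Subgroup (Equiv.Perm X)) (x x' : X) : ℕ :=
  #{y | ¬ SameSuborbit G y x x'}

theorem distinguishing_comm (x x' : X) : distinguishing G x x' = distinguishing G x' x := by
  unfold distinguishing
  congr 1
  ext y
  simp only [mem_filter, mem_univ, true_and, not_iff_not]
  exact ⟨fun h => h.symm, fun h => h.symm⟩

theorem distinguishing_triangle (x y z : X) :
    distinguishing G x z ≤ distinguishing G x y + distinguishing G y z := by
  unfold distinguishing
  refine le_trans (card_le_card ?_) (card_union_le _ _)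
  intro w hw
  simp only [mem_filter, mem_univ, true_and, mem_union] at hw ⊢
  by_contra! hcon
  exact hw (hcon.1.trans hcon.2)

theorem distinguishing_map {g : Equiv.Perm X} (hg : g ∈ G) (x x' : X) :
    distinguishing G (g x) (g x') = distinguishing G x x' := by
  unfold distinguishing
  refine (card_bij (fun y _ => g y) ?_ ?_ ?_).symm
  · intro y hy
    simp only [mem_filter, mem_univ, true_and] at hy ⊢
    intro h
    exact hy (by simpa using h.map (G.inv_mem hg))
  · intro y _ z _ h
    exact g.injective h
  · intro y hy
    simp only [mem_filter, mem_univ, true_and] at hy ⊢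
    refine ⟨g⁻¹ y, fun h => hy (by simpa using h.map hg), by simp⟩

theorem InOrbital.distinguishing_eq {u v x y : X} (h : InOrbital G u v x y) :
    distinguishing G x y = distinguishing G u v := by
  obtain ⟨g, hg, rfl, rfl⟩ := h
  exact distinguishing_map hg u v

theorem card_inOrbital (htr : ∀ x y : X, ∃ g ∈ G, g x = y) (u v x : X) :
    #{y | InOrbital G u v x y} = #{w | SameSuborbit G u v w} := by
  obtain ⟨g, hg, rfl⟩ := htr u x
  refine (card_bij (fun y _ => g y) ?_ ?_ ?_).symm
  · intro y hy
    simp only [mem_filter, mem_univ, true_and] at hy ⊢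
    obtain ⟨k, hk, h1, rfl⟩ := hy
    exact ⟨g * k, G.mul_mem hg hk, by simp [h1], rfl⟩
  · intro y _ z _ h
    exact g.injective h
  · intro y hy
    simp only [mem_filter, mem_univ, true_and] at hy ⊢
    obtain ⟨k, hk, h1, rfl⟩ := hy
    exact ⟨g⁻¹ (k v), ⟨g⁻¹ * k, G.mul_mem (G.inv_mem hg) hk, by simp [h1], rfl⟩, by simp⟩

theorem card_le_two_mul_valency_mul_distinguishing (htr : ∀ x y : X, ∃ g ∈ G, g x = y)
    (hpr : HasTrivialCongruences G) {u v : X} (huv : u ≠ v) :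
    Fintype.card X ≤ 2 * (#{w | SameSuborbit G u v w} * distinguishing G u v) := by
  set arcs : Finset (X × X) := {p | InOrbital G u v p.1 p.2} with harcs
  have hcard : #arcs = Fintype.card X * #{w | SameSuborbit G u v w} := by
    have := card_eq_sum_card_fiberwise (f := Prod.fst) (s := arcs) (t := univ) (by simp)
    rw [this, Finset.sum_const_nat (m := #{w | SameSuborbit G u v w}), card_univ]
    intro x _
    rw [← card_inOrbital htr u v x]
    refine (card_bij (fun y _ => (x, y)) ?_ ?_ ?_).symm
    · intro y hy
      simpa [harcs] using hy
    · intro y _ z _ h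
      simpa using h
    · rintro ⟨a, b⟩ hp
      simp only [harcs, mem_filter, mem_univ, true_and] at hp
      obtain ⟨h, rfl⟩ := hp
      exact ⟨b, by simpa using h, rfl⟩
  have hy : ∀ y : X, Fintype.card X ≤ 2 * #{p ∈ arcs | ¬ SameSuborbit G y p.1 p.2} := by
    intro y
    have hsub : (univ : Finset X) ⊆
        ({p ∈ arcs | ¬ SameSuborbit G y p.1 p.2}).image Prod.fst ∪
        ({p ∈ arcs | ¬ SameSuborbit G y p.1 p.2}).image Prod.snd := by
      intro x _
      obtain ⟨z, hz | hz, hxz⟩ := exists_adj_not_sameSuborbit hpr huv y x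
      · exact mem_union_left _ (mem_image.2 ⟨(x, z), by simpa [harcs] using ⟨hz, hxz⟩, rfl⟩)
      · exact mem_union_right _ (mem_image.2 ⟨(z, x), by
          simpa [harcs] using ⟨hz, fun h => hxz h.symm⟩, rfl⟩)
    have h1 := card_le_card hsub
    have h2 := card_union_le (({p ∈ arcs | ¬ SameSuborbit G y p.1 p.2}).image Prod.fst)
      (({p ∈ arcs | ¬ SameSuborbit G y p.1 p.2}).image Prod.snd)
    have h3 := card_image_le (s := {p ∈ arcs | ¬ SameSuborbit G y p.1 p.2}) (f := Prod.fst)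
    have h4 := card_image_le (s := {p ∈ arcs | ¬ SameSuborbit G y p.1 p.2}) (f := Prod.snd)
    rw [card_univ] at h1
    omega
  have hsum : ∑ y : X, #{p ∈ arcs | ¬ SameSuborbit G y p.1 p.2} = #arcs * distinguishing G u v := by
    simp only [card_filter (fun p : X × X => ¬ SameSuborbit G _ p.1 p.2) arcs]
    rw [Finset.sum_comm, ← smul_eq_mul, ← Finset.sum_const]
    refine Finset.sum_congr rfl fun p hp => ?_
    have hp' : InOrbital G u v p.1 p.2 := by simpa [harcs] using hp
    rw [← hp'.distinguishing_eq, distinguishing, card_filter]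
  have htot : Fintype.card X * Fintype.card X ≤
      Fintype.card X * (2 * (#{w | SameSuborbit G u v w} * distinguishing G u v)) := by
    calc Fintype.card X * Fintype.card X = ∑ _y : X, Fintype.card X := by simp
      _ ≤ ∑ y : X, 2 * #{p ∈ arcs | ¬ SameSuborbit G y p.1 p.2} :=
          Finset.sum_le_sum fun y _ => hy y
      _ = _ := by rw [← Finset.mul_sum, hsum, hcard]; ring
  exact Nat.le_of_mul_le_mul_left htot (Fintype.card_pos_iff.2 ⟨u⟩)

/-- In a primitive group that is not doubly transitive, any two points are distinguished by
at least `√n / 4` points. -/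
theorem card_le_sixteen_mul_sq_distinguishing (htr : ∀ x y : X, ∃ g ∈ G, g x = y)
    (hpr : HasTrivialCongruences G)
    (hn2 : ∃ u v v' : X, v ≠ u ∧ v' ≠ u ∧ ¬ SameSuborbit G u v v') {x x' : X} (hxx : x ≠ x') :
    Fintype.card X ≤ 16 * distinguishing G x x' ^ 2 := by
  obtain ⟨⟨u, v⟩, huv, hmin⟩ := exists_min_image (univ.offDiag : Finset (X × X))
    (fun p => distinguishing G p.1 p.2) ⟨(x, x'), by simpa using hxx⟩
  have huv' : u ≠ v := by simpa using huv
  refine le_trans ?_ (Nat.mul_le_mul_left 16 (Nat.pow_le_pow_left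
    (hmin (x, x') (by simpa using hxx)) 2))
  simp only
  set d := distinguishing G u v with hd
  set k := #{w | SameSuborbit G u v w} with hk
  have hkd := card_le_two_mul_valency_mul_distinguishing htr hpr huv'
  rw [← hd, ← hk] at hkd
  let adj : X → X → Prop := fun x z => InOrbital G u v x z ∨ InOrbital G u v z x
  have adj_symm : ∀ {x z}, adj x z → adj z x := fun h => Or.symm h
  have adj_d : ∀ {x z}, adj x z → distinguishing G x z = d := by
    rintro x z (h | h)
    · exact h.distinguishing_eq
    · rw [distinguishing_comm]; exact h.distinguishing_eq
  have hdeg : ∀ x, k ≤ #{z | adj x z} := by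
    intro x
    rw [hk, ← card_inOrbital htr u v x]
    exact card_le_card fun z hz => by
      simp only [mem_filter, mem_univ, true_and] at hz ⊢
      exact .inl hz
  by_cases hcase : ∃ x p q x', adj x p ∧ adj p q ∧ adj q x' ∧ ∀ z, ¬ (adj x z ∧ adj x' z)
  · obtain ⟨x, p, q, x', h1, h2, h3, hdisj⟩ := hcase
    have hle : distinguishing G x x' ≤ 3 * d := by
      have t1 := distinguishing_triangle (G := G) x p x'
      have t2 := distinguishing_triangle (G := G) p q x'
      rw [adj_d h1] at t1
      rw [adj_d h2, adj_d h3] at t2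
      omega
    have hge : #{z | adj x z} + #{z | adj x' z} ≤ distinguishing G x x' := by
      rw [← card_union_of_disjoint]
      · refine card_le_card ?_
        intro y hy
        simp only [mem_union, mem_filter, mem_univ, true_and] at hy ⊢
        intro hsame
        have key : ∀ {a b}, SameSuborbit G y a b → adj a y → adj b y := by
          rintro a b hab (h | h)
          · exact .inl (h.left_of_sameSuborbit hab)
          · exact .inr (h.right_of_sameSuborbit hab)
        rcases hy with hy | hy
        · exact hdisj y ⟨hy, key hsame hy⟩
        · exact hdisj y ⟨key hsame.symm hy, hy⟩
      · rw [Finset.disjoint_left]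
        intro z hz hz'
        simp only [mem_filter, mem_univ, true_and] at hz hz'
        exact hdisj z ⟨hz, hz'⟩
    have := hdeg x
    have := hdeg x'
    have : 2 * k ≤ 3 * d := by omega
    nlinarith
  · push Not at hcase
    have hcommon : ∀ x x', ∃ z, adj x z ∧ adj x' z := by
      intro x x'
      refine hpr.closed_eq_univ huv' (fun x' => ∃ z, adj x z ∧ adj x' z) ?_ (x₀ := x) ?_ x'
      · rintro a b ⟨z, h1, h2⟩ hab
        exact hcase x z a b h1 (adj_symm h2) hab
      · have : 0 < #{z | adj x z} := by
          refine lt_of_lt_of_le ?_ (hdeg x)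
          exact card_pos.2 ⟨v, by simpa using SameSuborbit.refl G u v⟩
        obtain ⟨z, hz⟩ := card_pos.1 this
        have hz : adj x z := by simpa using hz
        exact ⟨z, hz, hz⟩
    have hle : ∀ x x', distinguishing G x x' ≤ 2 * d := by
      intro x x'
      obtain ⟨z, h1, h2⟩ := hcommon x x'
      have := distinguishing_triangle (G := G) x z x'
      rw [adj_d h1, adj_d (adj_symm h2)] at this
      omega
    obtain ⟨s, t, hst, hsmall⟩ : ∃ s t : X, s ≠ t ∧
        2 * #{w | SameSuborbit G s t w} ≤ Fintype.card X := by
      obtain ⟨s, t, t', ht, ht', hne⟩ := hn2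
      have hdis : #{w | SameSuborbit G s t w} + #{w | SameSuborbit G s t' w} ≤
          Fintype.card X := by
        rw [← card_union_of_disjoint]
        · exact card_le_univ _
        · rw [Finset.disjoint_left]
          intro w hw hw'
          simp only [mem_filter, mem_univ, true_and] at hw hw'
          exact hne (hw.trans hw'.symm)
      by_cases h : 2 * #{w | SameSuborbit G s t w} ≤ Fintype.card X
      · exact ⟨s, t, ht.symm, h⟩
      · exact ⟨s, t', ht'.symm, by omega⟩
    have hkd' := card_le_two_mul_valency_mul_distinguishing htr hpr hst
    set l := #{w | SameSuborbit G s t w} with hl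
    have hn : 0 < Fintype.card X := Fintype.card_pos_iff.2 ⟨u⟩
    have hcount : ∀ y : X, l * (Fintype.card X - l) ≤
        #{p : X × X | ¬ SameSuborbit G y p.1 p.2} := by
      intro y
      have h1 : #{z | InOrbital G s t y z} = l := card_inOrbital htr s t y
      rw [← h1, ← card_compl, ← card_product]
      refine card_le_card ?_
      rintro ⟨a, b⟩ hab
      simp only [mem_product, mem_compl, mem_filter, mem_univ, true_and] at hab ⊢
      exact fun h => hab.2 (hab.1.right_of_sameSuborbit h)
    have hsum : ∑ y : X, #{p : X × X | ¬ SameSuborbit G y p.1 p.2} =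
        ∑ p : X × X, distinguishing G p.1 p.2 := by
      simp only [card_filter (fun p : X × X => ¬ SameSuborbit G _ p.1 p.2)]
      rw [Finset.sum_comm]
      refine Finset.sum_congr rfl fun p _ => ?_
      rw [distinguishing, card_filter]
    have htot : Fintype.card X * (l * (Fintype.card X - l)) ≤
        Fintype.card X * (Fintype.card X * (2 * d)) := by
      calc _ = ∑ _y : X, l * (Fintype.card X - l) := by simp
        _ ≤ _ := Finset.sum_le_sum fun y _ => hcount y
        _ = _ := hsum
        _ ≤ ∑ _p : X × X, 2 * d := Finset.sum_le_sum fun p _ => hle _ _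
        _ = _ := by simp [Fintype.card_prod]; ring
    have htot' := Nat.le_of_mul_le_mul_left htot hn
    have hl4 : l ≤ 4 * d := by
      obtain ⟨e, he⟩ := Nat.exists_eq_add_of_le (show l ≤ Fintype.card X by omega)
      have : Fintype.card X ≤ 2 * (Fintype.card X - l) := by omega
      have h' : Fintype.card X * l ≤ Fintype.card X * (4 * d) := by
        calc Fintype.card X * l ≤ 2 * (Fintype.card X - l) * l := Nat.mul_le_mul_right _ this
          _ = 2 * (l * (Fintype.card X - l)) := by ring
          _ ≤ 2 * (Fintype.card X * (2 * d)) := Nat.mul_le_mul_left _ htot'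
          _ = _ := by ring
      exact Nat.le_of_mul_le_mul_left h' hn
    calc Fintype.card X ≤ 2 * (l * distinguishing G s t) := hkd'
      _ ≤ 2 * ((4 * d) * (2 * d)) := by gcongr; exact hle s t
      _ = 16 * d ^ 2 := by ring

theorem distinguishing_le_card_moved {g : Equiv.Perm X} (hg : g ∈ G) (x : X) :
    distinguishing G x (g x) ≤ #{y | g y ≠ y} := by
  refine card_le_card fun y hy => ?_
  simp only [mem_filter, mem_univ, true_and] at hy ⊢
  exact fun h => hy ⟨g, hg, h, rfl⟩

end Uniprimitive

section LargeOrbits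

open Finset
open scoped Classical

variable {X : Type*}

/-- `x` and `x'` lie in the same orbit of the pointwise stabilizer of `B`. -/
def SameOrbitFixing (G : Subgroup (Equiv.Perm X)) (B : Finset X) (x x' : X) : Prop :=
  ∃ g ∈ G, (∀ b ∈ B, g b = b) ∧ g x = x'

namespace SameOrbitFixing

variable {G : Subgroup (Equiv.Perm X)} {B : Finset X} {x y z w : X}

theorem refl (G : Subgroup (Equiv.Perm X)) (B : Finset X) (x : X) : SameOrbitFixing G B x x :=
  ⟨1, G.one_mem, fun _ _ => rfl, rfl⟩

theorem symm (h : SameOrbitFixing G B x z) : SameOrbitFixing G B z x := by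
  obtain ⟨g, hg, h1, h2⟩ := h
  exact ⟨g⁻¹, G.inv_mem hg, fun b hb => by rw [Equiv.Perm.inv_eq_iff_eq, h1 b hb],
    by rw [Equiv.Perm.inv_eq_iff_eq, h2]⟩

theorem trans (h : SameOrbitFixing G B x z) (h' : SameOrbitFixing G B z w) :
    SameOrbitFixing G B x w := by
  obtain ⟨g, hg, h1, h2⟩ := h
  obtain ⟨k, hk, h3, h4⟩ := h'
  exact ⟨k * g, G.mul_mem hk hg, fun b hb => by simp [h1 b hb, h3 b hb], by simp [h2, h4]⟩

theorem mono {A : Finset X} (hAB : A ⊆ B) (h : SameOrbitFixing G B x z) :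
    SameOrbitFixing G A x z := by
  obtain ⟨g, hg, h1, h2⟩ := h
  exact ⟨g, hg, fun b hb => h1 b (hAB hb), h2⟩

theorem map (h : SameOrbitFixing G B x z) {g : Equiv.Perm X} (hg : g ∈ G) :
    SameOrbitFixing G (B.image g) (g x) (g z) := by
  obtain ⟨k, hk, h1, h2⟩ := h
  refine ⟨g * k * g⁻¹, G.mul_mem (G.mul_mem hg hk) (G.inv_mem hg), ?_, by simp [h2]⟩
  intro b hb
  obtain ⟨c, hc, rfl⟩ := mem_image.1 hb
  simp [h1 c hc]

end SameOrbitFixing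

variable [Fintype X]

/-- The orbit of `x` under the pointwise stabilizer of `B`. -/
noncomputable def orbitFixing (G : Subgroup (Equiv.Perm X)) (B : Finset X) (x : X) : Finset X :=
  {y | SameOrbitFixing G B x y}

variable {G : Subgroup (Equiv.Perm X)}

theorem mem_orbitFixing {B : Finset X} {x y : X} :
    y ∈ orbitFixing G B x ↔ SameOrbitFixing G B x y := by
  simp [orbitFixing]

theorem orbitFixing_eq {B : Finset X} {x y : X} (h : SameOrbitFixing G B x y) :
    orbitFixing G B x = orbitFixing G B y := by
  ext z
  rw [mem_orbitFixing, mem_orbitFixing]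
  exact ⟨fun h' => h.symm.trans h', fun h' => h.trans h'⟩

theorem card_orbitFixing_image (B : Finset X) (x : X) {g : Equiv.Perm X} (hg : g ∈ G) :
    #(orbitFixing G (B.image g) (g x)) = #(orbitFixing G B x) := by
  refine (card_bij (fun y _ => g y) ?_ (fun _ _ _ _ h => g.injective h) ?_).symm
  · intro y hy
    rw [mem_orbitFixing] at hy ⊢
    exact hy.map hg
  · intro y hy
    rw [mem_orbitFixing] at hy
    refine ⟨g⁻¹ y, ?_, by simp⟩
    rw [mem_orbitFixing]
    have := hy.map (G.inv_mem hg)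
    rw [image_image] at this
    simpa using this

theorem card_orbitFixing_mul (B : Finset X) (z : X) :
    #(orbitFixing G B z) * #{g : Equiv.Perm X | g ∈ G ∧ ∀ b ∈ insert z B, g b = b} =
      #{g : Equiv.Perm X | g ∈ G ∧ ∀ b ∈ B, g b = b} := by
  symm
  rw [card_eq_sum_card_fiberwise (f := fun g : Equiv.Perm X => g z) (t := orbitFixing G B z)]
  · rw [Finset.sum_const_nat]
    intro w hw
    obtain ⟨k, hk, h1, rfl⟩ := mem_orbitFixing.1 hw
    refine (card_bij (fun g _ => k * g) ?_ (fun _ _ _ _ h => mul_left_cancel h) ?_).symm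
    · intro g hg
      simp only [mem_filter, mem_univ, true_and, mem_insert, forall_eq_or_imp] at hg ⊢
      obtain ⟨hg, hgz, hgB⟩ := hg
      exact ⟨⟨G.mul_mem hk hg, fun b hb => by simp [hgB b hb, h1 b hb]⟩, by simp [hgz]⟩
    · intro g hg
      simp only [mem_filter, mem_univ, true_and, mem_insert, forall_eq_or_imp] at hg ⊢
      obtain ⟨⟨hg, hgB⟩, hgz⟩ := hg
      refine ⟨k⁻¹ * g, ⟨G.mul_mem (G.inv_mem hk) hg, ?_, fun b hb => ?_⟩, by simp⟩
      · rw [Equiv.Perm.mul_apply, Equiv.Perm.inv_eq_iff_eq, hgz]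
      · rw [Equiv.Perm.mul_apply, Equiv.Perm.inv_eq_iff_eq, hgB b hb, h1 b hb]
  · intro g hg
    simp only [coe_filter, mem_univ, true_and, Set.mem_ofPred_eq] at hg
    exact mem_coe.2 (mem_orbitFixing.2 ⟨g, hg.1, hg.2, rfl⟩)

theorem sameOrbitFixing_of_large {B : Finset X} {x y : X}
    (hx : Fintype.card X < 2 * #(orbitFixing G B x))
    (hy : Fintype.card X < 2 * #(orbitFixing G B y)) : SameOrbitFixing G B x y := by
  by_contra hcon
  have : #(orbitFixing G B x ∪ orbitFixing G B y) = _ := card_union_of_disjoint (by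
    rw [Finset.disjoint_left]
    intro z hz hz'
    exact hcon ((mem_orbitFixing.1 hz).trans (mem_orbitFixing.1 hz').symm))
  have := card_le_univ (orbitFixing G B x ∪ orbitFixing G B y)
  omega

theorem large_mono {A B : Finset X} (hAB : A ⊆ B) {x : X}
    (hx : Fintype.card X < 2 * #(orbitFixing G B x)) :
    Fintype.card X < 2 * #(orbitFixing G A x) :=
  hx.trans_le (Nat.mul_le_mul_left _ (card_le_card fun _ hy =>
    mem_orbitFixing.2 ((mem_orbitFixing.1 hy).mono hAB)))

theorem large_exchange {A : Finset X} {y z : X} (hy : Fintype.card X < 2 * #(orbitFixing G A y))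
    (hz : Fintype.card X < 2 * #(orbitFixing G (insert y A) z)) :
    Fintype.card X < 2 * #(orbitFixing G (insert z A) y) := by
  have hz' := large_mono (subset_insert y A) hz
  have e1 := card_orbitFixing_mul (G := G) (insert y A) z
  have e2 := card_orbitFixing_mul (G := G) (insert z A) y
  have e3 := card_orbitFixing_mul (G := G) A y
  have e4 := card_orbitFixing_mul (G := G) A z
  have pos : ∀ C : Finset X, 0 < #{g : Equiv.Perm X | g ∈ G ∧ ∀ b ∈ C, g b = b} := fun C =>
    card_pos.2 ⟨1, by simp [G.one_mem]⟩
  rw [orbitFixing_eq (sameOrbitFixing_of_large hy hz')] at e3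
  rw [insert_comm] at e2
  have h5 : #{g : Equiv.Perm X | g ∈ G ∧ ∀ b ∈ insert y A, g b = b} =
      #{g : Equiv.Perm X | g ∈ G ∧ ∀ b ∈ insert z A, g b = b} := by
    refine Nat.eq_of_mul_eq_mul_left (show 0 < #(orbitFixing G A z) by omega) (e3.trans e4.symm)
  have h6 := e1.trans (h5.trans e2.symm)
  rwa [Nat.eq_of_mul_eq_mul_right (pos _) h6] at hz

theorem exists_card_eq_large (hn : 2 ≤ Fintype.card X) (t : ℕ)
    (hlarge : ∀ B : Finset X, #B < t → ∃ x, Fintype.card X < 2 * #(orbitFixing G B x)) :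
    ∀ j ≤ t, ∃ T : Finset X, #T = j ∧
      ∀ y ∈ T, Fintype.card X < 2 * #(orbitFixing G (T.erase y) y) := by
  intro j
  induction j with
  | zero => exact fun _ => ⟨∅, by simp⟩
  | succ j ih =>
    intro hj
    obtain ⟨T, hT, hQ⟩ := ih (by omega)
    obtain ⟨z, hz⟩ := hlarge T (by omega)
    have hzT : z ∉ T := by
      intro hzT
      have : orbitFixing G T z ⊆ {z} := by
        intro w hw
        obtain ⟨g, -, h1, rfl⟩ := mem_orbitFixing.1 hw
        simp [h1 z hzT]
      have := card_le_card this
      rw [card_singleton] at this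
      omega
    refine ⟨insert z T, by rw [card_insert_of_notMem hzT, hT], ?_⟩
    intro y hy
    rcases mem_insert.1 hy with rfl | hy
    · rwa [erase_insert hzT]
    · have hzy : y ≠ z := fun h => hzT (h ▸ hy)
      rw [erase_insert_of_ne hzy.symm]
      exact large_exchange (hQ y hy) (by rwa [insert_erase hy])

theorem exists_mem_eq_perm {T : Finset X}
    (hT : ∀ y ∈ T, Fintype.card X < 2 * #(orbitFixing G (T.erase y) y)) (σ : Equiv.Perm T) :
    ∃ g ∈ G, ∀ x : T, g x = σ x := by
  induction σ using Equiv.Perm.swap_induction_on with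
  | one => exact ⟨1, G.one_mem, fun _ => rfl⟩
  | swap_mul f y z hyz ih =>
    obtain ⟨g, hg, hgf⟩ := ih
    have hyz' : (y : X) ≠ z := fun h => hyz (Subtype.ext h)
    set A := (T.erase y).erase z with hA
    have hAz : T.erase z = insert y.1 A := by
      rw [hA, erase_right_comm, insert_erase (mem_erase.2 ⟨hyz', y.2⟩)]
    have hAy : T.erase y = insert z.1 A := by
      rw [hA, insert_erase (mem_erase.2 ⟨hyz'.symm, z.2⟩)]
    have hy := hT y y.2
    have hz := hT z z.2
    rw [hAy] at hy
    rw [hAz] at hz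
    obtain ⟨k, hk, hkA, hkyz⟩ := sameOrbitFixing_of_large (large_mono (subset_insert _ _) hy)
      (large_mono (subset_insert _ _) hz)
    have himg : (insert y.1 A).image k = insert z.1 A := by
      rw [image_insert, hkyz]
      congr 1
      conv_rhs => rw [← image_id (s := A)]
      exact image_congr fun a ha => hkA a ha
    have hkz : Fintype.card X < 2 * #(orbitFixing G (insert z.1 A) (k z)) := by
      rwa [← himg, card_orbitFixing_image _ _ hk]
    obtain ⟨l, hl, hlA, hlz⟩ := sameOrbitFixing_of_large hkz hy
    refine ⟨l * k * g, G.mul_mem (G.mul_mem hl hk) hg, fun x => ?_⟩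
    rw [Equiv.Perm.mul_apply, hgf, Equiv.Perm.mul_apply, Equiv.Perm.mul_apply]
    generalize f x = w
    by_cases hwy : w = y
    · subst hwy
      rw [hkyz, hlA _ (mem_insert_self _ _), Equiv.swap_apply_left]
    · by_cases hwz : w = z
      · subst hwz
        rw [hlz, Equiv.swap_apply_right]
      · have hwA : w.1 ∈ A := by
          rw [hA, mem_erase, mem_erase]
          exact ⟨fun h => hwz (Subtype.ext h), fun h => hwy (Subtype.ext h), w.2⟩
        rw [hkA _ hwA, hlA _ (mem_insert_of_mem hwA), Equiv.swap_apply_of_ne_of_ne hwy hwz]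

theorem exists_primes (s J : ℕ) : ∃ P : Finset ℕ, #P = J ∧
    ∀ p ∈ P, p.Prime ∧ s < p ∧ p ≤ 2 ^ J * (s + 1) := by
  induction J with
  | zero => exact ⟨∅, by simp⟩
  | succ J ih =>
    obtain ⟨P, hP, h⟩ := ih
    obtain ⟨q, hq, h1, h2⟩ := Nat.exists_prime_lt_and_le_two_mul (2 ^ J * (s + 1)) (by positivity)
    have hqP : q ∉ P := fun hqP => by have := (h q hqP).2.2; omega
    refine ⟨insert q P, by rw [card_insert_of_notMem hqP, hP], ?_⟩
    intro p hp
    rcases mem_insert.1 hp with rfl | hp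
    · refine ⟨hq, ?_, by rw [pow_succ]; linarith⟩
      have := Nat.one_le_two_pow (n := J)
      nlinarith
    · obtain ⟨h3, h4, h5⟩ := h p hp
      refine ⟨h3, h4, h5.trans ?_⟩
      exact Nat.mul_le_mul_right _ (Nat.pow_le_pow_right (by norm_num) (by omega))

theorem exists_pow_ne_one_of_prime_dvd_orderOf (g : Equiv.Perm X) {p : ℕ} (hp : p.Prime)
    (hpg : p ∣ orderOf g) :
    ∃ q : ℕ, g ^ q ≠ 1 ∧ ∀ x, (g ^ q) x ≠ x → p ∣ Function.minimalPeriod g x := by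
  have ho : orderOf g ≠ 0 := (orderOf_pos g).ne'
  obtain ⟨a, q, hq, he⟩ := Nat.exists_eq_pow_mul_and_not_dvd ho p hp.ne_one
  refine ⟨q, fun h => ?_, fun x hx => ?_⟩
  · have h1 := orderOf_dvd_of_pow_eq_one h
    exact hq (hpg.trans h1)
  · by_contra hcon
    have h1 : Function.minimalPeriod g x ∣ p ^ a * q := by
      rw [← he, ← Function.isPeriodicPt_iff_minimalPeriod_dvd, Function.IsPeriodicPt,
        ← Equiv.Perm.coe_pow, pow_orderOf_eq_one]
      rfl
    have h2 : Nat.Coprime (Function.minimalPeriod g x) (p ^ a) :=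
      ((Nat.Prime.coprime_iff_not_dvd hp).2 hcon).symm.pow_right a
    have h3 := h2.dvd_of_dvd_mul_left h1
    rw [← Function.isPeriodicPt_iff_minimalPeriod_dvd, Function.IsPeriodicPt,
        ← Equiv.Perm.coe_pow] at h3
    exact hx h3

/-- In a group of linear minimal degree, some set of `O(√n)` points has a pointwise stabilizer
with no orbit of more than half of the points. -/
theorem exists_card_lt_orbitFixing_le (hn : 2 ≤ Fintype.card X)
    (hdeg : ∀ g ∈ G, g ≠ 1 → Fintype.card X ≤ 19 * #{x | g x ≠ x}) :
    ∃ B : Finset X, #B < 20 * (2 ^ 20 * (Nat.sqrt (Fintype.card X) + 1)) ∧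
      ∀ x, 2 * #(orbitFixing G B x) ≤ Fintype.card X := by
  by_contra! hcon
  obtain ⟨T, hTcard, hT⟩ := exists_card_eq_large hn _ hcon _ le_rfl
  obtain ⟨P, hP, hprime⟩ := exists_primes (Nat.sqrt (Fintype.card X)) 20
  obtain ⟨σ, hσ⟩ : ∃ σ : Equiv.Perm T, σ.cycleType = P.val := by
    rw [Equiv.Perm.exists_with_cycleType_iff]
    refine ⟨?_, fun a ha => (hprime a ha).1.two_le⟩
    rw [Fintype.card_coe, hTcard, Finset.sum_val, ← smul_eq_mul]
    nth_rewrite 1 [← hP]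
    exact P.sum_le_card_nsmul id _ fun p hp => (hprime p hp).2.2
  obtain ⟨g, hg, hgσ⟩ := exists_mem_eq_perm hT σ
  have hpow : ∀ (k : ℕ) (x : T), (g ^ k) x = (σ ^ k) x := by
    intro k
    induction k with
    | zero => exact fun _ => rfl
    | succ k ih => intro x; rw [pow_succ, Equiv.Perm.mul_apply, hgσ, ih, pow_succ]; rfl
  have hord : orderOf σ ∣ orderOf g := by
    refine orderOf_dvd_of_pow_eq_one (Equiv.ext fun x => Subtype.ext ?_)
    rw [← hpow, pow_orderOf_eq_one]
    rfl
  have hlarge : ∀ p ∈ P, Fintype.card X ≤ 19 * #{x | p ∣ Function.minimalPeriod g x} := by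
    intro p hp
    obtain ⟨q, hq1, hq⟩ := exists_pow_ne_one_of_prime_dvd_orderOf g (hprime p hp).1
      ((Equiv.Perm.dvd_of_mem_cycleType (by rw [hσ]; exact hp)).trans hord)
    refine (hdeg _ (G.pow_mem hg q) hq1).trans (Nat.mul_le_mul_left _ (card_le_card ?_))
    intro x hx
    simp only [mem_filter, mem_univ, true_and] at hx ⊢
    exact hq x hx
  have hper : ∀ x, 0 < Function.minimalPeriod g x ∧
      Function.minimalPeriod g x ≤ Fintype.card X := by
    intro x
    have h0 : 0 < Function.minimalPeriod g x := by
      refine Function.minimalPeriod_pos_of_mem_periodicPts ⟨orderOf g, orderOf_pos g, ?_⟩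
      rw [Function.IsPeriodicPt, ← Equiv.Perm.coe_pow, pow_orderOf_eq_one]
      rfl
    refine ⟨h0, ?_⟩
    exact Function.minimalPeriod_le_card
  have hdisj : (P : Set ℕ).PairwiseDisjoint
      fun p => ({x | p ∣ Function.minimalPeriod g x} : Finset X) := by
    intro p hp q hq hpq
    rw [Function.onFun, Finset.disjoint_left]
    intro x hx hx'
    simp only [mem_filter, mem_univ, true_and] at hx hx'
    obtain ⟨hp1, hp2, -⟩ := hprime p hp
    obtain ⟨hq1, hq2, -⟩ := hprime q hq
    have hdvd := Nat.Coprime.mul_dvd_of_dvd_of_dvd ((Nat.coprime_primes hp1 hq1).2 hpq) hx hx'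
    have := (Nat.le_of_dvd (hper x).1 hdvd).trans (hper x).2
    have h3 := Nat.lt_succ_sqrt (Fintype.card X)
    have := Nat.mul_le_mul (Nat.succ_le_of_lt hp2) (Nat.succ_le_of_lt hq2)
    omega
  have h1 := card_biUnion hdisj
  have h2 := card_le_univ (P.biUnion fun p => ({x | p ∣ Function.minimalPeriod g x} : Finset X))
  have h3 := P.card_nsmul_le_sum (fun p => 19 * #{x | p ∣ Function.minimalPeriod g x}) _ hlarge
  rw [← Finset.mul_sum, ← h1, hP, smul_eq_mul] at h3
  omega

end LargeOrbits

section Bases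

open Finset
open scoped Classical

variable {X : Type*} [Fintype X] {G : Subgroup (Equiv.Perm X)}

/-- If random translates of `B₀` separate each pair of points with probability at least `δ`,
then a union of few translates is a base. -/
theorem exists_base_of_separating (B₀ : Finset X) (δ : ℝ)
    (hsep : ∀ x x' : X, x ≠ x' → δ * Fintype.card G ≤
      #{g : G | ¬ SameOrbitFixing G (B₀.image g.1) x x'}) (r : ℕ)
    (hδ : δ ≤ 1) (hr : (Fintype.card X : ℝ) ^ 2 * (1 - δ) ^ r < 1) :
    ∃ B : Finset X, #B ≤ r * #B₀ ∧ ∀ g ∈ G, (∀ x ∈ B, g x = x) → g = 1 := by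
  let I := {p : X × X // p.1 ≠ p.2}
  let f : I → G → ℝ := fun p g => if SameOrbitFixing G (B₀.image g.1) p.1.1 p.1.2 then 1 else 0
  have hf : ∀ p g, 0 ≤ f p g := fun p g => by simp only [f]; split_ifs <;> norm_num
  have hθ : ∀ p, ∑ g, f p g ≤ (1 - δ) * Fintype.card G := by
    intro p
    have h1 := hsep p.1.1 p.1.2 p.2
    have h2 := card_filter_add_card_filter_not (s := (univ : Finset G))
      (fun g : G => SameOrbitFixing G (B₀.image g.1) p.1.1 p.1.2)
    rw [card_univ] at h2
    have h3 : ((#{g : G | SameOrbitFixing G (B₀.image g.1) p.1.1 p.1.2} : ℕ) : ℝ) +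
      (#{g : G | ¬ SameOrbitFixing G (B₀.image g.1) p.1.1 p.1.2} : ℕ) = Fintype.card G := by
      exact_mod_cast h2
    simp only [f, Finset.sum_boole]
    linarith
  obtain ⟨γ, hγ⟩ := exists_sum_prod_le f hf (1 - δ) hθ r
  have hI : (Fintype.card I : ℝ) ≤ (Fintype.card X : ℝ) ^ 2 := by
    have := Fintype.card_subtype_le (fun p : X × X => p.1 ≠ p.2)
    rw [Fintype.card_prod, ← sq] at this
    exact_mod_cast this
  have hlt : ∑ p, ∏ j, f p (γ j) < 1 := by
    refine (hγ.trans (mul_le_mul_of_nonneg_right hI ?_)).trans_lt hr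
    exact pow_nonneg (by linarith) r
  refine ⟨univ.biUnion fun j => B₀.image (γ j).1, ?_, ?_⟩
  · refine card_biUnion_le.trans ?_
    refine (Finset.sum_le_card_nsmul _ _ _ fun j _ => card_image_le).trans ?_
    simp
  · intro g hg hfix
    by_contra hg1
    obtain ⟨x, hx⟩ : ∃ x, g x ≠ x := by
      by_contra! h
      exact hg1 (Equiv.ext h)
    have h1 : ∏ j, f ⟨(x, g x), hx.symm⟩ (γ j) = 1 := by
      refine Finset.prod_eq_one fun j _ => ?_
      simp only [f]
      rw [if_pos]
      exact ⟨g, hg, fun b hb => hfix b (mem_biUnion.2 ⟨j, mem_univ _, hb⟩), rfl⟩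
    have h2 := Finset.single_le_sum (f := fun p => ∏ j, f p (γ j))
      (fun p _ => Finset.prod_nonneg fun j _ => hf p (γ j)) (mem_univ ⟨(x, g x), hx.symm⟩)
    rw [h1] at h2
    linarith

theorem sq_mul_one_sub_pow_lt_one {n L r : ℕ} (hn : 1 ≤ n) (hL : n ≤ 2 ^ L) (hL0 : 1 ≤ L) {δ : ℝ}
    (hδ : δ ≤ 1) (hr : 2 * (L : ℝ) ≤ δ * r) : (n : ℝ) ^ 2 * (1 - δ) ^ r < 1 := by
  have h1 : (1 - δ) ^ r ≤ Real.exp (-(2 * (L : ℝ))) := by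
    calc (1 - δ) ^ r ≤ Real.exp (-δ) ^ r :=
          pow_le_pow_left₀ (by linarith) (by linarith [Real.add_one_le_exp (-δ)]) r
      _ = Real.exp (-(δ * r)) := by rw [← Real.exp_nat_mul]; ring_nf
      _ ≤ _ := Real.exp_le_exp.2 (by linarith)
  have h2 : (n : ℝ) < Real.exp L := by
    calc (n : ℝ) ≤ 2 ^ L := by exact_mod_cast hL
      _ < Real.exp 1 ^ L := pow_lt_pow_left₀ (by linarith [Real.exp_one_gt_d9]) (by norm_num)
          (by omega)
      _ = Real.exp L := by rw [← Real.exp_nat_mul, mul_one]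
  have hn0 : (0 : ℝ) < n := by exact_mod_cast hn
  calc (n : ℝ) ^ 2 * (1 - δ) ^ r ≤ (n : ℝ) ^ 2 * Real.exp (-(2 * (L : ℝ))) := by gcongr
    _ < Real.exp L ^ 2 * Real.exp (-(2 * (L : ℝ))) := by gcongr
    _ = 1 := by
        rw [← Real.exp_nat_mul, ← Real.exp_add]
        simp

theorem exists_base_of_uniprimitive (htr : ∀ x y : X, ∃ g ∈ G, g x = y)
    (hpr : HasTrivialCongruences G)
    (hn2 : ∃ u v v' : X, v ≠ u ∧ v' ≠ u ∧ ¬ SameSuborbit G u v v')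
    (L : ℕ) (hL0 : 1 ≤ L) (hL : Fintype.card X ≤ 2 ^ L) :
    ∃ B : Finset X, #B ≤ 8 * L * (Nat.sqrt (Fintype.card X) + 1) ∧
      ∀ g ∈ G, (∀ x ∈ B, g x = x) → g = 1 := by
  obtain ⟨y, -⟩ := id hn2
  have hn : 0 < Fintype.card X := Fintype.card_pos_iff.2 ⟨y⟩
  set s := Nat.sqrt (Fintype.card X) with hs
  have hns : Fintype.card X ≤ (s + 1) ^ 2 := (Nat.lt_succ_sqrt' _).le
  set δ : ℝ := 1 / (4 * (s + 1)) with hδ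
  have hs0 : (0 : ℝ) < s + 1 := by positivity
  have hδ1 : δ ≤ 1 := by
    rw [hδ, div_le_one (by positivity)]
    nlinarith [Nat.cast_nonneg (α := ℝ) s]
  have := exists_base_of_separating (G := G) {y} δ ?_ (8 * L * (s + 1)) hδ1
    (sq_mul_one_sub_pow_lt_one hn hL hL0 hδ1 ?_)
  · simpa using this
  · intro x x' hxx
    have hD := card_le_sixteen_mul_sq_distinguishing htr hpr hn2 hxx
    have hiff : ∀ z, SameOrbitFixing G {z} x x' ↔ SameSuborbit G z x x' := fun z => by
      simp [SameOrbitFixing, SameSuborbit]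
    have e := card_mul_sum_perm G htr (fun z => if ¬ SameSuborbit G z x x' then (1 : ℝ) else 0) y
    simp only [Finset.sum_boole] at e
    simp only [image_singleton, hiff]
    change _ = (Fintype.card G : ℝ) * (distinguishing G x x' : ℝ) at e
    have hnR : (0 : ℝ) < Fintype.card X := by exact_mod_cast hn
    have hGR : (0 : ℝ) < Fintype.card G := by exact_mod_cast Fintype.card_pos
    have hDR : (Fintype.card X : ℝ) ≤ 4 * (s + 1) * distinguishing G x x' := by
      have h1 : (Fintype.card X : ℝ) ≤ (s + 1) ^ 2 := by exact_mod_cast hns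
      have h2 : (Fintype.card X : ℝ) ≤ (4 * distinguishing G x x') ^ 2 := by
        have : (Fintype.card X : ℝ) ≤ 16 * (distinguishing G x x' : ℝ) ^ 2 := by exact_mod_cast hD
        linarith
      refine (pow_le_pow_iff_left₀ hnR.le (by positivity) two_ne_zero).1 ?_
      calc (Fintype.card X : ℝ) ^ 2 = Fintype.card X * Fintype.card X := sq _
        _ ≤ (s + 1) ^ 2 * (4 * distinguishing G x x') ^ 2 := by gcongr
        _ = _ := by ring
    refine le_of_mul_le_mul_left ?_ hnR
    rw [e, hδ]
    calc (Fintype.card X : ℝ) * (1 / (4 * (s + 1)) * Fintype.card G)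
        ≤ (4 * (s + 1) * distinguishing G x x') * (1 / (4 * (s + 1)) * Fintype.card G) := by gcongr
      _ = _ := by field_simp
  · rw [hδ]
    push_cast
    refine le_of_eq ?_
    field_simp
    ring

theorem exists_base_of_doubly_transitive (hn : 2 ≤ Fintype.card X)
    (h2 : ∀ x y x' y' : X, x ≠ y → x' ≠ y' → ∃ g ∈ G, g x = x' ∧ g y = y')
    (h4 : ∀ g ∈ G, g ≠ 1 → 4 ≤ #{x | g x ≠ x})
    (L : ℕ) (hL0 : 1 ≤ L) (hL : Fintype.card X ≤ 2 ^ L) :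
    ∃ B : Finset X, #B ≤ 4 * L * (20 * (2 ^ 20 * (Nat.sqrt (Fintype.card X) + 1))) ∧
      ∀ g ∈ G, (∀ x ∈ B, g x = x) → g = 1 := by
  obtain ⟨B₀, hB₀, horb⟩ := exists_card_lt_orbitFixing_le hn
    (card_le_nineteen_mul_card_moved G h2 h4)
  obtain ⟨B, hB, hbase⟩ := exists_base_of_separating (G := G) B₀ (1 / 2) (by
    intro x x' hxx
    have e := card_mul_sum_perm_pair G h2
      (fun p => if ¬ SameOrbitFixing G B₀ p.1 p.2 then (1 : ℝ) else 0) hxx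
    have hinv : ∑ g : G, (if ¬ SameOrbitFixing G B₀ (g.1 x) (g.1 x') then (1 : ℝ) else 0) =
        ∑ g : G, if ¬ SameOrbitFixing G (B₀.image g.1) x x' then (1 : ℝ) else 0 := by
      refine Fintype.sum_equiv (Equiv.inv G) _ _ fun g => ?_
      have : SameOrbitFixing G B₀ (g.1 x) (g.1 x') ↔
          SameOrbitFixing G (B₀.image (g⁻¹).1) x x' := by
        constructor
        · intro h
          simpa using h.map (g⁻¹).2
        · intro h
          have := h.map g.2
          rw [image_image] at this
          simpa [Function.comp_def] using this
      simp only [this, Equiv.inv_apply]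
    rw [hinv, Finset.sum_boole, Finset.sum_boole] at e
    have hOpos : (0 : ℝ) < (#(univ.offDiag : Finset (X × X)) : ℝ) := by
      exact_mod_cast card_pos.2 ⟨(x, x'), by simpa using hxx⟩
    have hfib : Fintype.card X * Fintype.card X ≤
        2 * #{p ∈ (univ.offDiag : Finset (X × X)) | ¬ SameOrbitFixing G B₀ p.1 p.2} := by
      have hset : (univ.offDiag : Finset (X × X)).filter (fun p => ¬ SameOrbitFixing G B₀ p.1 p.2) =
          univ.filter fun p => ¬ SameOrbitFixing G B₀ p.1 p.2 := by
        ext ⟨a, b⟩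
        simp only [mem_filter, mem_offDiag, mem_univ, true_and, and_iff_right_iff_imp]
        rintro h rfl
        exact h (SameOrbitFixing.refl G B₀ a)
      have hcount : #{p : X × X | ¬ SameOrbitFixing G B₀ p.1 p.2} =
          ∑ a : X, #{b | ¬ SameOrbitFixing G B₀ a b} := by
        rw [card_filter, Fintype.sum_prod_type]
        exact Finset.sum_congr rfl fun a _ => (card_filter _ _).symm
      rw [hset, hcount, Finset.mul_sum, ← smul_eq_mul, ← card_univ, ← Finset.sum_const]
      refine Finset.sum_le_sum fun a _ => ?_
      have h1 := card_filter_add_card_filter_not (s := (univ : Finset X))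
        (fun b => SameOrbitFixing G B₀ a b)
      have h2 := horb a
      rw [orbitFixing] at h2
      rw [card_univ] at h1 ⊢
      omega
    have hO : #(univ.offDiag : Finset (X × X)) ≤ Fintype.card X * Fintype.card X := by
      rw [offDiag_card, card_univ]; exact Nat.sub_le _ _
    have hOR : ((#(univ.offDiag : Finset (X × X)) : ℕ) : ℝ) ≤
        2 * #{p ∈ (univ.offDiag : Finset (X × X)) | ¬ SameOrbitFixing G B₀ p.1 p.2} := by
      exact_mod_cast hO.trans hfib
    refine le_of_mul_le_mul_left ?_ hOpos
    rw [e]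
    have hGR : (0 : ℝ) < Fintype.card G := by exact_mod_cast Fintype.card_pos
    nlinarith) (4 * L) (by norm_num)
    (sq_mul_one_sub_pow_lt_one (by omega) hL hL0 (by norm_num) (by push_cast; linarith))
  exact ⟨B, hB.trans (Nat.mul_le_mul_left _ hB₀.le), hbase⟩

/-- Primitive groups without elements of support less than four have small bases and
large minimal degree. -/
theorem exists_base_and_card_moved (htr : ∀ x y : X, ∃ g ∈ G, g x = y)
    (hpr : HasTrivialCongruences G) (h4 : ∀ g ∈ G, g ≠ 1 → 4 ≤ #{x | g x ≠ x})
    (hn : 2 ≤ Fintype.card X) (L : ℕ) (hL0 : 1 ≤ L) (hL : Fintype.card X ≤ 2 ^ L) :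
    (∃ B : Finset X, #B ≤ 4 * L * (20 * (2 ^ 20 * (Nat.sqrt (Fintype.card X) + 1))) ∧
      ∀ g ∈ G, (∀ x ∈ B, g x = x) → g = 1) ∧
    ∀ g ∈ G, g ≠ 1 → Fintype.card X ≤ 361 * #{x | g x ≠ x} ^ 2 := by
  by_cases hn2 : ∃ u v v' : X, v ≠ u ∧ v' ≠ u ∧ ¬ SameSuborbit G u v v'
  · refine ⟨?_, fun g hg hg1 => ?_⟩
    · obtain ⟨B, hB, hbase⟩ := exists_base_of_uniprimitive htr hpr hn2 L hL0 hL
      exact ⟨B, hB.trans (by nlinarith), hbase⟩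
    · obtain ⟨x, hx⟩ : ∃ x, g x ≠ x := by
        by_contra! h
        exact hg1 (Equiv.ext h)
      have h1 := card_le_sixteen_mul_sq_distinguishing htr hpr hn2 hx.symm
      have h2 := Nat.pow_le_pow_left (distinguishing_le_card_moved hg x) 2
      omega
  · push Not at hn2
    have h2 : ∀ x y x' y' : X, x ≠ y → x' ≠ y' → ∃ g ∈ G, g x = x' ∧ g y = y' := by
      intro x y x' y' hxy hxy'
      obtain ⟨g, hg, hgx⟩ := htr x x'
      obtain ⟨k, hk, hk1, hk2⟩ := hn2 x' (g y) y'
        (fun h => hxy (g.injective (hgx.trans h.symm))) hxy'.symm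
      exact ⟨k * g, G.mul_mem hk hg, by simp [hgx, hk1], by simp [hk2]⟩
    refine ⟨exists_base_of_doubly_transitive hn h2 h4 L hL0 hL, fun g hg hg1 => ?_⟩
    have h1 := card_le_nineteen_mul_card_moved G h2 h4 g hg hg1
    nlinarith

end Bases

section OrbitRigidity

open Finset
open scoped Classical

theorem eventually_parameters (c : ℝ) (hc : c < 1 / 2) :
    ∃ n₀ : ℕ, ∀ n : ℕ, n₀ ≤ n → 2 ≤ n ∧ 1 ≤ Nat.clog 2 n ∧
      2 ^ 24 * (Nat.clog 2 n ^ 2 * (4 * Nat.clog 2 n * (20 * (2 ^ 20 * (Nat.sqrt n + 1))))) ≤ n ∧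
      4 * Nat.clog 2 n ≤ Nat.sqrt n / 228 ∧
      ((n : ℝ) + 1) < 2 ^ (Nat.sqrt n / 228) * Real.exp (-(n : ℝ) ^ c) := by
  have hlog := (isLittleO_log_rpow_atTop (show (0 : ℝ) < 1 / 12 by norm_num)).bound
    (show (0 : ℝ) < 1 by norm_num)
  have hpow : ∀ᶠ x : ℝ in Filter.atTop, 2000 ≤ x ^ (1 / 2 - c) :=
    (tendsto_rpow_atTop (sub_pos.2 hc)).eventually_ge_atTop 2000
  have hbig := (tendsto_rpow_atTop (show (0 : ℝ) < 1 / 12 by norm_num)).eventually_ge_atTop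
    ((2 : ℝ) ^ 19)
  have hev := ((hlog.and hpow).and (hbig.and (Filter.eventually_ge_atTop (2 : ℝ))))
  obtain ⟨n₀, hn₀⟩ := Filter.eventually_atTop.1 (tendsto_natCast_atTop_atTop.eventually hev)
  refine ⟨n₀, fun n hn => ?_⟩
  obtain ⟨⟨h1, h2⟩, h3, h4⟩ := hn₀ n hn
  replace h2 : 2000 ≤ (n : ℝ) ^ (1 / 2 - c) := h2
  have hn2 : 2 ≤ n := by exact_mod_cast h4
  set x : ℝ := (n : ℝ) with hx
  have hx0 : 0 < x := by linarith
  set u : ℝ := x ^ (1 / 12 : ℝ) with hu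
  have hu12 : u ^ 12 = x := by
    rw [hu, ← Real.rpow_natCast, ← Real.rpow_mul hx0.le]; norm_num
  have hu6 : x ^ (1 / 2 : ℝ) = u ^ 6 := by
    rw [hu, ← Real.rpow_natCast, ← Real.rpow_mul hx0.le]; norm_num
  have hu0 : 0 < u := by positivity
  rw [Real.norm_of_nonneg (Real.log_nonneg (by linarith)), Real.norm_of_nonneg hu0.le,
    one_mul] at h1
  have hxc : 2000 * x ^ c ≤ u ^ 6 := by
    have : x ^ (1 / 2 - c) * x ^ c = u ^ 6 := by
      rw [← Real.rpow_add hx0, sub_add_cancel, hu6]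
    rw [← this]
    gcongr
  obtain ⟨L, hL⟩ : ∃ L, Nat.clog 2 n = L := ⟨_, rfl⟩
  obtain ⟨s, hs⟩ : ∃ s, Nat.sqrt n = s := ⟨_, rfl⟩
  have hL1 : 1 ≤ L := by
    rw [← hL]; exact Nat.clog_pos (by norm_num) hn2
  have hLu : (L : ℝ) ≤ 3 * u := by
    have hlt : 2 ^ (L - 1) < n := by
      rw [← hL]; exact Nat.pow_pred_clog_lt_self (by norm_num) (by omega)
    have hlt' : (2 : ℝ) ^ (L - 1) < x := by rw [hx]; exact_mod_cast hlt
    have := Real.log_lt_log (by positivity) hlt'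
    rw [Real.log_pow, Nat.cast_sub hL1] at this
    have hl2 := Real.log_two_gt_d9
    have hL1' : (1 : ℝ) ≤ L := by exact_mod_cast hL1
    push_cast at this
    nlinarith
  have hsx : (s : ℝ) ^ 2 ≤ x := by
    rw [hx, ← hs]; exact_mod_cast Nat.sqrt_le' n
  have hsx' : x < ((s : ℝ) + 1) ^ 2 := by
    rw [hx, ← hs]; exact_mod_cast Nat.lt_succ_sqrt' n
  have hu66 : x = (u ^ 6) ^ 2 := by rw [← hu12]; ring
  have hsu : (s : ℝ) ≤ u ^ 6 := by
    rw [hu66] at hsx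
    exact (pow_le_pow_iff_left₀ (by positivity) (by positivity) two_ne_zero).1 hsx
  have hsu' : u ^ 6 < (s : ℝ) + 1 := by
    rw [hu66] at hsx'
    exact (pow_lt_pow_iff_left₀ (by positivity) (by positivity) two_ne_zero).1 hsx'
  have hu1 : (1 : ℝ) ≤ u := by linarith [show (1 : ℝ) ≤ 2 ^ 19 by norm_num]
  have hu61 : 2 ^ 95 * u ≤ u ^ 6 := by
    calc (2 : ℝ) ^ 95 * u = (2 ^ 19) ^ 5 * u := by norm_num
      _ ≤ u ^ 5 * u := by gcongr
      _ = u ^ 6 := by ring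
  rw [hL, hs]
  refine ⟨hn2, hL1, ?_, ?_, ?_⟩
  · have : (2 : ℝ) ^ 24 * (L ^ 2 * (4 * L * (20 * (2 ^ 20 * (s + 1))))) ≤ x := by
      calc (2 : ℝ) ^ 24 * (L ^ 2 * (4 * L * (20 * (2 ^ 20 * (s + 1)))))
          ≤ 2 ^ 24 * ((3 * u) ^ 2 * (4 * (3 * u) * (20 * (2 ^ 20 * (u ^ 6 + u ^ 6))))) := by
            have : (1 : ℝ) ≤ u ^ 6 := one_le_pow₀ hu1
            gcongr
        _ = (2 ^ 24 * 9 * 4 * 3 * 20 * 2 ^ 20 * 2) * u ^ 9 := by ring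
        _ ≤ (2 ^ 19) ^ 3 * u ^ 9 := by gcongr; norm_num
        _ ≤ u ^ 3 * u ^ 9 := by gcongr
        _ = x := by rw [← hu12]; ring
    rw [hx] at this
    exact_mod_cast this
  · rw [Nat.le_div_iff_mul_le (by norm_num)]
    have : (4 : ℝ) * L * 228 ≤ s := by
      linarith
    exact_mod_cast this
  · have ha : (s : ℝ) < 228 * ((s / 228 : ℕ) : ℝ) + 228 := by
      have : s < 228 * (s / 228) + 228 := by omega
      exact_mod_cast this
    set a := s / 228
    have hl2 := Real.log_two_gt_d9
    have hkey : 1 + Real.log x + x ^ c < a * Real.log 2 := by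
      have : (a : ℝ) * 0.69 ≤ a * Real.log 2 := by gcongr; linarith
      linarith
    calc x + 1 ≤ Real.exp 1 * x := by nlinarith [Real.exp_one_gt_d9]
      _ = Real.exp (1 + Real.log x + x ^ c) * Real.exp (-x ^ c) := by
          rw [← Real.exp_add, add_neg_cancel_right, Real.exp_add, Real.exp_log hx0]
      _ < Real.exp (a * Real.log 2) * Real.exp (-x ^ c) := by gcongr
      _ = 2 ^ a * Real.exp (-x ^ c) := by
          rw [Real.exp_nat_mul, Real.exp_log (by norm_num)]

variable {X : Type*}

theorem le_of_mem_setAut {G : Subgroup (Equiv.Perm X)} {g : Equiv.Perm X} (hg : g ∈ G)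
    (Y : Set X) : g ∈ setAut (setOrbit G Y) := by
  ext Z
  constructor
  · rintro ⟨_, ⟨k, hk, rfl⟩, rfl⟩
    exact ⟨g * k, G.mul_mem hg hk, by simp [Set.image_image]⟩
  · rintro ⟨k, hk, rfl⟩
    exact ⟨(g⁻¹ * k : Equiv.Perm X) '' Y, ⟨g⁻¹ * k, G.mul_mem (G.inv_mem hg) hk, rfl⟩, by
      simp [Set.image_image]⟩

/-- The automorphism group of a family of subsets. -/
def setAutSubgroup (ℬ : Set (Set X)) : Subgroup (Equiv.Perm X) where
  carrier := setAut ℬ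
  mul_mem' {g h} hg hh := by
    have hg' : (fun Y : Set X => (g : X → X) '' Y) '' ℬ = ℬ := hg
    have hh' : (fun Y : Set X => (h : X → X) '' Y) '' ℬ = ℬ := hh
    change (fun Y : Set X => ((g * h : Equiv.Perm X) : X → X) '' Y) '' ℬ = ℬ
    conv_rhs => rw [← hg', ← hh', Set.image_image]
    simp [Set.image_image]
  one_mem' := by
    change (fun Y : Set X => ((1 : Equiv.Perm X) : X → X) '' Y) '' ℬ = ℬ
    simp
  inv_mem' {g} hg := by
    have hg' : (fun Y : Set X => (g : X → X) '' Y) '' ℬ = ℬ := hg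
    change (fun Y : Set X => ((g⁻¹ : Equiv.Perm X) : X → X) '' Y) '' ℬ = ℬ
    conv_lhs => rw [← hg', Set.image_image]
    simp [Set.image_image]

/-- The stabilizer of `Y` in the automorphism group of its orbit. -/
def orbitStabilizer (G : Subgroup (Equiv.Perm X)) (Y : Set X) : Subgroup (Equiv.Perm X) where
  carrier := {h | h ∈ setAutSubgroup (setOrbit G Y) ∧ (h : X → X) '' Y = Y}
  mul_mem' {g h} hg hh := by
    refine ⟨Subgroup.mul_mem _ hg.1 hh.1, ?_⟩
    rw [Equiv.Perm.coe_mul, Set.image_comp, hh.2, hg.2]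
  one_mem' := ⟨Subgroup.one_mem _, by simp⟩
  inv_mem' {g} hg := by
    refine ⟨Subgroup.inv_mem _ hg.1, ?_⟩
    conv_lhs => rw [← hg.2, ← Set.image_comp]
    simp

theorem isOrbitStabilizer_orbitStabilizer (G : Subgroup (Equiv.Perm X)) (Y : Set X) :
    IsOrbitStabilizer G (orbitStabilizer G Y) Y where
  exists_mem h hh g hg := by
    have h1 : (fun Z : Set X => (h : X → X) '' Z) '' setOrbit G Y = setOrbit G Y := hh.1
    have h2 : (h : X → X) '' ((g : X → X) '' Y) ∈ setOrbit G Y := by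
      rw [← h1]; exact ⟨_, ⟨g, hg, rfl⟩, rfl⟩
    obtain ⟨k, hk, hkY⟩ := h2
    refine ⟨k * g⁻¹, G.mul_mem hk (G.inv_mem hg), ?_, ?_⟩
    · have mem : ∀ {x}, x ∈ G → x ∈ setAutSubgroup (setOrbit G Y) := fun hx => le_of_mem_setAut hx Y
      exact Subgroup.mul_mem _ (Subgroup.mul_mem _ (Subgroup.mul_mem _ (mem (G.inv_mem hg))
        (mem (G.inv_mem (G.mul_mem hk (G.inv_mem hg))))) hh.1) (mem hg)
    · have : g⁻¹ * (k * g⁻¹)⁻¹ * h * g = k⁻¹ * (h * g) := by group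
      rw [this, Equiv.Perm.coe_mul, Set.image_comp, Equiv.Perm.coe_mul, Set.image_comp, ← hkY,
        ← Set.image_comp]
      simp
  mem_iff h hh x := by
    conv_rhs => rw [← hh.2]
    simp

theorem orbitStabilizer_ne_bot {G : Subgroup (Equiv.Perm X)} {Y : Set X}
    (hY : (G : Set (Equiv.Perm X)) ⊂ setAut (setOrbit G Y)) : orbitStabilizer G Y ≠ ⊥ := by
  obtain ⟨h, hh, hG⟩ := Set.exists_of_ssubset hY
  intro hbot
  have h1 : (fun Z : Set X => (h : X → X) '' Z) '' setOrbit G Y = setOrbit G Y := hh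
  have h2 : (h : X → X) '' Y ∈ setOrbit G Y := by
    rw [← h1]; exact ⟨Y, ⟨1, G.one_mem, by simp⟩, rfl⟩
  obtain ⟨k, hk, hkY⟩ := h2
  have h3 : k⁻¹ * h ∈ orbitStabilizer G Y := by
    refine ⟨Subgroup.mul_mem _ (le_of_mem_setAut (G.inv_mem hk) Y) hh, ?_⟩
    rw [Equiv.Perm.coe_mul, Set.image_comp, ← hkY, ← Set.image_comp]
    simp
  rw [hbot, Subgroup.mem_bot, inv_mul_eq_one] at h3
  exact hG (h3 ▸ hk)

theorem IsPrimitiveSubgroup.hasTrivialCongruences {G : Subgroup (Equiv.Perm X)}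
    (hG : IsPrimitiveSubgroup G) : HasTrivialCongruences G := by
  intro s hs hinv u v huv hsuv x y
  have hinv' : ∀ g ∈ G, ∀ x y, s (g x) (g y) → s x y := fun g hg x y h => by
    simpa using hinv g⁻¹ (G.inv_mem hg) _ _ h
  have huniv : ∀ y, s u y := by
    have hblock : MulAction.IsBlock G {y | s u y} := by
      rw [MulAction.isBlock_iff_smul_eq_of_nonempty]
      rintro g ⟨w, ⟨z, hz, hzw⟩, hw⟩
      have hzw' : g.1 z = w := hzw
      have hz' : s u z := hz
      have hw' : s u w := hw
      have hgu : s u (g.1 u) := by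
        refine hs.trans hw' (hs.symm ?_)
        rw [← hzw']
        exact hinv _ g.2 _ _ hz'
      ext y
      constructor
      · rintro ⟨y, hy, rfl⟩
        exact hs.trans hgu (hinv _ g.2 _ _ hy)
      · intro hy
        have hy' : s u y := hy
        refine ⟨g.1⁻¹ y, ?_, by simp [Subgroup.smul_def]⟩
        refine hinv' _ g.2 _ _ ?_
        simpa using hs.trans (hs.symm hgu) hy'
    rcases hG.2 _ hblock with h | h
    · exact absurd (h (hs.refl u) hsuv) huv
    · exact fun y => (h ▸ Set.mem_univ y : y ∈ {y | s u y})
  exact hs.trans (hs.symm (huniv x)) (huniv y)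

theorem IsPrimitiveSubgroup.four_le_card_moved [Fintype X] [DecidableEq X]
    {G : Subgroup (Equiv.Perm X)} (hG : IsPrimitiveSubgroup G) (htop : G ≠ ⊤)
    (halt : G ≠ alternatingGroup X) : ∀ g ∈ G, g ≠ 1 → 4 ≤ #{x | g x ≠ x} := by
  intro g hg hg1
  have hprim : MulAction.IsPreprimitive G X :=
    { toIsPretransitive := hG.1, isTrivialBlock_of_isBlock := fun {B} => hG.2 B }
  have hsupp : #{x | g x ≠ x} = #g.support := by
    congr 1
  rw [hsupp]
  have h0 : #g.support ≠ 0 := fun h => hg1 (Equiv.Perm.card_support_eq_zero.1 h)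
  have h1 := Equiv.Perm.card_support_ne_one g
  have h2 : #g.support ≠ 2 := fun h =>
    htop (Equiv.Perm.subgroup_eq_top_of_isPreprimitive_of_isSwap_mem hprim g
      (Equiv.Perm.card_support_eq_two.1 h) hg)
  have h3 : #g.support ≠ 3 := by
    intro h
    have hle := Equiv.Perm.alternatingGroup_le_of_isPreprimitive_of_isThreeCycle_mem hprim
      (card_support_eq_three_iff.1 h) hg
    have : Nontrivial X := by
      obtain ⟨x, hx⟩ := card_pos.1 (Nat.pos_of_ne_zero h0)
      exact ⟨g x, x, by simpa using hx⟩
    have hidx := Subgroup.relIndex_mul_index hle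
    rw [alternatingGroup.index_eq_two] at hidx
    rcases (Nat.dvd_prime Nat.prime_two).1 (Dvd.intro_left _ hidx) with h | h
    · exact htop (Subgroup.index_eq_one.1 h)
    · exact halt (Equiv.Perm.eq_alternatingGroup_of_index_eq_two h)
  omega

theorem ncard_lt_of_four_le_card_moved {X : Type*} [Fintype X] {G : Subgroup (Equiv.Perm X)}
    (htr : ∀ x y : X, ∃ g ∈ G, g x = y) (hG : HasTrivialCongruences G)
    (h4 : ∀ g ∈ G, g ≠ 1 → 4 ≤ #{x | g x ≠ x}) {n : ℕ} (hn : Fintype.card X = n) {r : ℝ}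
    (hn2 : 2 ≤ n) (hL0 : 1 ≤ Nat.clog 2 n)
    (hK : 2 ^ 24 * (Nat.clog 2 n ^ 2 *
      (4 * Nat.clog 2 n * (20 * (2 ^ 20 * (Nat.sqrt n + 1))))) ≤ n)
    (hLa : 4 * Nat.clog 2 n ≤ Nat.sqrt n / 228)
    (hfin : ((n : ℝ) + 1) < 2 ^ (Nat.sqrt n / 228) * r) :
    ({Y : Set X | (G : Set (Equiv.Perm X)) ⊂ setAut (setOrbit G Y)}.ncard : ℝ) < 2 ^ n * r := by
  have hL := Nat.le_pow_clog (b := 2) (by norm_num) n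
  subst hn
  obtain ⟨⟨B, hB, hbase⟩, hmoved⟩ := exists_base_and_card_moved htr
    hG h4 hn2 _ hL0 hL
  set n := Fintype.card X with hn
  have hmin : ∀ g ∈ G, g ≠ 1 → 12 * (Nat.sqrt n / 228) ≤ #{x | g x ≠ x} := by
    intro g hg hg1
    have h1 := hmoved g hg hg1
    have h2 : (228 * (Nat.sqrt n / 228)) ^ 2 ≤ (19 * #{x | g x ≠ x}) ^ 2 := by
      calc _ ≤ Nat.sqrt n ^ 2 := Nat.pow_le_pow_left (Nat.mul_div_le _ _) 2
        _ ≤ n := Nat.sqrt_le' n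
        _ ≤ _ := h1
        _ = _ := by ring
    have h3 := (Nat.pow_le_pow_iff_left two_ne_zero).1 h2
    omega
  have hcount := ncard_orbit_stabilizer_ne_bot_mul_le G htr B hbase _ _ _ hL hB hK hLa (by
    have h1 : Nat.sqrt n / 228 ≤ Nat.sqrt n := Nat.div_le_self _ _
    nlinarith) hL0 hmin
  have hsub : {Y : Set X | (G : Set (Equiv.Perm X)) ⊂ setAut (setOrbit G Y)}.ncard ≤
      {Y : Set X | ∃ P, IsOrbitStabilizer G P Y ∧ P ≠ ⊥}.ncard := by
    refine Set.ncard_le_ncard (fun Y hY => ?_) (Set.toFinite _)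
    exact ⟨orbitStabilizer G Y, isOrbitStabilizer_orbitStabilizer G Y, orbitStabilizer_ne_bot hY⟩
  have hR : ({Y : Set X | (G : Set (Equiv.Perm X)) ⊂ setAut (setOrbit G Y)}.ncard : ℝ) *
      2 ^ (Nat.sqrt n / 228) ≤ ((n : ℝ) + 1) * 2 ^ n := by
    exact_mod_cast (Nat.mul_le_mul_right _ hsub).trans hcount
  refine lt_of_mul_lt_mul_right (hR.trans_lt ?_) (by positivity : (0 : ℝ) ≤ 2 ^ (Nat.sqrt n / 228))
  calc ((n : ℝ) + 1) * 2 ^ n < (2 ^ (Nat.sqrt n / 228) * r) * 2 ^ n := by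
        gcongr
    _ = _ := by ring

end OrbitRigidity

theorem random_subset_orbit_rigid (c : ℝ) (hc0 : 0 < c) (hc : c < 1 / 2) :
    ∃ n₀ : ℕ, ∀ (X : Type) [Fintype X] [DecidableEq X],
      n₀ ≤ Fintype.card X →
      ∀ G : Subgroup (Equiv.Perm X), IsPrimitiveSubgroup G →
        G ≠ alternatingGroup X →
        (Set.ncard {Y : Set X | (G : Set (Equiv.Perm X)) ⊂ setAut (setOrbit G Y)} : ℝ) <
          2 ^ (Fintype.card X) * Real.exp (-(Fintype.card X : ℝ) ^ c) := by
  obtain ⟨n₀, hn₀⟩ := eventually_parameters c hc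
  refine ⟨n₀, fun X _ _ hX G hG halt => ?_⟩
  obtain ⟨hn2, hL0, hK, hLa, hfin⟩ := hn₀ _ hX
  by_cases htop : G = ⊤
  · have : {Y : Set X | (G : Set (Equiv.Perm X)) ⊂ setAut (setOrbit G Y)} = ∅ := by
      ext Y
      simp only [Set.mem_ofPred_eq, Set.mem_empty_iff_false, iff_false]
      intro h
      rw [htop, Subgroup.coe_top] at h
      exact h.2 (Set.subset_univ _)
    rw [this, Set.ncard_empty, Nat.cast_zero]
    positivity
  · have htr : ∀ x y : X, ∃ g ∈ G, g x = y := by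
      intro x y
      obtain ⟨g, hg⟩ := hG.1.exists_smul_eq x y
      exact ⟨g.1, g.2, hg⟩
    have h4 : ∀ g ∈ G, g ≠ 1 → 4 ≤ Finset.card {x | g x ≠ x} := by
      convert hG.four_le_card_moved htop halt
    exact ncard_lt_of_four_le_card_moved htr hG.hasTrivialCongruences (by convert h4) rfl hn2 hL0 hK
      hLa hfin
end

section
/- There is an absolute constant c > 0 such that the following holds. Let m ≥ 2 and let X be a finite set with n := |X| = m². If G ≤ Sym(X) is primitive, then the number of subgroups M ≤ Sym(X) such that M is a copy of S_m ≀ S_2 in product action and G ≤ M is at most n^(c·log n). (log denotes the natural logarithm.) -/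
/-- The product action of the wreath product `S_m ≀ S_k` on `Fin k → Fin m`,
as a set of permutations: all permutations `x ↦ (i ↦ π i (x (τ⁻¹ i)))` with
`π : Fin k → Sym(Fin m)` and `τ ∈ Sym(Fin k)`. -/
def wreathProductAction (m k : ℕ) : Set (Equiv.Perm (Fin k → Fin m)) :=
  {w | ∃ (π : Fin k → Equiv.Perm (Fin m)) (τ : Equiv.Perm (Fin k)),
        ∀ (x : Fin k → Fin m) (i : Fin k), w x i = π i (x (τ⁻¹ i))}

/-- A subgroup `M ≤ Sym(X)` is a copy of `S_m ≀ S_k` in product action if there is a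
bijection `e : X → (Fin k → Fin m)` conjugating the wreath product in product action to `M`. -/
def IsWreathCopy {X : Type*} (m k : ℕ) (M : Subgroup (Equiv.Perm X)) : Prop :=
  ∃ e : X ≃ (Fin k → Fin m),
    (M : Set (Equiv.Perm X)) =
      {p | ∃ w ∈ wreathProductAction m k, p = (e.trans w).trans e.symm}

section Blocks

open MulAction
open scoped Pointwise

/-- The smallest block of the action of `N` on `X` that contains the set `S`. -/
def blockClosure (N : Type*) {X : Type*} [Group N] [MulAction N X] (S : Set X) : Set X :=
  ⋂ C : {C : Set X // IsBlock N C ∧ S ⊆ C}, (C : Set X)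

variable {N X : Type*} [Group N] [MulAction N X]

theorem isBlock_blockClosure (S : Set X) : IsBlock N (blockClosure N S) :=
  IsBlock.iInter fun C => C.2.1

theorem subset_blockClosure (S : Set X) : S ⊆ blockClosure N S :=
  Set.subset_iInter fun C => C.2.2

theorem blockClosure_subset {S C : Set X} (hC : IsBlock N C) (hS : S ⊆ C) :
    blockClosure N S ⊆ C :=
  Set.iInter_subset (fun C : {C : Set X // IsBlock N C ∧ S ⊆ C} => (C : Set X)) ⟨C, hC, hS⟩

theorem two_mul_ncard_le_of_isBlock_ssubset [Finite X] [IsPretransitive N X] {B C : Set X}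
    (hB : IsBlock N B) (hC : IsBlock N C) {x : X} (hx : x ∈ C) (h : C ⊂ B) :
    2 * C.ncard ≤ B.ncard := by
  obtain ⟨y, hyB, hyC⟩ := Set.exists_of_ssubset h
  obtain ⟨g, rfl⟩ := exists_smul_eq N x y
  have hgB : g • B = B := hB.smul_eq_of_mem (h.1 hx) hyB
  have hdisj : Disjoint (g • C) C := by
    refine hC.disjoint_smul_of_ne fun hg => hyC ?_
    rw [← hg]
    exact Set.smul_mem_smul_set hx
  have hsub : g • C ∪ C ⊆ B := by
    refine Set.union_subset ?_ h.1
    rw [← hgB]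
    exact Set.smul_set_mono h.1
  have hcard := Set.ncard_le_ncard hsub
  rw [Set.ncard_union_eq hdisj, Set.ncard_smul_set] at hcard
  omega

theorem exists_blockClosure_insert_range_eq [Finite X] [IsPretransitive N X] (x : X) (k : ℕ) :
    ∀ B : Set X, IsBlock N B → x ∈ B → B.ncard < 2 ^ (k + 1) →
      ∃ f : Fin k → X, blockClosure N (insert x (Set.range f)) = B := by
  induction k with
  | zero =>
    intro B hB hx hcard
    have hBx : B = {x} := by
      refine (Set.eq_of_subset_of_ncard_le (Set.singleton_subset_iff.2 hx) ?_).symm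
      rw [Set.ncard_singleton]
      omega
    refine ⟨Fin.elim0, ?_⟩
    subst hBx
    refine (blockClosure_subset hB (by simp)).antisymm ?_
    exact Set.singleton_subset_iff.2 (subset_blockClosure _ (Set.mem_insert _ _))
  | succ k ih =>
    intro B hB hx hcard
    by_cases hBx : B = {x}
    · subst hBx
      refine ⟨fun _ => x, (blockClosure_subset hB ?_).antisymm ?_⟩
      · rintro _ (rfl | ⟨i, rfl⟩) <;> rfl
      · exact Set.singleton_subset_iff.2 (subset_blockClosure _ (Set.mem_insert _ _))
    have hx_lt : ({x} : Set X) ⊂ B :=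
      (Set.singleton_subset_iff.2 hx).ssubset_of_ne (Ne.symm hBx)
    obtain ⟨C, hCmax⟩ := Set.Finite.exists_maximal
      (Set.toFinite {C : Set X | IsBlock N C ∧ x ∈ C ∧ C ⊂ B})
      ⟨{x}, IsBlock.singleton, rfl, hx_lt⟩
    obtain ⟨hC, hxC, hCB⟩ := hCmax.prop
    have hdouble := two_mul_ncard_le_of_isBlock_ssubset hB hC hxC hCB
    obtain ⟨f, hf⟩ := ih C hC hxC (by rw [pow_succ] at hcard; omega)
    obtain ⟨y, hyB, hyC⟩ := Set.exists_of_ssubset hCB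
    have hfC : insert x (Set.range f) ⊆ C := hf ▸ subset_blockClosure _
    refine ⟨Fin.cons y f, ?_⟩
    set D := blockClosure N (insert x (Set.range (Fin.cons y f : Fin (k + 1) → X)))
    have hyD : y ∈ D := subset_blockClosure _ (Or.inr ⟨0, rfl⟩)
    have hxD : x ∈ D := subset_blockClosure _ (Or.inl rfl)
    have hDB : D ⊆ B := by
      refine blockClosure_subset hB ?_
      rw [Fin.range_cons]
      rintro z (rfl | rfl | hz)
      · exact hx
      · exact hyB
      · exact hCB.1 (hfC (Or.inr hz))
    have hCD : C ⊆ D := by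
      rw [← hf]
      refine blockClosure_subset (isBlock_blockClosure _) ?_
      refine Set.Subset.trans ?_ (subset_blockClosure _)
      rw [Fin.range_cons]
      exact Set.insert_subset_insert (Set.subset_insert _ _)
    by_contra hne
    exact hyC (hCmax.le_of_ge ⟨isBlock_blockClosure _, hxD, hDB.ssubset_of_ne hne⟩ hCD hyD)

theorem ncard_isBlock_mem_le [Finite X] [IsPretransitive N X] (x : X) :
    {B : Set X | IsBlock N B ∧ x ∈ B}.ncard ≤ Nat.card X ^ Nat.log 2 (Nat.card X) := by
  set k := Nat.log 2 (Nat.card X)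
  have hsub : {B : Set X | IsBlock N B ∧ x ∈ B} ⊆
      (fun f : Fin k → X => blockClosure N (insert x (Set.range f))) '' Set.univ := by
    rintro B ⟨hB, hx⟩
    obtain ⟨f, hf⟩ := exists_blockClosure_insert_range_eq x k B hB hx
      ((Set.ncard_le_card B).trans_lt (Nat.lt_pow_succ_log_self one_lt_two _))
    exact ⟨f, trivial, hf⟩
  calc _ ≤ _ := Set.ncard_le_ncard hsub
    _ ≤ _ := Set.ncard_image_le
    _ = _ := by simp [Set.ncard_univ, Nat.card_fun]

/-- The subgroup generated by the squares in a group acting primitively on more than two points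
is transitive. -/
theorem isPretransitive_closure_squares {G : Type*} [Group G] [MulAction G X] [IsPreprimitive G X]
    (hX : 2 < Nat.card X) :
    IsPretransitive (Subgroup.closure {g : G | ∃ h : G, g = h ^ 2}) X := by
  have : (Subgroup.closure {g : G | ∃ h : G, g = h ^ 2}).Normal := by
    refine ⟨fun n hn g => ?_⟩
    induction hn using Subgroup.closure_induction with
    | mem n hn =>
      obtain ⟨h, rfl⟩ := hn
      exact Subgroup.subset_closure ⟨g * h * g⁻¹, (conj_pow ..).symm⟩
    | one => simp
    | mul a b _ _ ha hb =>
      rw [← conj_mul]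
      exact mul_mem ha hb
    | inv a _ ha =>
      rw [← conj_inv]
      exact inv_mem ha
  refine IsQuasiPreprimitive.isPretransitive_of_normal fun hfix => ?_
  have hsq : ∀ (h : G) (x : X), h • h • x = x := by
    intro h x
    have hx : x ∈ fixedPoints (Subgroup.closure {g : G | ∃ h : G, g = h ^ 2}) X := by
      rw [hfix]; trivial
    have := hx ⟨h ^ 2, Subgroup.subset_closure ⟨h, rfl⟩⟩
    rwa [Subgroup.mk_smul, pow_two, mul_smul] at this
  have hcomm : ∀ (g h : G) (x : X), g • h • x = h • g • x := by
    intro g h x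
    have h1 := hsq (g * h) (h • g • x)
    simp only [mul_smul, hsq] at h1
    exact h1
  have htriv : ∀ (g : G) (x : X), g • x = x := by
    intro g x
    have hblock : IsBlock G ({x, g • x} : Set X) := by
      rw [isBlock_iff_smul_eq_of_mem]
      intro h a ha hha
      have himage : h • ({x, g • x} : Set X) = {h • x, g • h • x} := by
        rw [Set.smul_set_insert, Set.smul_set_singleton, hcomm h g]
      rw [himage]
      have hhx : h • x = x ∨ h • x = g • x := by
        rcases ha with rfl | rfl
        · exact hha
        · rcases hha with hha | hha
          · right
            rw [← hsq h (g • x), hha]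
          · left
            rw [hcomm h g] at hha
            exact smul_left_cancel g hha
      rcases hhx with hhx | hhx
      · rw [hhx]
      · rw [hhx, hsq, Set.pair_comm]
    rcases hblock.subsingleton_or_eq_univ with hs | hu
    · exact hs (by simp) (by simp)
    · have hle : ({x, g • x} : Set X).ncard ≤ 2 := (Set.ncard_insert_le _ _).trans (by simp)
      rw [hu, Set.ncard_univ] at hle
      omega
  have hsub : Subsingleton X := ⟨fun a b => by
    obtain ⟨g, rfl⟩ := exists_smul_eq G a b
    exact (htriv g a).symm⟩
  have := Finite.card_le_one_iff_subsingleton.2 hsub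
  omega

end Blocks

section Grids

open MulAction

variable {X : Type*}

theorem mem_wreathCopy_iff_preserves_coordinates {m k : ℕ} {M : Subgroup (Equiv.Perm X)}
    {e : X ≃ (Fin k → Fin m)}
    (he : (M : Set (Equiv.Perm X)) =
      {p | ∃ w ∈ wreathProductAction m k, p = (e.trans w).trans e.symm}) (p : Equiv.Perm X) :
    p ∈ M ↔ ∃ τ : Equiv.Perm (Fin k), ∀ a b i, e a i = e b i ↔ e (p a) (τ i) = e (p b) (τ i) := by
  rw [← SetLike.mem_coe, he]
  constructor
  · rintro ⟨w, ⟨π, τ, hw⟩, rfl⟩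
    exact ⟨τ, fun a b i => by simp [hw]⟩
  · rintro ⟨τ, hτ⟩
    let f : Fin k → Fin m → Fin m := fun i u => e (p (e.symm fun _ => u)) i
    have hinj : ∀ i, Function.Injective (f i) := by
      intro i u v huv
      have := (hτ (e.symm fun _ => u) (e.symm fun _ => v) (τ⁻¹ i)).2 (by simpa using huv)
      simpa using this
    refine ⟨(e.symm.trans p).trans e, ⟨fun i => Equiv.ofBijective (f i)
      (Finite.injective_iff_bijective.1 (hinj i)), τ, fun x i => ?_⟩, ?_⟩
    · have := (hτ (e.symm x) (e.symm fun _ => x (τ⁻¹ i)) (τ⁻¹ i)).1 (by simp)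
      simpa [f] using this
    · ext a
      simp

theorem perm_fin_two_apply_apply (τ : Equiv.Perm (Fin 2)) (i : Fin 2) : τ (τ i) = i := by
  revert τ i
  decide

theorem coordinate_eq_iff_of_mem_closure_squares {m : ℕ} {G M : Subgroup (Equiv.Perm X)}
    {e : X ≃ (Fin 2 → Fin m)}
    (he : (M : Set (Equiv.Perm X)) =
      {p | ∃ w ∈ wreathProductAction m 2, p = (e.trans w).trans e.symm}) (hGM : G ≤ M)
    (g : Subgroup.closure {g : G | ∃ h : G, g = h ^ 2}) (a b : X) (i : Fin 2) :
    e (g • a) i = e (g • b) i ↔ e a i = e b i := by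
  obtain ⟨g, hg⟩ := g
  simp only [Subgroup.mk_smul]
  induction hg using Subgroup.closure_induction generalizing a b with
  | mem g hg =>
    obtain ⟨h, rfl⟩ := hg
    obtain ⟨τ, hτ⟩ := (mem_wreathCopy_iff_preserves_coordinates he _).1 (hGM h.2)
    have h2 := (hτ a b i).trans (hτ (h.1 a) (h.1 b) (τ i))
    rw [perm_fin_two_apply_apply] at h2
    rw [pow_two, mul_smul, mul_smul]
    exact h2.symm
  | one => simp
  | mul g h _ _ hg hh => rw [mul_smul, mul_smul, hg, hh]
  | inv g _ hg => rw [← hg, smul_inv_smul, smul_inv_smul]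

theorem ncard_wreathCopy_two_overgroups_le [Finite X] {m : ℕ} (hX : 2 < Nat.card X)
    (G : Subgroup (Equiv.Perm X)) [IsPreprimitive G X] :
    {M : Subgroup (Equiv.Perm X) | IsWreathCopy m 2 M ∧ G ≤ M}.ncard ≤
      (Nat.card X ^ Nat.log 2 (Nat.card X)) ^ 2 := by
  let N : Subgroup G := Subgroup.closure {g : G | ∃ h : G, g = h ^ 2}
  have : IsPretransitive N X := isPretransitive_closure_squares hX
  obtain ⟨x⟩ := (Nat.card_pos_iff.1 (show 0 < Nat.card X by omega)).1
  let S := {M : Subgroup (Equiv.Perm X) | IsWreathCopy m 2 M ∧ G ≤ M}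
  have hS : ∀ M ∈ S, ∃ e : X ≃ (Fin 2 → Fin m), (M : Set (Equiv.Perm X)) =
      {p | ∃ w ∈ wreathProductAction m 2, p = (e.trans w).trans e.symm} := fun M hM => hM.1
  rcases S.eq_empty_or_nonempty with hempty | ⟨M₀, hM₀⟩
  · change S.ncard ≤ _
    simp [hempty]
  have : Nonempty (X ≃ (Fin 2 → Fin m)) := (hS M₀ hM₀).nonempty
  choose! e he using hS
  let line : Subgroup (Equiv.Perm X) → Fin 2 → Set X := fun M i => {a | e M a i = e M x i}
  have hline : ∀ M ∈ S, ∀ i, IsBlock N (line M i) ∧ x ∈ line M i := by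
    intro M hM i
    refine ⟨isBlock_iff_smul_eq_of_mem.2 fun g a ha hga => ?_, rfl⟩
    have hinv := coordinate_eq_iff_of_mem_closure_squares (he M hM) hM.2
    ext b
    rw [Set.mem_smul_set_iff_inv_smul_mem]
    change e M (g⁻¹ • b) i = e M x i ↔ e M b i = e M x i
    rw [← show e M a i = e M x i from ha, ← hinv g, smul_inv_smul,
      show e M (g • a) i = e M x i from hga, show e M a i = e M x i from ha]
  have hrel : ∀ M ∈ S, ∀ i (g : N) (a b : X), g • a = x →
      (e M a i = e M b i ↔ g • b ∈ line M i) := by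
    intro M hM i g a b hga
    rw [← coordinate_eq_iff_of_mem_closure_squares (he M hM) hM.2 g, hga]
    exact eq_comm
  have hcard := Set.ncard_le_ncard_of_injOn (s := S)
    (t := {B : Set X | IsBlock N B ∧ x ∈ B} ×ˢ {B : Set X | IsBlock N B ∧ x ∈ B})
    (fun M => (line M 0, line M 1)) (fun M hM => ⟨hline M hM 0, hline M hM 1⟩) ?_
  · rw [Set.ncard_prod] at hcard
    refine hcard.trans ?_
    rw [pow_two]
    exact Nat.mul_le_mul (ncard_isBlock_mem_le x) (ncard_isBlock_mem_le x)
  · intro M hM M' hM' heq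
    obtain ⟨h0, h1⟩ := Prod.mk.inj heq
    have hlines : ∀ i, line M i = line M' i := Fin.forall_fin_two.2 ⟨h0, h1⟩
    have hsame : ∀ a b i, e M a i = e M b i ↔ e M' a i = e M' b i := by
      intro a b i
      obtain ⟨g, hg⟩ := exists_smul_eq N a x
      rw [hrel M hM i g a b hg, hrel M' hM' i g a b hg, hlines]
    ext p
    rw [mem_wreathCopy_iff_preserves_coordinates (he M hM), mem_wreathCopy_iff_preserves_coordinates (he M' hM')]
    simp only [hsame]

end Grids

theorem few_overgroups_Sm_wr_S2 :
    ∃ c : ℝ, 0 < c ∧ ∀ (m : ℕ), 2 ≤ m → ∀ (X : Type) [Fintype X],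
      Fintype.card X = m ^ 2 →
      ∀ G : Subgroup (Equiv.Perm X), IsPrimitiveSubgroup G →
        (Set.ncard {M : Subgroup (Equiv.Perm X) | IsWreathCopy m 2 M ∧ G ≤ M} : ℝ) ≤
          (Fintype.card X : ℝ) ^ (c * Real.log (Fintype.card X)) := by
  have hlog2 : 0 < Real.log 2 := Real.log_pos one_lt_two
  refine ⟨2 / Real.log 2, by positivity, fun m hm X _ hX G hG => ?_⟩
  have : MulAction.IsPreprimitive G X :=
    { toIsPretransitive := hG.1, isTrivialBlock_of_isBlock := fun {B} hB => hG.2 B hB }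
  have hcard : 4 ≤ Fintype.card X := by
    rw [hX]
    nlinarith
  have hcount := ncard_wreathCopy_two_overgroups_le (m := m)
    (by rw [Nat.card_eq_fintype_card]; omega) G
  rw [Nat.card_eq_fintype_card, ← pow_mul] at hcount
  generalize Fintype.card X = n at hcard hcount ⊢
  have hn : (1 : ℝ) ≤ n := by exact_mod_cast (show 1 ≤ n by omega)
  calc _ ≤ ((n ^ (Nat.log 2 n * 2) : ℕ) : ℝ) := by exact_mod_cast hcount
    _ = (n : ℝ) ^ ((Nat.log 2 n * 2 : ℕ) : ℝ) := by rw [Real.rpow_natCast, Nat.cast_pow]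
    _ ≤ _ := by
      refine Real.rpow_le_rpow_of_exponent_le hn ?_
      have hlog := Real.natLog_le_logb n 2
      rw [Real.logb, Nat.cast_ofNat] at hlog
      calc ((Nat.log 2 n * 2 : ℕ) : ℝ) = Nat.log 2 n * 2 := by push_cast; rfl
        _ ≤ Real.log n / Real.log 2 * 2 := by gcongr
        _ = _ := by ring
end

section
/- For every k ≥ 2 there is a constant c_k > 0 such that the following holds. Let m > 2 and let X be a finite set with n := |X| = m^k. If G ≤ Sym(X) is primitive, then the number of subgroups M ≤ Sym(X) such that M is a copy of S_m ≀ S_k in product action and G ≤ M is at most n^(c_k·log n). (log denotes the natural logarithm.) -/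
section HammingLine

variable {ι α : Type*}

/-- Two points are collinear if they differ in at most one coordinate. -/
def HammingCollinear (p q : ι → α) : Prop := ∃ i, ∀ j, j ≠ i → p j = q j

theorem apply_eq_of_update_invariant [Finite ι] [DecidableEq ι] {β : Type*} (P : ι → Prop)
    (f : (ι → α) → β) (hf : ∀ p j c, P j → f (Function.update p j c) = f p)
    {p q : ι → α} (h : ∀ j, ¬ P j → p j = q j) : f p = f q := by
  classical
  cases nonempty_fintype ι
  have key : ∀ s : Finset ι, f (s.piecewise q p) = f p := by
    intro s
    induction s using Finset.induction with
    | empty => simp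
    | insert j s hj ih =>
      rw [Finset.piecewise_insert]
      by_cases hP : P j
      · rw [hf _ _ _ hP, ih]
      · rw [← h j hP, ← ih, Function.update_eq_self_iff.2]
        simp [hj]
  simpa using (key Finset.univ).symm

theorem exists_perm_of_collinear_iff [Finite ι] [DecidableEq ι] [Finite α] [Nontrivial α]
    (σ : Equiv.Perm (ι → α)) (hσ : ∀ p q, HammingCollinear (σ p) (σ q) ↔ HammingCollinear p q) :
    ∃ (π : ι → Equiv.Perm α) (τ : Equiv.Perm ι), ∀ p i, σ p i = π i (p (τ⁻¹ i)) := by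
  classical
  have hupd : ∀ (p : ι → α) i c d,
      HammingCollinear (Function.update p i c) (Function.update p i d) :=
    fun p i c d => ⟨i, fun j hj => by simp [hj]⟩
  have hupd' : ∀ (p : ι → α) i c, HammingCollinear p (Function.update p i c) :=
    fun p i c => ⟨i, fun j hj => by simp [hj]⟩
  -- every line is mapped into a line
  have hdir : ∀ p i, ∃ a, ∀ c j, j ≠ a → σ (Function.update p i c) j = σ p j := by
    intro p i
    obtain ⟨c₀, hc₀⟩ := exists_ne (p i)
    obtain ⟨a, ha⟩ := (hσ _ _).2 (hupd' p i c₀)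
    refine ⟨a, fun c j hj => ?_⟩
    obtain ⟨a', ha'⟩ := (hσ _ _).2 (hupd' p i c)
    obtain ⟨b, hb⟩ := (hσ _ _).2 (hupd p i c₀ c)
    by_contra hne
    have h1 : σ p a ≠ σ (Function.update p i c₀) a := by
      intro h
      have : σ p = σ (Function.update p i c₀) := by
        ext1 l
        by_cases hl : l = a
        · rw [hl, h]
        · exact ha l hl
      have := congrFun (σ.injective this) i
      simp at this
      exact hc₀ this.symm
    grind
  choose τ hτ using hdir
  have hne : ∀ p i c, c ≠ p i → σ (Function.update p i c) (τ p i) ≠ σ p (τ p i) := by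
    intro p i c hc h
    have : σ (Function.update p i c) = σ p := by
      ext1 l
      by_cases hl : l = τ p i
      · rw [hl, h]
      · exact hτ p i c l hl
    have := congrFun (σ.injective this) i
    simp at this
    exact hc this
  have huniq : ∀ p i c a, c ≠ p i → (∀ j, j ≠ a → σ (Function.update p i c) j = σ p j) →
      a = τ p i := by
    intro p i c a hc h
    by_contra hn
    exact hne p i c hc (h _ (Ne.symm hn))
  have hinj : ∀ p, Function.Injective (τ p) := by
    intro p i j hij
    by_contra hn
    obtain ⟨c, hc⟩ := exists_ne (p i)
    obtain ⟨d, hd⟩ := exists_ne (p j)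
    obtain ⟨a, ha⟩ := (hσ (Function.update p i c) (Function.update p j d)).1
      ⟨τ p i, fun l hl => by rw [hτ p i c l hl, hτ p j d l (hij ▸ hl)]⟩
    have h1 := ha i
    have h2 := ha j
    simp only [Function.update_self, Function.update_of_ne hn,
      Function.update_of_ne (Ne.symm hn)] at h1 h2
    grind
  have hsame : ∀ p i c, τ (Function.update p i c) i = τ p i := by
    intro p i c
    by_cases hc : c = p i
    · rw [hc, Function.update_eq_self]
    · refine huniq p i c _ hc fun j hj => ?_
      have := hτ (Function.update p i c) i (p i) j hj
      rw [Function.update_idem, Function.update_eq_self] at this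
      exact this.symm
  -- the induced map on directions does not change along an edge
  have hconst : ∀ p j c, True → τ (Function.update p j c) = τ p := by
    intro p j d _
    ext1 i
    by_cases hij : i = j
    · rw [hij, hsame]
    by_cases hd : d = p j
    · rw [hd, Function.update_eq_self]
    obtain ⟨c, hc⟩ := exists_ne (p i)
    have hcomm : Function.update (Function.update p i c) j d =
      Function.update (Function.update p j d) i c := Function.update_comm hij _ _ _
    have e1 := hτ p i c
    have e2 := hτ p j d
    have e3 := hτ (Function.update p i c) j d
    have e4 := hτ (Function.update p j d) i c
    have n1 := hne p i c hc
    have n2 := hne p j d hd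
    have n3 := hne (Function.update p i c) j d (by simpa [Ne.symm hij] using hd)
    have n4 := hne (Function.update p j d) i c (by simpa [hij] using hc)
    rw [← hcomm] at e4 n4
    have i1 := hinj p
    have i2 := hinj (Function.update p i c)
    have i3 := hinj (Function.update p j d)
    have s1 := hsame p i c
    have s2 := hsame p j d
    have m1 : τ p i ≠ τ p j := fun h => hij (i1 h)
    have m2 : τ (Function.update p i c) i ≠ τ (Function.update p i c) j := fun h => hij (i2 h)
    have m3 : τ (Function.update p j d) i ≠ τ (Function.update p j d) j := fun h => hij (i3 h)
    rw [s1] at m2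
    rw [s2] at m3
    by_contra hn
    have a1 := e1 (τ (Function.update p j d) i)
    have a2 := e2 (τ p i) m1
    have a3 := e3 (τ p i) m2
    have a4 := e4 (τ p i) (Ne.symm hn)
    exact n1 (by rw [← a3, a4, a2])
  obtain ⟨p₀⟩ : Nonempty (ι → α) := inferInstance
  have hτ₀ : ∀ p, τ p = τ p₀ := fun p =>
    apply_eq_of_update_invariant (fun _ => True) τ hconst (by simp)
  set t : Equiv.Perm ι := Equiv.ofBijective (τ p₀) (Finite.injective_iff_bijective.1 (hinj p₀))
  have htd : ∀ p i, τ p i = t i := fun p i => by rw [hτ₀]; rfl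
  have hdep : ∀ i p q, p i = q i → σ p (t i) = σ q (t i) := by
    intro i p q h
    refine apply_eq_of_update_invariant (fun j => j ≠ i) (fun p => σ p (t i)) ?_ (by simpa using h)
    intro p j c hj
    exact hτ p j c _ (by rw [htd]; exact fun h => hj (t.injective h).symm)
  let F : ι → α → α := fun i c => σ (Function.update p₀ i c) (t i)
  have hF : ∀ i, Function.Injective (F i) := by
    intro i c d hcd
    by_contra hn
    refine hne (Function.update p₀ i c) i d (by simpa using Ne.symm hn) ?_
    rw [Function.update_idem, htd]
    exact hcd.symm
  refine ⟨fun i => Equiv.ofBijective (F (t⁻¹ i)) (Finite.injective_iff_bijective.1 (hF _)), t,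
    fun p i => ?_⟩
  have := hdep (t⁻¹ i) p (Function.update p₀ (t⁻¹ i) (p (t⁻¹ i))) (by simp)
  simpa [F] using this

theorem collinear_iff_of_perm (σ : (ι → α) → (ι → α)) (π : ι → Equiv.Perm α) (τ : Equiv.Perm ι)
    (h : ∀ p i, σ p i = π i (p (τ⁻¹ i))) (p q : ι → α) :
    HammingCollinear (σ p) (σ q) ↔ HammingCollinear p q := by
  constructor
  · rintro ⟨i, hi⟩
    refine ⟨τ⁻¹ i, fun j hj => ?_⟩
    have := hi (τ j) (by rintro rfl; simp at hj)
    simpa [h] using this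
  · rintro ⟨i, hi⟩
    refine ⟨τ i, fun j hj => ?_⟩
    rw [h, h, hi]
    rintro rfl
    simp at hj

end HammingLine

section Generation

theorem exists_sup_closure_range_eq {Γ : Type*} [Group Γ] [Finite Γ] (S : Subgroup Γ) (r : ℕ)
    (P : Subgroup Γ) (hPS : P ≤ S) (h : Nat.card S < 2 ^ r * Nat.card P) :
    ∃ f : Fin r → Γ, P ⊔ Subgroup.closure (Set.range f) = S := by
  induction r generalizing P with
  | zero =>
    have := Subgroup.card_le_of_le hPS
    omega
  | succ r ih =>
    by_cases hSP : S ≤ P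
    · exact ⟨fun _ => 1, le_antisymm (sup_le hPS ((Subgroup.closure_le _).2 (by
        rintro _ ⟨_, rfl⟩; exact S.one_mem))) (hSP.trans le_sup_left)⟩
    obtain ⟨s, hs, hsP⟩ := SetLike.not_le_iff_exists.1 hSP
    set Q : Subgroup Γ := P ⊔ Subgroup.zpowers s with hQ
    have hPQ : P < Q := lt_of_le_not_ge le_sup_left fun hle =>
      hsP (hle ((le_sup_right : Subgroup.zpowers s ≤ Q) (Subgroup.mem_zpowers s)))
    have hcard : 2 * Nat.card P ≤ Nat.card Q := by
      obtain ⟨d, hd⟩ := Subgroup.card_dvd_of_le hPQ.le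
      have hP := Nat.card_pos (α := P)
      have hQ' := Nat.card_pos (α := Q)
      have h1 : d ≠ 1 := by
        rintro rfl
        exact hPQ.ne (Subgroup.eq_of_le_of_card_ge hPQ.le (by omega))
      have h0 : d ≠ 0 := by
        rintro rfl
        omega
      rw [hd, mul_comm]
      exact Nat.mul_le_mul_left _ (by omega)
    obtain ⟨f, hf⟩ := ih Q (sup_le hPS (by simpa using hs)) (by
      rw [pow_succ, mul_assoc] at h
      exact h.trans_le (Nat.mul_le_mul_left _ hcard))
    refine ⟨Fin.cons s f, ?_⟩
    rw [← hf, Fin.range_cons, ← Set.singleton_union, Subgroup.closure_union,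
      ← Subgroup.zpowers_eq_closure, hQ, sup_assoc]

/-- An overgroup of a point stabilizer is generated by the elements mapping the point into
a suitable short list of points. -/
theorem exists_closure_smul_mem_range_eq {Γ Y : Type*} [Group Γ] [Finite Γ] [MulAction Γ Y]
    [Finite Y] (p : Y) (S : Subgroup Γ) (hS : MulAction.stabilizer Γ p ≤ S) (r : ℕ)
    (hr : Nat.card Y < 2 ^ r) :
    ∃ q : Fin r → Y, Subgroup.closure {g : Γ | g • p = p ∨ ∃ i, g • p = q i} = S := by
  obtain ⟨f, hf⟩ := exists_sup_closure_range_eq S r (MulAction.stabilizer Γ p) hS (by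
    have h1 : Nat.card (MulAction.orbit Γ p) ≤ Nat.card Y :=
      Nat.card_le_card_of_injective _ Subtype.val_injective
    have h2 := Nat.card_congr (MulAction.orbitProdStabilizerEquivGroup Γ p)
    rw [Nat.card_prod] at h2
    calc Nat.card S ≤ Nat.card Γ := Subgroup.card_le_card_group S
      _ ≤ Nat.card Y * Nat.card (MulAction.stabilizer Γ p) := by
        rw [← h2]; exact Nat.mul_le_mul_right _ h1
      _ < _ := Nat.mul_lt_mul_of_pos_right hr Nat.card_pos)
  refine ⟨fun i => f i • p, le_antisymm ((Subgroup.closure_le _).2 ?_) ?_⟩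
  · have hfS : ∀ i, f i ∈ S := fun i => hf ▸ (le_sup_right : _ ≤ MulAction.stabilizer Γ p ⊔ _)
      (Subgroup.subset_closure ⟨i, rfl⟩)
    rintro g (hg | ⟨i, hg⟩)
    · exact hS hg
    · have : (f i)⁻¹ * g ∈ S := hS (by
        rw [MulAction.mem_stabilizer_iff, mul_smul, hg, inv_smul_smul])
      simpa using S.mul_mem (hfS i) this
  · rw [← hf]
    refine sup_le (fun g hg => Subgroup.subset_closure (Or.inl hg)) ((Subgroup.closure_le _).2 ?_)
    rintro _ ⟨i, rfl⟩
    exact Subgroup.subset_closure (Or.inr ⟨i, rfl⟩)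

end Generation

section ProductAction

variable {ι α X Γ : Type*} [Group Γ] [MulAction Γ X]

/-- Every element of `Γ` acts, in the coordinates `e`, as an element of a wreath product. -/
def ActsInProduct (Γ : Type*) [Group Γ] [MulAction Γ X] (e : X ≃ (ι → α)) : Prop :=
  ∀ g : Γ, ∃ (π : ι → Equiv.Perm α) (τ : Equiv.Perm ι), ∀ u i, e (g • u) i = π i (e u (τ⁻¹ i))

/-- The subgroup of the elements fixing every coordinate direction. -/
def directionKernel (Γ : Type*) [Group Γ] [MulAction Γ X] (e : X ≃ (ι → α)) : Subgroup Γ where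
  carrier := {g | ∃ π : ι → Equiv.Perm α, ∀ u i, e (g • u) i = π i (e u i)}
  one_mem' := ⟨fun _ => 1, by simp⟩
  mul_mem' := by
    rintro g h ⟨π, hπ⟩ ⟨ρ, hρ⟩
    exact ⟨fun i => π i * ρ i, fun u i => by rw [mul_smul, hπ, hρ]; rfl⟩
  inv_mem' := by
    rintro g ⟨π, hπ⟩
    refine ⟨fun i => (π i)⁻¹, fun u i => ?_⟩
    rw [Equiv.Perm.eq_inv_iff_eq, ← hπ, smul_inv_smul]

theorem ActsInProduct.directionKernel_normal {e : X ≃ (ι → α)} (h : ActsInProduct Γ e) :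
    (directionKernel Γ e).Normal := by
  refine ⟨?_⟩
  rintro n ⟨ρ, hρ⟩ g
  obtain ⟨π, τ, hπ⟩ := h g
  refine ⟨fun i => π i * ρ (τ⁻¹ i) * (π i)⁻¹, fun u i => ?_⟩
  have := hπ (g⁻¹ • u) i
  rw [smul_inv_smul] at this
  rw [mul_smul, mul_smul, hπ, hρ, Equiv.Perm.mul_apply, Equiv.Perm.mul_apply, this,
    ← Equiv.Perm.mul_apply (π i)⁻¹, inv_mul_cancel, Equiv.Perm.one_apply]

open MulAction Pointwise in
/-- A primitive group of order larger than `k!` preserving a product structure with `k` factors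
contains transitively many elements fixing all directions. -/
theorem ActsInProduct.directionKernel_pretransitive [Finite ι] [Finite Γ] [FaithfulSMul Γ X]
    [IsPreprimitive Γ X] {e : X ≃ (ι → α)} (h : ActsInProduct Γ e)
    (hcard : Nat.card (Equiv.Perm ι) < Nat.card Γ) :
    IsPretransitive (directionKernel Γ e) X := by
  have := h.directionKernel_normal
  apply IsQuasiPreprimitive.isPretransitive_of_normal (G := Γ)
  intro hfix
  choose π τ hπ using h
  refine hcard.not_ge (Nat.card_le_card_of_injective τ fun g g' hgg => ?_)
  have hmem : g * g'⁻¹ ∈ directionKernel Γ e := by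
    refine ⟨fun i => π g i * (π g' i)⁻¹, fun u i => ?_⟩
    have := hπ g' (g'⁻¹ • u) i
    rw [smul_inv_smul] at this
    rw [mul_smul, hπ, Equiv.Perm.mul_apply, this,
      ← Equiv.Perm.mul_apply (π g' i)⁻¹, inv_mul_cancel, Equiv.Perm.one_apply, hgg]
  have hone : g * g'⁻¹ = 1 := FaithfulSMul.eq_of_smul_eq_smul (α := X) fun x => by
    have hx : x ∈ fixedPoints (directionKernel Γ e) X := hfix ▸ Set.mem_univ x
    rw [one_smul]
    exact hx ⟨_, hmem⟩
  exact mul_inv_eq_one.1 hone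

open MulAction Pointwise in
theorem ActsInProduct.exists_direction_eq [Nontrivial α]
    [IsPreprimitive Γ X] {e : X ≃ (ι → α)} (h : ActsInProduct Γ e) (i₀ j₀ : ι) :
    ∃ (g : Γ) (π : ι → Equiv.Perm α) (τ : Equiv.Perm ι),
      (∀ u i, e (g • u) i = π i (e u (τ⁻¹ i))) ∧ τ i₀ = j₀ := by
  classical
  let O : Set ι := {j | ∃ (g : Γ) (π : ι → Equiv.Perm α) (τ : Equiv.Perm ι),
      (∀ u i, e (g • u) i = π i (e u (τ⁻¹ i))) ∧ τ i₀ = j}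
  have hi₀ : i₀ ∈ O := ⟨1, fun _ => 1, 1, by simp, rfl⟩
  have hOinv : ∀ (g : Γ) (π : ι → Equiv.Perm α) (τ : Equiv.Perm ι),
      (∀ u i, e (g • u) i = π i (e u (τ⁻¹ i))) → ∀ j, j ∈ O → τ⁻¹ j ∈ O := by
    rintro g π τ hg _ ⟨g', π', τ', hg', rfl⟩
    refine ⟨g⁻¹ * g', fun i => (π (τ i))⁻¹ * π' (τ i), τ⁻¹ * τ', fun u i => ?_, rfl⟩
    have := hg (g⁻¹ • g' • u) (τ i)
    rw [smul_inv_smul, ← Equiv.Perm.mul_apply, inv_mul_cancel, Equiv.Perm.one_apply, hg'] at this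
    rw [mul_smul, Equiv.Perm.mul_apply, Equiv.Perm.eq_inv_iff_eq.2 this.symm]
    simp
  by_contra hj₀
  change j₀ ∉ O at hj₀
  obtain ⟨a, b, hab⟩ := exists_pair_ne α
  set x : X := e.symm fun _ => a with hx
  have hex : ∀ i, e x i = a := by simp [hx]
  set B : Set X := {u | ∀ i ∈ O, e u i = a}
  have hblock : IsBlock Γ B := by
    have hsub : ∀ (g : Γ) (v : X), v ∈ B → g • v ∈ B → ∀ u ∈ B, g • u ∈ B := by
      intro g v hv hgv u hu i hi
      obtain ⟨π, τ, hg⟩ := h g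
      have hi' := hOinv g π τ hg i hi
      have := hgv i hi
      rw [hg, hv _ hi'] at this
      rw [hg, hu _ hi', this]
    rw [isBlock_iff_smul_eq_of_mem]
    intro g v hv hgv
    ext u
    rw [Set.mem_smul_set_iff_inv_smul_mem]
    refine ⟨fun hu => ?_, hsub g⁻¹ (g • v) hgv (by rwa [inv_smul_smul]) u⟩
    simpa using hsub g v hv hgv _ hu
  rcases hblock.subsingleton_or_eq_univ with hs | hu
  · have h1 : x ∈ B := fun i _ => hex i
    have h2 : e.symm (Function.update (fun _ => a) j₀ b) ∈ B := fun i hi => by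
      rw [Equiv.apply_symm_apply, Function.update_of_ne (by rintro rfl; exact hj₀ hi)]
    have := congrArg (fun u => e u j₀) (hs h1 h2)
    simp [hex] at this
    exact hab this
  · have : e.symm (fun _ => b) ∈ B := hu ▸ Set.mem_univ _
    have := this i₀ hi₀
    simp at this
    exact hab this.symm

open MulAction Pointwise in
/-- Collinearity can be recovered from the stabilizer of a line through `x`. -/
theorem ActsInProduct.exists_subgroup_collinear_iff [Finite ι] [Nonempty ι] [Nontrivial α]
    [Finite Γ] [FaithfulSMul Γ X] [IsPreprimitive Γ X] {e : X ≃ (ι → α)}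
    (h : ActsInProduct Γ e) (hcard : Nat.card (Equiv.Perm ι) < Nat.card Γ) (x : X) :
    ∃ (y : X) (S : Subgroup Γ), stabilizer Γ (x, y) ≤ S ∧
      ∀ u v, (∃ g : Γ, g • x = u ∧ ∃ s ∈ S, g • s • x = v) ↔ HammingCollinear (e u) (e v) := by
  classical
  have htrans := h.directionKernel_pretransitive hcard
  obtain ⟨i₀⟩ := ‹Nonempty ι›
  obtain ⟨c, hc⟩ := exists_ne (e x i₀)
  set y : X := e.symm (Function.update (e x) i₀ c) with hy
  have hey : e y = Function.update (e x) i₀ c := by simp [hy]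
  -- the line through `x` in direction `i₀`
  set L : Set X := {u | ∀ j, j ≠ i₀ → e u j = e x j}
  have hxL : x ∈ L := fun _ _ => rfl
  have hcol : ∀ (g : Γ) u v, HammingCollinear (e (g • u)) (e (g • v)) ↔
      HammingCollinear (e u) (e v) := fun g u v => by
    obtain ⟨π, τ, hg⟩ := h g
    simpa using collinear_iff_of_perm (fun p => e (g • e.symm p)) π τ
      (fun p i => by simp [hg]) (e u) (e v)
  refine ⟨y, stabilizer Γ L, fun g hg => ?_, fun u v => ⟨?_, ?_⟩⟩
  · obtain ⟨hgx, hgy⟩ := Prod.mk.inj (mem_stabilizer_iff.1 hg)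
    have hgx : g • x = x := hgx
    have hgy : g • y = y := hgy
    obtain ⟨π, τ, hπ⟩ := h g
    have hτ : τ⁻¹ i₀ = i₀ := by
      by_contra hne
      have h1 := hπ x i₀
      have h2 := hπ y i₀
      rw [hgx] at h1
      rw [hgy, hey, Function.update_self, Function.update_of_ne hne, ← h1] at h2
      exact hc h2
    rw [mem_stabilizer_iff]
    ext u
    rw [Set.mem_smul_set_iff_inv_smul_mem]
    have hu := fun j => hπ (g⁻¹ • u) j
    have hx := fun j => hπ x j
    rw [smul_inv_smul] at hu
    rw [hgx] at hx
    constructor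
    · intro hmem j hj
      rw [hu, hx, hmem]
      rintro h'
      exact hj (τ⁻¹.injective (h'.trans hτ.symm))
    · intro hmem j hj
      have h1 := hmem (τ j) (by
        rintro h'
        apply hj
        rw [← hτ, ← h']
        simp)
      rw [hu, hx] at h1
      simpa using h1
  · rintro ⟨g, rfl, s, hs, rfl⟩
    rw [hcol]
    have : s • x ∈ L := by
      rw [← mem_stabilizer_iff.1 hs]
      exact Set.smul_mem_smul_set hxL
    exact ⟨i₀, fun j hj => (this j hj).symm⟩
  · rintro ⟨j₀, hj₀⟩
    obtain ⟨g, π, τ, hg, hτ⟩ := h.exists_direction_eq i₀ j₀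
    obtain ⟨⟨n, ρ, hρ⟩, hn⟩ := exists_smul_eq (directionKernel Γ e) (g • x) u
    have hn : n • g • x = u := hn
    refine ⟨n * g, by rw [mul_smul, hn], ?_⟩
    have hw : (n * g)⁻¹ • v ∈ L := by
      intro j hj
      have hj' : τ j ≠ j₀ := fun h' => hj (τ.injective (h'.trans hτ.symm))
      have key : ∀ w, e ((n * g) • w) (τ j) = ρ (τ j) (π (τ j) (e w j)) := fun w => by
        rw [mul_smul, hρ, hg, ← Equiv.Perm.mul_apply τ⁻¹, inv_mul_cancel, Equiv.Perm.one_apply]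
      have h1 := key ((n * g)⁻¹ • v)
      rw [smul_inv_smul, ← hj₀ _ hj', ← hn, ← mul_smul, key] at h1
      simpa using h1.symm
    obtain ⟨⟨s, ρ', hρ'⟩, hs⟩ := exists_smul_eq (directionKernel Γ e) x ((n * g)⁻¹ • v)
    have hs : s • x = (n * g)⁻¹ • v := hs
    refine ⟨s, ?_, by rw [hs, smul_inv_smul]⟩
    rw [mem_stabilizer_iff]
    ext w
    rw [Set.mem_smul_set_iff_inv_smul_mem]
    refine forall₂_congr fun j hj => ?_
    have h1 := hρ' (s⁻¹ • w) j
    have h2 := hρ' x j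
    rw [smul_inv_smul] at h1
    rw [hs, hw j hj] at h2
    rw [h1]
    nth_rewrite 2 [h2]
    simp

end ProductAction

section Counting

/-- The permutations preserving the relation recovered from `y` and the points `q`. -/
def relationAut {X Γ : Type*} [Group Γ] [MulAction Γ X] (x : X) {r : ℕ}
    (d : X × (Fin r → X × X)) : Set (Equiv.Perm X) :=
  let S : Subgroup Γ :=
    Subgroup.closure {g : Γ | g • (x, d.1) = (x, d.1) ∨ ∃ i, g • (x, d.1) = d.2 i}
  let R : X → X → Prop := fun u v => ∃ g : Γ, g • x = u ∧ ∃ s ∈ S, g • s • x = v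
  {σ | ∀ u v, R (σ u) (σ v) ↔ R u v}

theorem IsWreathCopy.exists_coe_eq_relationAut {X : Type*} [Finite X] {m k r : ℕ} (hm : 2 ≤ m)
    (hk : k ≠ 0) {G M : Subgroup (Equiv.Perm X)} [MulAction.IsPreprimitive G X]
    (hM : IsWreathCopy m k M) (hGM : G ≤ M) (hcard : k.factorial < Nat.card G)
    (hr : Nat.card (X × X) < 2 ^ r) (x : X) :
    ∃ d : X × (Fin r → X × X), (M : Set (Equiv.Perm X)) = relationAut (Γ := G) x d := by
  obtain ⟨e, he⟩ := hM
  have : Nontrivial (Fin m) := Fin.nontrivial_iff_two_le.2 hm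
  have : Nonempty (Fin k) := ⟨⟨0, Nat.pos_of_ne_zero hk⟩⟩
  have hG : ActsInProduct G e := by
    intro g
    have hg : (g : Equiv.Perm X) ∈ (M : Set (Equiv.Perm X)) := hGM g.2
    rw [he] at hg
    obtain ⟨w, ⟨π, τ, hw⟩, hgw⟩ := hg
    refine ⟨π, τ, fun u i => ?_⟩
    rw [← hw, Subgroup.smul_def, Equiv.Perm.smul_def, hgw]
    simp
  obtain ⟨y, S, hS, hR⟩ := hG.exists_subgroup_collinear_iff
    (by simpa [Nat.card_eq_fintype_card, Fintype.card_perm] using hcard) x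
  obtain ⟨q, hq⟩ := exists_closure_smul_mem_range_eq (x, y) S hS r hr
  refine ⟨(y, q), ?_⟩
  ext σ
  simp only [relationAut, hq, hR, Set.mem_ofPred_eq]
  rw [he]
  constructor
  · rintro ⟨w, ⟨π, τ, hw⟩, rfl⟩ u v
    simpa using collinear_iff_of_perm w π τ hw (e u) (e v)
  · intro hσ
    obtain ⟨π, τ, hw⟩ := exists_perm_of_collinear_iff ((e.symm.trans σ).trans e)
      (fun p q => by simpa using hσ (e.symm p) (e.symm q))
    exact ⟨_, ⟨π, τ, hw⟩, by ext; simp⟩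

theorem ncard_wreathCopies_le {X : Type*} [Finite X] {m k r : ℕ} (hm : 2 ≤ m)
    (hk : k ≠ 0) {G : Subgroup (Equiv.Perm X)} [MulAction.IsPreprimitive G X]
    (hcard : k.factorial < Nat.card X) (hr : Nat.card X ^ 2 < 2 ^ r) :
    Set.ncard {M : Subgroup (Equiv.Perm X) | IsWreathCopy m k M ∧ G ≤ M} ≤
      Nat.card X ^ (2 * r + 1) := by
  have hX : Nonempty X := (Nat.card_pos_iff.1 (by omega)).1
  obtain ⟨x⟩ := hX
  have hG : Nat.card X ≤ Nat.card G :=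
    Nat.card_le_card_of_surjective (fun g : G => g • x) (MulAction.surjective_smul G x)
  choose d hd using fun M : {M : Subgroup (Equiv.Perm X) | IsWreathCopy m k M ∧ G ≤ M} =>
    M.2.1.exists_coe_eq_relationAut hm hk M.2.2 (hcard.trans_le hG)
      (r := r) (by rwa [Nat.card_prod, ← sq]) x
  have hinj : Function.Injective d := fun M N hMN => by
    apply Subtype.ext
    apply SetLike.coe_injective
    rw [hd M, hd N, hMN]
  calc _ = Nat.card {M : Subgroup (Equiv.Perm X) | IsWreathCopy m k M ∧ G ≤ M} := rfl
    _ ≤ Nat.card (X × (Fin r → X × X)) := Nat.card_le_card_of_injective d hinj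
    _ = _ := by
      rw [Nat.card_prod, Nat.card_fun, Nat.card_prod, Nat.card_fin, ← sq, ← pow_mul, ← pow_succ']

end Counting

theorem few_overgroups_Sm_wr_Sk (k : ℕ) (hk : 2 ≤ k) :
    ∃ c : ℝ, 0 < c ∧ ∀ (m : ℕ), 2 < m → ∀ (X : Type) [Fintype X],
      Fintype.card X = m ^ k →
      ∀ G : Subgroup (Equiv.Perm X), IsPrimitiveSubgroup G →
        (Set.ncard {M : Subgroup (Equiv.Perm X) | IsWreathCopy m k M ∧ G ≤ M} : ℝ) ≤
          (Fintype.card X : ℝ) ^ (c * Real.log (Fintype.card X)) := by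
  set D : ℕ := 2 ^ (k.factorial).factorial with hD
  refine ⟨D + 11, by positivity, fun m hm X _ hX G hG => ?_⟩
  have hprim : MulAction.IsPreprimitive G X :=
    { toIsPretransitive := hG.1, isTrivialBlock_of_isBlock := fun {B} => hG.2 B }
  set n := Fintype.card X with hn
  have hn3 : 3 ≤ n := by
    rw [hX]
    calc 3 ≤ m := hm
      _ ≤ m ^ k := Nat.le_self_pow (by omega) m
  have hn3' : (3 : ℝ) ≤ n := by exact_mod_cast hn3
  have hlog : 1 ≤ Real.log n := by
    rw [Real.le_log_iff_exp_le (by linarith)]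
    linarith [Real.exp_one_lt_d9]
  rcases lt_or_ge k.factorial n with hlt | hge
  · set r := Nat.log 2 (n ^ 2) + 1 with hr
    have hle := ncard_wreathCopies_le (X := X) (m := m) (k := k) (r := r) (G := G) hm.le
      (by omega) (by simpa [Nat.card_eq_fintype_card] using hlt)
      (by simpa [Nat.card_eq_fintype_card] using Nat.lt_pow_succ_log_self one_lt_two (n ^ 2))
    rw [Nat.card_eq_fintype_card, ← hn] at hle
    have hrle : (r : ℝ) ≤ 2 * Real.log n / Real.log 2 + 1 := by
      have := Real.natLog_le_logb (n ^ 2) 2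
      rw [hr]
      push_cast
      rw [Real.logb] at this
      push_cast at this
      rw [Real.log_pow] at this
      push_cast at this
      linarith
    calc _ ≤ ((n ^ (2 * r + 1) : ℕ) : ℝ) := by exact_mod_cast hle
      _ = (n : ℝ) ^ ((2 * r + 1 : ℕ) : ℝ) := by rw [Real.rpow_natCast]; push_cast; rfl
      _ ≤ _ := by
        apply Real.rpow_le_rpow_of_exponent_le (by linarith)
        have h2 : 2 * Real.log n / Real.log 2 ≤ 4 * Real.log n := by
          rw [div_le_iff₀ (Real.log_pos one_lt_two)]
          nlinarith [Real.log_two_gt_d9]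
        have hD0 : (0 : ℝ) ≤ D * Real.log n := by positivity
        push_cast
        nlinarith
  · have hle : Set.ncard {M : Subgroup (Equiv.Perm X) | IsWreathCopy m k M ∧ G ≤ M} ≤ D := by
      calc _ ≤ Nat.card (Subgroup (Equiv.Perm X)) := Set.ncard_le_card _
        _ ≤ Nat.card (Set (Equiv.Perm X)) :=
          Nat.card_le_card_of_injective _ SetLike.coe_injective
        _ = 2 ^ n.factorial := by
          classical
          rw [Nat.card_eq_fintype_card, Fintype.card_set, Fintype.card_perm]
        _ ≤ D := Nat.pow_le_pow_right two_pos (Nat.factorial_le hge)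
    calc _ ≤ (D : ℝ) := by exact_mod_cast hle
      _ ≤ (2 : ℝ) ^ D := by exact_mod_cast Nat.lt_two_pow_self.le
      _ ≤ (n : ℝ) ^ D := by gcongr; linarith
      _ = (n : ℝ) ^ (D : ℝ) := (Real.rpow_natCast _ _).symm
      _ ≤ _ := by
        apply Real.rpow_le_rpow_of_exponent_le (by linarith)
        have hD0 : (0 : ℝ) ≤ D := by positivity
        nlinarith
end

section
/- Let X be a finite set with |X| = n ≥ 2, let H ≤ Sym(X) act transitively on X, and let x ∈ X. Then the number of subgroups K of H with Stab_H(x) ≤ K ≤ H is at most n^(log₂ n), where Stab_H(x) denotes the stabilizer of the point x in H and log₂ is the base-2 logarithm. -/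
/-- If the relative index of `S` in `K` is less than `2 ^ (m + 1)`, then `K` is generated over `S`
by `m` elements, which may be taken from any set of representatives of the left cosets of a
subgroup `S₀` of `S`. -/
theorem Subgroup.exists_eq_sup_closure_range_of_relIndex_lt {G ι : Type*} [Group G]
    {S₀ K : Subgroup G} {r : ι → G} (hr : ∀ g, ∃ i, g⁻¹ * r i ∈ S₀)
    (m : ℕ) (S : Subgroup G) (hS : S₀ ≤ S) (hSK : S ≤ K) (h0 : S.relIndex K ≠ 0)
    (hm : S.relIndex K < 2 ^ (m + 1)) :
    ∃ q : Fin m → ι, K = S ⊔ Subgroup.closure (Set.range (r ∘ q)) := by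
  induction m generalizing S with
  | zero =>
    have hKS : K ≤ S := Subgroup.relIndex_eq_one.mp (by omega)
    exact ⟨Fin.elim0, by simpa [Set.range_eq_empty] using le_antisymm hKS hSK⟩
  | succ m ih =>
    by_cases hKS : K ≤ S
    · obtain ⟨i, hi⟩ := hr 1
      have hiK : r i ∈ K := hSK (hS (by simpa using hi))
      refine ⟨fun _ => i, le_antisymm (hKS.trans le_sup_left) (sup_le hSK ?_)⟩
      rw [Subgroup.closure_le]
      rintro _ ⟨_, rfl⟩
      exact hiK
    obtain ⟨g, hgK, hgS⟩ := SetLike.not_le_iff_exists.mp hKS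
    obtain ⟨i, hi⟩ := hr g
    have hiK : r i ∈ K := (Subgroup.mul_mem_cancel_left K (K.inv_mem hgK)).mp (hSK (hS hi))
    have hiS : r i ∉ S := fun h =>
      hgS (S.inv_mem_iff.mp ((Subgroup.mul_mem_cancel_right S h).mp (hS hi)))
    have hT : S ⊔ Subgroup.zpowers (r i) ≤ K :=
      sup_le hSK (Subgroup.zpowers_le.mpr hiK)
    have hmul := Subgroup.relIndex_mul_relIndex S _ K le_sup_left hT
    have h1 : S.relIndex (S ⊔ Subgroup.zpowers (r i)) ≠ 1 := fun h =>
      hiS (Subgroup.relIndex_eq_one.mp h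
        (Subgroup.mem_sup_right (Subgroup.mem_zpowers (r i))))
    rw [← hmul] at h0 hm
    obtain ⟨h2, h3⟩ := mul_ne_zero_iff.mp h0
    have hlt : (S ⊔ Subgroup.zpowers (r i)).relIndex K < 2 ^ (m + 1) := by
      have : 2 ≤ S.relIndex (S ⊔ Subgroup.zpowers (r i)) := by omega
      rw [pow_succ] at hm
      nlinarith
    obtain ⟨q, hq⟩ := ih _ (hS.trans le_sup_left) hT h3 hlt
    refine ⟨Fin.cons i q, ?_⟩
    rw [Fin.comp_cons, Fin.range_cons, Set.insert_eq, Subgroup.closure_union,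
      ← Subgroup.zpowers_eq_closure, ← sup_assoc]
    exact hq

/-- A subgroup `S` of finite index `n` has at most `n ^ ⌊log₂ n⌋` overgroups. -/
theorem Subgroup.ncard_le_index_pow_log {G : Type*} [Group G] (S : Subgroup G) [S.FiniteIndex] :
    Set.ncard {K : Subgroup G | S ≤ K} ≤ S.index ^ Nat.log 2 S.index := by
  have hsub : {K : Subgroup G | S ≤ K} ⊆ Set.range fun q : Fin (Nat.log 2 S.index) → G ⧸ S =>
      S ⊔ Subgroup.closure (Set.range (Quotient.out ∘ q)) := by
    intro K hK
    have hne : S.relIndex K ≠ 0 := fun h =>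
      Subgroup.FiniteIndex.index_ne_zero (H := S) (Subgroup.index_eq_zero_of_relIndex_eq_zero h)
    have hle : S.relIndex K ≤ S.index :=
      Nat.le_of_dvd (Nat.pos_of_ne_zero Subgroup.FiniteIndex.index_ne_zero)
        (Subgroup.relIndex_dvd_index_of_le hK)
    obtain ⟨q, hq⟩ := Subgroup.exists_eq_sup_closure_range_of_relIndex_lt (S₀ := S) (K := K)
      (r := (Quotient.out : G ⧸ S → G))
      (fun g => ⟨(g : G ⧸ S), QuotientGroup.eq.mp (QuotientGroup.out_eq' _).symm⟩)
      (Nat.log 2 S.index) S le_rfl hK hne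
      (hle.trans_lt (Nat.lt_pow_succ_log_self one_lt_two _))
    exact ⟨q, hq.symm⟩
  calc Set.ncard {K : Subgroup G | S ≤ K} ≤ _ := Set.ncard_le_ncard hsub (Set.finite_range _)
    _ ≤ Nat.card (Fin (Nat.log 2 S.index) → G ⧸ S) := by
      rw [← Set.image_univ, ← Set.ncard_univ]
      exact Set.ncard_image_le Set.finite_univ
    _ = S.index ^ Nat.log 2 S.index := by
      rw [Nat.card_fun, Nat.card_fin, Subgroup.index]

theorem few_subgroups_between_stabilizer_and_group
    (X : Type) [Fintype X] (hX : 2 ≤ Fintype.card X)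
    (H : Subgroup (Equiv.Perm X)) (hH : MulAction.IsPretransitive H X) (x : X) :
    (Set.ncard {K : Subgroup H | MulAction.stabilizer H x ≤ K} : ℝ) ≤
      (Fintype.card X : ℝ) ^ (Real.logb 2 (Fintype.card X)) := by
  have hidx : (MulAction.stabilizer H x).index = Fintype.card X := by
    rw [MulAction.index_stabilizer_of_transitive, Nat.card_eq_fintype_card]
  have hcard := (MulAction.stabilizer H x).ncard_le_index_pow_log
  rw [hidx] at hcard
  calc (Set.ncard {K : Subgroup H | MulAction.stabilizer H x ≤ K} : ℝ)
      ≤ (Fintype.card X : ℝ) ^ Nat.log 2 (Fintype.card X) := by exact_mod_cast hcard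
    _ = (Fintype.card X : ℝ) ^ (Nat.log 2 (Fintype.card X) : ℝ) := (Real.rpow_natCast _ _).symm
    _ ≤ _ := Real.rpow_le_rpow_of_exponent_le (by exact_mod_cast one_le_two.trans hX)
      (by exact_mod_cast Real.natLog_le_logb (Fintype.card X) 2)
end

section
/- There is an absolute constant c > 0 such that the following holds. Let X be a finite set with |X| = n ≥ 2, let G ≤ Sym(X) be primitive, and let M ≤ Sym(X) be a maximal subgroup. Then the number of subgroups M' ≤ Sym(X) that are conjugate to M in Sym(X) and satisfy G ≤ M' is at most (c·|M|)^(c·(log n)²). (log denotes the natural logarithm.) -/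
/-- `M ≤ Sym(X)` is a maximal subgroup if it is neither `Sym(X)` nor `Alt(X)` and it is
maximal under inclusion among subgroups of `Sym(X)` different from `Sym(X)` and `Alt(X)`. -/
def IsMaximalSubgroup {X : Type*} [Fintype X] [DecidableEq X]
    (M : Subgroup (Equiv.Perm X)) : Prop :=
  M ≠ ⊤ ∧ M ≠ alternatingGroup X ∧
    ∀ K : Subgroup (Equiv.Perm X), K ≠ ⊤ → K ≠ alternatingGroup X → M ≤ K → K = M

/-- In a transitive action, the elements moving `x` to `y` make up a fraction `1 / |X|`
of the group. -/
theorem card_filter_smul_eq_mul_card {G X : Type*} [Group G] [Fintype G] [Fintype X]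
    [DecidableEq X] [MulAction G X] [MulAction.IsPretransitive G X] (x y : X) :
    (Finset.univ.filter fun g : G => g • x = y).card * Fintype.card X = Fintype.card G := by
  have h : ∀ z : X, (Finset.univ.filter fun g : G => g • x = z).card =
      (Finset.univ.filter fun g : G => g • x = y).card := by
    intro z
    obtain ⟨k, hk⟩ := MulAction.exists_smul_eq G z y
    refine Finset.card_bij (fun g _ => k * g) ?_ ?_ ?_
    · intro g hg
      simp only [Finset.mem_filter, Finset.mem_univ, true_and] at hg ⊢
      rw [mul_smul, hg, hk]
    · intro a _ b _ hab
      exact mul_left_cancel hab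
    · intro g hg
      simp only [Finset.mem_filter, Finset.mem_univ, true_and] at hg
      refine ⟨k⁻¹ * g, ?_, by simp⟩
      simp only [Finset.mem_filter, Finset.mem_univ, true_and]
      rw [mul_smul, hg, ← hk, inv_smul_smul]
  have hsum := Finset.card_eq_sum_card_fiberwise (s := (Finset.univ : Finset G))
    (t := (Finset.univ : Finset X)) (f := fun g => g • x) (fun _ _ => Finset.mem_coe.2
      (Finset.mem_univ _))
  rw [Finset.sum_congr rfl fun z _ => h z, Finset.sum_const, Finset.card_univ, Finset.card_univ,
    smul_eq_mul, mul_comm] at hsum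
  exact hsum.symm

/-- Averaging over a transitive group: some translate of `B` meets `B` in at most
`|B|² / |X|` points. -/
theorem exists_card_filter_smul_mem_mul_card_le {G X : Type*} [Group G] [Fintype G] [Fintype X]
    [DecidableEq X] [MulAction G X] [MulAction.IsPretransitive G X] (B : Finset X) :
    ∃ g : G, (B.filter fun x => g • x ∈ B).card * Fintype.card X ≤ B.card ^ 2 := by
  have key : ∑ g : G, (B.filter fun x => g • x ∈ B).card * Fintype.card X
      = ∑ _g : G, B.card ^ 2 := by
    have h1 : ∀ g : G, (B.filter fun x => g • x ∈ B).card
        = ∑ x ∈ B, ∑ y ∈ B, if g • x = y then 1 else 0 := by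
      intro g
      rw [Finset.card_filter]
      exact Finset.sum_congr rfl fun x _ => by rw [Finset.sum_ite_eq]
    have h2 : ∀ x y : X, (∑ g : G, if g • x = y then 1 else 0) * Fintype.card X
        = Fintype.card G := by
      intro x y
      rw [← Finset.card_filter, card_filter_smul_eq_mul_card]
    calc ∑ g : G, (B.filter fun x => g • x ∈ B).card * Fintype.card X
        = (∑ g : G, ∑ x ∈ B, ∑ y ∈ B, if g • x = y then 1 else 0) * Fintype.card X := by
          rw [← Finset.sum_mul, Finset.sum_congr rfl fun g _ => h1 g]
      _ = (∑ x ∈ B, ∑ y ∈ B, ∑ g : G, if g • x = y then 1 else 0) * Fintype.card X := by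
          rw [Finset.sum_comm]
          exact congrArg (· * _) (Finset.sum_congr rfl fun x _ => Finset.sum_comm)
      _ = ∑ x ∈ B, ∑ y ∈ B, Fintype.card G := by
          rw [Finset.sum_mul]
          refine Finset.sum_congr rfl fun x _ => ?_
          rw [Finset.sum_mul]
          exact Finset.sum_congr rfl fun y _ => h2 x y
      _ = ∑ _g : G, B.card ^ 2 := by
          simp only [Finset.sum_const, smul_eq_mul, Finset.card_univ]
          ring
  obtain ⟨g, -, hg⟩ := Finset.exists_le_of_sum_le Finset.univ_nonempty key.le
  exact ⟨g, hg⟩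

/-- In a transitive group, some `k` elements generate a subgroup whose orbit through `x₀` misses
at most a fraction `(1 - 1 / |X|) ^ 2 ^ k` of the points. -/
theorem exists_finset_card_compl_orbit_le {G X : Type*} [Group G] [Fintype G] [Fintype X]
    [DecidableEq X] [MulAction G X] [MulAction.IsPretransitive G X] (x₀ : X) (k : ℕ) :
    ∃ S : Finset G, S.card ≤ k ∧ ∃ B : Finset X,
      (B.card : ℝ) / Fintype.card X ≤ (1 - 1 / (Fintype.card X : ℝ)) ^ 2 ^ k ∧
      ∀ x, x ∉ B → x ∈ MulAction.orbit (Subgroup.closure (S : Set G)) x₀ := by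
  classical
  have hn : (0 : ℝ) < Fintype.card X := by
    exact_mod_cast Fintype.card_pos_iff.2 ⟨x₀⟩
  induction k with
  | zero =>
    refine ⟨∅, by simp, {x₀}ᶜ, ?_, ?_⟩
    · rw [Finset.card_compl, Finset.card_singleton,
        Nat.cast_sub (Fintype.card_pos_iff.2 ⟨x₀⟩)]
      simp [sub_div, div_self hn.ne']
    · intro x hx
      have : x = x₀ := by simpa using hx
      rw [this]
      exact MulAction.mem_orbit_self x₀
  | succ k ih =>
    obtain ⟨S, hS, B, hB, hO⟩ := ih
    obtain ⟨g, hg⟩ := exists_card_filter_smul_mem_mul_card_le (G := G) B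
    refine ⟨insert g S, (Finset.card_insert_le _ _).trans (by omega),
      B.filter fun x => g • x ∈ B, ?_, ?_⟩
    · have hg' : ((B.filter fun x => g • x ∈ B).card : ℝ) * Fintype.card X ≤ (B.card : ℝ) ^ 2 := by
        exact_mod_cast hg
      calc ((B.filter fun x => g • x ∈ B).card : ℝ) / Fintype.card X
          ≤ ((B.card : ℝ) / Fintype.card X) ^ 2 := by
            rw [div_pow, div_le_div_iff₀ hn (by positivity)]
            nlinarith
        _ ≤ ((1 - 1 / (Fintype.card X : ℝ)) ^ 2 ^ k) ^ 2 := by gcongr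
        _ = _ := by rw [← pow_mul, ← pow_succ]
    · have hle : Subgroup.closure (S : Set G) ≤
          Subgroup.closure ((insert g S : Finset G) : Set G) :=
        Subgroup.closure_mono (by simp)
      have hmono : ∀ y, y ∉ B →
          y ∈ MulAction.orbit (Subgroup.closure ((insert g S : Finset G) : Set G)) x₀ := by
        intro y hy
        obtain ⟨⟨h, hh⟩, rfl⟩ := hO y hy
        exact ⟨⟨h, hle hh⟩, rfl⟩
      intro x hx
      by_cases hxB : x ∈ B
      · have hgx : g • x ∉ B := fun h => hx (Finset.mem_filter.2 ⟨hxB, h⟩)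
        obtain ⟨⟨h, hh⟩, hhx⟩ := hmono _ hgx
        have hgS : g ∈ Subgroup.closure ((insert g S : Finset G) : Set G) :=
          Subgroup.subset_closure (by simp)
        refine ⟨⟨g⁻¹ * h, mul_mem (inv_mem hgS) hh⟩, ?_⟩
        change h • x₀ = g • x at hhx
        change (g⁻¹ * h) • x₀ = x
        rw [mul_smul, hhx, inv_smul_smul]
      · exact hmono x hxB

/-- A transitive group on `X` has a transitive subgroup generated by `k` elements as soon as
`|X|² ≤ 2 ^ k`. -/
theorem exists_finset_card_le_orbit_closure_eq_univ {G X : Type*} [Group G] [Fintype G]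
    [Fintype X] [MulAction G X] [MulAction.IsPretransitive G X] (x₀ : X) (k : ℕ)
    (hk : Fintype.card X ^ 2 ≤ 2 ^ k) :
    ∃ S : Finset G, S.card ≤ k ∧
      ∀ x, x ∈ MulAction.orbit (Subgroup.closure (S : Set G)) x₀ := by
  classical
  obtain ⟨S, hS, B, hB, hO⟩ := exists_finset_card_compl_orbit_le (G := G) x₀ k
  refine ⟨S, hS, fun x => hO x ?_⟩
  have hpos : 0 < Fintype.card X := Fintype.card_pos_iff.2 ⟨x₀⟩
  set n := Fintype.card X
  have hn : (0 : ℝ) < n := by exact_mod_cast hpos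
  have hn1 : (1 : ℝ) ≤ n := by exact_mod_cast hpos
  have hk' : (n : ℝ) ^ 2 ≤ 2 ^ k := by exact_mod_cast hk
  have h1 : (1 - 1 / (n : ℝ)) ^ 2 ^ k ≤ Real.exp (-n) := by
    calc (1 - 1 / (n : ℝ)) ^ 2 ^ k ≤ (Real.exp (-(1 / n))) ^ 2 ^ k := by
          gcongr
          · rw [sub_nonneg, div_le_one hn]
            exact hn1
          · exact Real.one_sub_le_exp_neg _
      _ = Real.exp (-(2 ^ k / n)) := by
          rw [← Real.exp_nat_mul]
          congr 1
          push_cast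
          ring
      _ ≤ Real.exp (-n) := by
          rw [Real.exp_le_exp, neg_le_neg_iff, le_div_iff₀ hn]
          nlinarith
  have h2 : (B.card : ℝ) < 1 := by
    have h3 := hB.trans h1
    rw [div_le_iff₀ hn] at h3
    refine h3.trans_lt ?_
    rw [Real.exp_neg, inv_mul_lt_iff₀ (Real.exp_pos _), mul_one]
    linarith [Real.add_one_le_exp (n : ℝ)]
  have h4 : B.card = 0 := by
    have : B.card < 1 := by exact_mod_cast h2
    omega
  simp [Finset.card_eq_zero.1 h4]

/-- If the finite set `S` generates a transitive group on `X`, at most `|X| * |M| ^ |S|`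
permutations conjugate all of `S` into `M`. -/
theorem ncard_conj_mem_le {X : Type*} [Finite X] (M : Subgroup (Equiv.Perm X))
    (S : Finset (Equiv.Perm X)) (x₀ : X)
    (hS : ∀ x, x ∈ MulAction.orbit (Subgroup.closure (S : Set (Equiv.Perm X))) x₀) :
    {σ : Equiv.Perm X | ∀ s ∈ S, σ⁻¹ * s * σ ∈ M}.ncard ≤ Nat.card X * Nat.card M ^ S.card := by
  let T := {σ : Equiv.Perm X | ∀ s ∈ S, σ⁻¹ * s * σ ∈ M}
  let f : T → X × (S → M) :=
    fun σ => (σ.1⁻¹ x₀, fun s => ⟨σ.1⁻¹ * s.1 * σ.1, σ.2 s.1 s.2⟩)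
  have hf : Function.Injective f := by
    rintro ⟨σ, hσ⟩ ⟨τ, hτ⟩ h
    simp only [f, Prod.mk.injEq] at h
    obtain ⟨hx, hs⟩ := h
    have hcomm : Subgroup.closure (S : Set (Equiv.Perm X)) ≤
        Subgroup.centralizer {τ * σ⁻¹} := by
      rw [Subgroup.closure_le]
      intro s hsS
      have h1 : σ⁻¹ * s * σ = τ⁻¹ * s * τ := congrArg Subtype.val (congrFun hs ⟨s, hsS⟩)
      rw [SetLike.mem_coe, Subgroup.mem_centralizer_singleton_iff]
      calc s * (τ * σ⁻¹) = τ * (τ⁻¹ * s * τ) * σ⁻¹ := by group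
        _ = τ * (σ⁻¹ * s * σ) * σ⁻¹ := by rw [h1]
        _ = τ * σ⁻¹ * s := by group
    have hfix : (τ * σ⁻¹) x₀ = x₀ := by
      rw [Equiv.Perm.mul_apply, hx, ← Equiv.Perm.mul_apply, mul_inv_cancel, Equiv.Perm.one_apply]
    have hone : τ * σ⁻¹ = 1 := by
      ext x
      obtain ⟨⟨h, hh⟩, hhx⟩ := hS x
      change h x₀ = x at hhx
      have hc := Subgroup.mem_centralizer_singleton_iff.1 (hcomm hh)
      rw [← hhx, ← Equiv.Perm.mul_apply, ← hc, Equiv.Perm.mul_apply, hfix, Equiv.Perm.one_apply]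
    exact Subtype.ext (mul_inv_eq_one.1 hone).symm
  have hcard := Nat.card_le_card_of_injective f hf
  rw [Nat.card_prod, Nat.card_fun, Nat.card_eq_fintype_card (α := S), Fintype.card_coe] at hcard
  rwa [← Nat.card_coe_set_eq]

/-- A transitive group `G` of degree `n` lies in at most `|M| ^ (k + 1)` conjugates of `M`, for
every `k` with `n² ≤ 2 ^ k`. -/
theorem ncard_conj_containing_transitive_le {X : Type*} [Fintype X] [Nonempty X]
    (G M : Subgroup (Equiv.Perm X)) [MulAction.IsPretransitive G X] (k : ℕ)
    (hk : Fintype.card X ^ 2 ≤ 2 ^ k) :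
    {M' : Subgroup (Equiv.Perm X) |
      (∃ σ : Equiv.Perm X, M' = Subgroup.map (MulAut.conj σ).toMonoidHom M) ∧ G ≤ M'}.ncard ≤
      Nat.card M ^ (k + 1) := by
  classical
  obtain ⟨x₀⟩ := ‹Nonempty X›
  set A := {M' : Subgroup (Equiv.Perm X) |
      (∃ σ : Equiv.Perm X, M' = Subgroup.map (MulAut.conj σ).toMonoidHom M) ∧ G ≤ M'}
  rcases A.eq_empty_or_nonempty with h0 | ⟨M₁, ⟨σ₁, rfl⟩, hM₁⟩
  · simp [h0]
  have hXM : Nat.card X ≤ Nat.card M := by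
    calc Nat.card X ≤ Nat.card G :=
          Nat.card_le_card_of_surjective (fun g : G => g • x₀) (MulAction.surjective_smul G x₀)
      _ ≤ Nat.card (Subgroup.map (MulAut.conj σ₁).toMonoidHom M) :=
          Subgroup.card_le_of_le hM₁
      _ = Nat.card M := Subgroup.card_map_of_injective (MulAut.conj σ₁).injective
  obtain ⟨S, hSk, hS⟩ := exists_finset_card_le_orbit_closure_eq_univ (G := G) x₀ k hk
  let S' : Finset (Equiv.Perm X) := S.image Subtype.val
  have hS' : ∀ x, x ∈ MulAction.orbit (Subgroup.closure (S' : Set (Equiv.Perm X))) x₀ := by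
    intro x
    obtain ⟨⟨h, hh⟩, hhx⟩ := hS x
    refine ⟨⟨h.1, ?_⟩, hhx⟩
    have : (S' : Set (Equiv.Perm X)) = Set.image G.subtype (S : Set G) := by simp [S']
    rw [this, ← MonoidHom.map_closure]
    exact Subgroup.mem_map_of_mem _ hh
  have hsub : A ⊆ Set.image (fun σ : Equiv.Perm X => Subgroup.map (MulAut.conj σ).toMonoidHom M)
      {σ : Equiv.Perm X | ∀ s ∈ S', σ⁻¹ * s * σ ∈ M} := by
    rintro _ ⟨⟨σ, rfl⟩, hG⟩
    refine ⟨σ, fun s hs => ?_, rfl⟩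
    obtain ⟨g, -, rfl⟩ := Finset.mem_image.1 hs
    obtain ⟨m, hm, hmg⟩ := hG g.2
    have : σ * m * σ⁻¹ = g := hmg
    rw [← this]
    simpa [mul_assoc] using hm
  have hMpos : 0 < Nat.card M := Nat.card_pos
  calc A.ncard ≤ _ := Set.ncard_le_ncard hsub (Set.toFinite _)
    _ ≤ _ := Set.ncard_image_le (Set.toFinite _)
    _ ≤ Nat.card X * Nat.card M ^ S'.card := ncard_conj_mem_le M S' x₀ hS'
    _ ≤ Nat.card M * Nat.card M ^ k :=
        Nat.mul_le_mul hXM (Nat.pow_le_pow_right hMpos (Finset.card_image_le.trans hSk))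
    _ = Nat.card M ^ (k + 1) := by ring

theorem few_conjugates_of_maximal_containing_primitive :
    ∃ c : ℝ, 0 < c ∧ ∀ (X : Type) [Fintype X] [DecidableEq X],
      2 ≤ Fintype.card X →
      ∀ G : Subgroup (Equiv.Perm X), IsPrimitiveSubgroup G →
        ∀ M : Subgroup (Equiv.Perm X), IsMaximalSubgroup M →
          (Set.ncard {M' : Subgroup (Equiv.Perm X) |
              (∃ σ : Equiv.Perm X, M' = Subgroup.map (MulAut.conj σ).toMonoidHom M) ∧
              G ≤ M'} : ℝ) ≤
            (c * (Nat.card M : ℝ)) ^ (c * (Real.log (Fintype.card X)) ^ 2) := by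
  refine ⟨100, by norm_num, fun X _ _ hX G hG M _ => ?_⟩
  have : MulAction.IsPretransitive G X := hG.1
  have : Nonempty X := Fintype.card_pos_iff.1 (by omega)
  have hbound := ncard_conj_containing_transitive_le G M (2 * Nat.clog 2 (Fintype.card X)) (by
    rw [mul_comm 2, pow_mul]
    exact Nat.pow_le_pow_left (Nat.le_pow_clog one_lt_two _) 2)
  set n := Fintype.card X
  have hM : (1 : ℝ) ≤ Nat.card M := by exact_mod_cast (Nat.card_pos : 0 < Nat.card M)
  have hlog2 : 0.69 < Real.log 2 := by linarith [Real.log_two_gt_d9]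
  have hlogn : Real.log 2 ≤ Real.log n :=
    Real.log_le_log (by norm_num) (by exact_mod_cast hX)
  have hclog : ((Nat.clog 2 n : ℝ) - 1) * Real.log 2 ≤ Real.log n := by
    have h1 : 2 ^ (Nat.clog 2 n).pred < n := Nat.pow_pred_clog_lt_self one_lt_two (by omega)
    have h2 : ((2 : ℝ) ^ (Nat.clog 2 n).pred) ≤ n := by exact_mod_cast h1.le
    have h3 := Real.log_le_log (by positivity) h2
    rw [Real.log_pow, Nat.pred_eq_sub_one,
      Nat.cast_sub (Nat.clog_pos one_lt_two hX), Nat.cast_one] at h3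
    exact h3
  have hexp : ((2 * Nat.clog 2 n + 1 : ℕ) : ℝ) ≤ 100 * Real.log n ^ 2 := by
    push_cast
    by_cases hc : (Nat.clog 2 n : ℝ) ≤ 1
    all_goals nlinarith
  calc _ ≤ ((Nat.card M : ℝ)) ^ (2 * Nat.clog 2 n + 1) := by exact_mod_cast hbound
    _ = (Nat.card M : ℝ) ^ ((2 * Nat.clog 2 n + 1 : ℕ) : ℝ) := (Real.rpow_natCast _ _).symm
    _ ≤ (Nat.card M : ℝ) ^ (100 * Real.log n ^ 2) := Real.rpow_le_rpow_of_exponent_le hM hexp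
    _ ≤ _ := Real.rpow_le_rpow (by positivity) (by linarith) (by positivity)
end
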